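/- There exist constants c > 0 and N_0 such that for all integers N > N_0, every subset S ⊆ {1, 2, ..., N} containing no three-term arithmetic progression satisfies |S| ≤ N · exp(−c·(log N)^{1/11}). -/

import Mathlib

open Finset

set_option linter.unusedSectionVars false

section BohrNorm

variable {G : Type*} [AddCommGroup G] [Fintype G]

/-- The size of `x` as seen by the characters in `Γ`. -/
noncomputable def bohrNorm (Γ : Finset (AddChar G ℂ)) (x : G) : ℝ := ∑ γ ∈ Γ, ‖1 - γ x‖

lemma norm_one_sub_addChar_add_le (γ : AddChar G ℂ) (x y : G) :
    ‖1 - γ (x + y)‖ ≤ ‖1 - γ x‖ + ‖1 - γ y‖ := by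
  have h : 1 - γ (x + y) = (1 - γ x) + γ x * (1 - γ y) := by
    rw [AddChar.map_add_eq_mul]; ring
  rw [h]
  refine (norm_add_le _ _).trans ?_
  simp

lemma norm_one_sub_addChar_neg (γ : AddChar G ℂ) (x : G) : ‖1 - γ (-x)‖ = ‖1 - γ x‖ := by
  have h : 1 - γ x = - (γ x * (1 - γ (-x))) := by
    rw [mul_sub, ← AddChar.map_add_eq_mul]; simp
  rw [h, norm_neg, norm_mul]
  simp

lemma bohrNorm_nonneg (Γ : Finset (AddChar G ℂ)) (x : G) : 0 ≤ bohrNorm Γ x :=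
  sum_nonneg fun _ _ => norm_nonneg _

@[simp] lemma bohrNorm_neg (Γ : Finset (AddChar G ℂ)) (x : G) :
    bohrNorm Γ (-x) = bohrNorm Γ x := by
  simp [bohrNorm, norm_one_sub_addChar_neg]

@[simp] lemma bohrNorm_empty (x : G) : bohrNorm (∅ : Finset (AddChar G ℂ)) x = 0 := by
  simp [bohrNorm]

lemma bohrNorm_add_le (Γ : Finset (AddChar G ℂ)) (x y : G) :
    bohrNorm Γ (x + y) ≤ bohrNorm Γ x + bohrNorm Γ y := by
  rw [bohrNorm, bohrNorm, bohrNorm, ← sum_add_distrib]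
  exact sum_le_sum fun γ _ => norm_one_sub_addChar_add_le γ x y

lemma bohrNorm_sub_le (Γ : Finset (AddChar G ℂ)) (x y : G) :
    bohrNorm Γ (x - y) ≤ bohrNorm Γ x + bohrNorm Γ y := by
  simpa [sub_eq_add_neg] using bohrNorm_add_le Γ x (-y)

lemma bohrNorm_mono {Γ Γ' : Finset (AddChar G ℂ)} (h : Γ ⊆ Γ') (x : G) :
    bohrNorm Γ x ≤ bohrNorm Γ' x :=
  sum_le_sum_of_subset_of_nonneg h fun _ _ _ => norm_nonneg _

/-- The total mass of the unnormalised exponential weight. -/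
noncomputable def bohrMass (Γ : Finset (AddChar G ℂ)) (c : ℝ) : ℝ :=
  ∑ x, Real.exp (-(c * bohrNorm Γ x))

/-- The exponential weight attached to a set of characters, a smooth analogue of the uniform
measure on a Bohr set of width `1 / c`. -/
noncomputable def bohrWeight (Γ : Finset (AddChar G ℂ)) (c : ℝ) (x : G) : ℝ :=
  Real.exp (-(c * bohrNorm Γ x)) / bohrMass Γ c

lemma bohrMass_pos (Γ : Finset (AddChar G ℂ)) (c : ℝ) : 0 < bohrMass Γ c :=
  sum_pos (fun _ _ => Real.exp_pos _) univ_nonempty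

lemma bohrWeight_pos (Γ : Finset (AddChar G ℂ)) (c : ℝ) (x : G) : 0 < bohrWeight Γ c x :=
  div_pos (Real.exp_pos _) (bohrMass_pos Γ c)

lemma sum_bohrWeight (Γ : Finset (AddChar G ℂ)) (c : ℝ) : ∑ x, bohrWeight Γ c x = 1 := by
  simp only [bohrWeight]
  rw [← sum_div]
  exact div_self (bohrMass_pos Γ c).ne'

@[simp] lemma bohrWeight_neg (Γ : Finset (AddChar G ℂ)) (c : ℝ) (x : G) :
    bohrWeight Γ c (-x) = bohrWeight Γ c x := by
  simp [bohrWeight]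

lemma bohrWeight_le_inv_mass (Γ : Finset (AddChar G ℂ)) {c : ℝ} (hc : 0 ≤ c) (x : G) :
    bohrWeight Γ c x ≤ 1 / bohrMass Γ c := by
  rw [bohrWeight]
  gcongr
  · exact (bohrMass_pos Γ c).le
  · have := mul_nonneg hc (bohrNorm_nonneg Γ x)
    simpa using this

lemma bohrWeight_add_le (Γ : Finset (AddChar G ℂ)) {c : ℝ} (hc : 0 ≤ c) (x t : G) :
    bohrWeight Γ c (x + t) ≤ Real.exp (c * bohrNorm Γ t) * bohrWeight Γ c x := by
  have hZ := bohrMass_pos Γ c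
  rw [bohrWeight, bohrWeight, ← mul_div_assoc, ← Real.exp_add]
  gcongr
  have h := bohrNorm_sub_le Γ (x + t) t
  rw [add_sub_cancel_right] at h
  nlinarith

lemma bohrWeight_sub_le (Γ : Finset (AddChar G ℂ)) {c : ℝ} (hc : 0 ≤ c) (x t : G) :
    bohrWeight Γ c (x - t) ≤ Real.exp (c * bohrNorm Γ t) * bohrWeight Γ c x := by
  simpa [sub_eq_add_neg] using bohrWeight_add_le Γ hc x (-t)

lemma le_bohrWeight_add (Γ : Finset (AddChar G ℂ)) {c : ℝ} (hc : 0 ≤ c) (x t : G) :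
    Real.exp (-(c * bohrNorm Γ t)) * bohrWeight Γ c x ≤ bohrWeight Γ c (x + t) := by
  have h := bohrWeight_sub_le Γ hc (x + t) t
  rw [add_sub_cancel_right] at h
  rw [Real.exp_neg, inv_mul_le_iff₀ (Real.exp_pos _)]
  exact h

lemma bohrWeight_sq_sum (Γ : Finset (AddChar G ℂ)) (c : ℝ) (x : G) :
    bohrWeight Γ c x ^ 2 = (∑ y, bohrWeight Γ c y ^ 2) * bohrWeight Γ (2 * c) x := by
  have hZ := (bohrMass_pos Γ c).ne'
  have hZ2 := (bohrMass_pos Γ (2 * c)).ne'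
  have h : ∀ y, bohrWeight Γ c y ^ 2 = Real.exp (-(2 * c * bohrNorm Γ y)) / bohrMass Γ c ^ 2 := by
    intro y
    rw [bohrWeight, div_pow, ← Real.exp_nat_mul]
    congr 2
    push_cast
    ring
  simp_rw [h]
  rw [← sum_div]
  change _ = bohrMass Γ (2 * c) / _ * _
  rw [bohrWeight]
  field_simp

end BohrNorm

section Doubling

variable {G : Type*} [AddCommGroup G] [Fintype G]

/-- The cell of the torus containing `(γ x)_γ`, for cells of side `1 / c`. -/
noncomputable def torusCell (c : ℝ) (γ : AddChar G ℂ) (x : G) : ℤ := ⌊c * (γ x).arg⌋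

lemma norm_sub_le_abs_arg_sub {z w : ℂ} (hz : ‖z‖ = 1) (hw : ‖w‖ = 1) :
    ‖z - w‖ ≤ |z.arg - w.arg| := by
  have h1 : z = Complex.exp (z.arg * Complex.I) := by
    conv_lhs => rw [← Complex.norm_mul_exp_arg_mul_I z, hz]
    simp
  have h2 : w = Complex.exp (w.arg * Complex.I) := by
    conv_lhs => rw [← Complex.norm_mul_exp_arg_mul_I w, hw]
    simp
  have h3 : z - w = Complex.exp (w.arg * Complex.I) *
      (Complex.exp (Complex.I * ((z.arg - w.arg : ℝ) : ℂ)) - 1) := by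
    rw [mul_sub, ← Complex.exp_add, mul_one, ← h2]
    congr 1
    conv_lhs => rw [h1]
    congr 1
    push_cast
    ring
  rw [h3, norm_mul, Complex.norm_exp_ofReal_mul_I, one_mul]
  exact Real.norm_exp_I_mul_ofReal_sub_one_le

lemma norm_one_sub_addChar_le_of_torusCell_eq {c : ℝ} (hc : 0 < c) {γ : AddChar G ℂ} {x y : G}
    (h : torusCell c γ x = torusCell c γ y) : ‖1 - γ (x - y)‖ ≤ 1 / c := by
  have h1 : ‖γ x - γ y‖ ≤ 1 / c := by
    refine (norm_sub_le_abs_arg_sub (by simp) (by simp)).trans ?_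
    have := Int.abs_sub_lt_one_of_floor_eq_floor h
    rw [← mul_sub, abs_mul, abs_of_pos hc] at this
    rw [le_div_iff₀ hc]
    linarith
  have h2 : γ x - γ y = - (γ y * (1 - γ (x - y))) := by
    rw [mul_sub, ← AddChar.map_add_eq_mul]; simp
  rw [h2, norm_neg, norm_mul] at h1
  simpa using h1

lemma abs_torusCell_le (c : ℝ) (hc : 0 < c) (γ : AddChar G ℂ) (x : G) :
    |(torusCell c γ x : ℝ)| ≤ 1 + c * 4 ∧
      |(torusCell c γ x : ℝ)| ≤ 1 + c * (2 * ‖1 - γ x‖) := by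
  have h1 : |(torusCell c γ x : ℝ)| ≤ 1 + c * |(γ x).arg| := by
    rw [← abs_of_pos hc, ← abs_mul, abs_of_pos hc]
    have ha := Int.floor_le (c * (γ x).arg)
    have hb := Int.lt_floor_add_one (c * (γ x).arg)
    have hd := le_abs_self (c * (γ x).arg)
    have he := neg_abs_le (c * (γ x).arg)
    rw [torusCell, abs_le]
    constructor <;> linarith
  have h2 : |(γ x).arg| ≤ 4 :=
    (Complex.abs_arg_le_pi _).trans (by linarith [Real.pi_lt_four])
  have h3 : |(γ x).arg| ≤ 2 * ‖1 - γ x‖ := by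
    have hne : γ x ≠ 0 := by
      intro h0
      have : ‖γ x‖ = 1 := by simp
      simp [h0] at this
    have h := Complex.angle_le_mul_norm_sub (x := 1) (y := γ x) (by simp) (by simp)
    rw [Complex.angle_one_left hne] at h
    have := Real.pi_lt_four
    exact h.trans (by gcongr; linarith)
  constructor
  · exact h1.trans (by gcongr)
  · exact h1.trans (by gcongr)

lemma card_torusCell_fiber_le (Γ : Finset (AddChar G ℂ)) {c : ℝ} (hc : 0 < c) (j : Γ → ℤ) :
    (#{x : G | (fun γ : Γ => torusCell c γ.1 x) = j} : ℝ) ≤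
      Real.exp #Γ * bohrMass Γ c := by
  classical
  set F : Finset G := {x : G | (fun γ : Γ => torusCell c γ.1 x) = j} with hF
  rcases F.eq_empty_or_nonempty with h0 | ⟨y, hy⟩
  · rw [h0]
    simpa using mul_nonneg (Real.exp_pos _).le (bohrMass_pos Γ c).le
  have hy' : (fun γ : Γ => torusCell c γ.1 y) = j := by simpa [hF] using hy
  have h1 : ∀ x ∈ F, Real.exp (-#Γ) ≤ Real.exp (-(c * bohrNorm Γ (x - y))) := by
    intro x hx
    have hx' : (fun γ : Γ => torusCell c γ.1 x) = j := by simpa [hF] using hx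
    have h2 : bohrNorm Γ (x - y) ≤ #Γ * (1 / c) := by
      rw [bohrNorm, ← nsmul_eq_mul]
      refine sum_le_card_nsmul _ _ _ fun γ hγ => ?_
      exact norm_one_sub_addChar_le_of_torusCell_eq hc (congrFun (hx'.trans hy'.symm) ⟨γ, hγ⟩)
    have h3 : c * bohrNorm Γ (x - y) ≤ #Γ := by
      calc _ ≤ c * (#Γ * (1 / c)) := by gcongr
        _ = _ := by field_simp
    gcongr
  have h4 : (#F : ℝ) * Real.exp (-#Γ) ≤ bohrMass Γ c := by
    rw [← nsmul_eq_mul]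
    refine (card_nsmul_le_sum _ _ _ h1).trans ?_
    refine (sum_le_univ_sum_of_nonneg fun x => (Real.exp_pos _).le).trans ?_
    rw [bohrMass]
    exact (Equiv.sum_comp (Equiv.subRight y) fun x => Real.exp (-(c * bohrNorm Γ x))).le
  rw [Real.exp_neg, ← div_eq_mul_inv, div_le_iff₀ (Real.exp_pos _)] at h4
  linarith

lemma summable_exp_neg_abs_int : Summable fun j : ℤ => Real.exp (-((|(j : ℝ)| - 1) / 4)) := by
  have h : ∀ n : ℕ, Real.exp (-((n - 1) / 4)) = Real.exp (1 / 4) * Real.exp (-(1 / 4)) ^ n := by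
    intro n
    rw [← Real.exp_nat_mul, ← Real.exp_add]
    congr 1
    ring
  have hs : Summable fun n : ℕ => Real.exp (-(((n : ℝ) - 1) / 4)) := by
    simp_rw [h]
    refine (summable_geometric_of_lt_one (Real.exp_pos _).le ?_).mul_left _
    rw [Real.exp_lt_one_iff]
    norm_num
  refine Summable.of_nat_of_neg ?_ ?_ <;> simpa using hs

/-- The constant in the doubling estimate for exponential weights. -/
noncomputable def bohrConst : ℝ :=
  4 + |Real.log (∑' j : ℤ, Real.exp (-((|(j : ℝ)| - 1) / 4)))|

lemma four_le_bohrConst : 4 ≤ bohrConst := by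
  have := abs_nonneg (Real.log (∑' j : ℤ, Real.exp (-((|(j : ℝ)| - 1) / 4))))
  rw [bohrConst]
  linarith

lemma exp_one_mul_tsum_le :
    Real.exp 1 * ∑' j : ℤ, Real.exp (-((|(j : ℝ)| - 1) / 4)) ≤ Real.exp bohrConst := by
  have hpos : 0 < ∑' j : ℤ, Real.exp (-((|(j : ℝ)| - 1) / 4)) :=
    summable_exp_neg_abs_int.tsum_pos (fun _ => (Real.exp_pos _).le) 0 (Real.exp_pos _)
  rw [bohrConst, Real.exp_add]
  gcongr
  · norm_num
  · nth_rw 1 [← Real.exp_log hpos]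
    gcongr
    exact le_abs_self _

lemma torusCell_mem_piFinset (Γ : Finset (AddChar G ℂ)) {c : ℝ} (hc : 0 < c) (x : G) :
    (fun γ : Γ => torusCell c γ.1 x) ∈
      Fintype.piFinset fun _ : Γ => Icc (-⌈1 + c * 4⌉) ⌈1 + c * 4⌉ := by
  rw [Fintype.mem_piFinset]
  intro γ
  have h := (abs_torusCell_le c hc γ.1 x).1
  rw [mem_Icc, ← abs_le]
  have h2 := h.trans (Int.le_ceil _)
  exact_mod_cast h2

lemma bohrMass_half_le (Γ : Finset (AddChar G ℂ)) {c : ℝ} (hc : 0 < c) :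
    bohrMass Γ (c / 2) ≤ Real.exp (bohrConst * #Γ) * bohrMass Γ c := by
  classical
  set T : Finset ℤ := Icc (-⌈1 + c * 4⌉) ⌈1 + c * 4⌉ with hT
  set J : G → (Γ → ℤ) := fun x γ => torusCell c γ.1 x with hJ
  set w : ℤ → ℝ := fun j => Real.exp (-((|(j : ℝ)| - 1) / 4)) with hw
  have hmem : ∀ x ∈ (univ : Finset G), J x ∈ Fintype.piFinset fun _ : Γ => T :=
    fun x _ => torusCell_mem_piFinset Γ hc x
  have h1 : ∀ x, Real.exp (-(c / 2 * bohrNorm Γ x)) ≤ ∏ γ : Γ, w (J x γ) := by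
    intro x
    rw [← Real.exp_sum, Real.exp_le_exp, sum_neg_distrib, neg_le_neg_iff, bohrNorm, mul_sum,
      ← sum_coe_sort Γ]
    refine sum_le_sum fun γ _ => ?_
    have := (abs_torusCell_le c hc γ.1 x).2
    simp only [hJ]
    linarith
  have hmass := bohrMass_pos Γ c
  calc bohrMass Γ (c / 2) = ∑ x, Real.exp (-(c / 2 * bohrNorm Γ x)) := rfl
    _ ≤ ∑ x, ∏ γ : Γ, w (J x γ) := sum_le_sum fun x _ => h1 x
    _ = ∑ j ∈ Fintype.piFinset fun _ : Γ => T, ∑ x with J x = j, ∏ γ : Γ, w (J x γ) :=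
        (sum_fiberwise_of_maps_to hmem _).symm
    _ = ∑ j ∈ Fintype.piFinset fun _ : Γ => T, #{x | J x = j} * ∏ γ : Γ, w (j γ) := by
        refine sum_congr rfl fun j _ => ?_
        rw [← nsmul_eq_mul, ← sum_const]
        refine sum_congr rfl fun x hx => ?_
        rw [(mem_filter.1 hx).2]
    _ ≤ ∑ j ∈ Fintype.piFinset fun _ : Γ => T,
          (Real.exp #Γ * bohrMass Γ c) * ∏ γ : Γ, w (j γ) := by
        refine sum_le_sum fun j _ => ?_
        gcongr
        exact card_torusCell_fiber_le Γ hc j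
    _ = (Real.exp #Γ * bohrMass Γ c) * (∑ j ∈ T, w j) ^ #Γ := by
        rw [← mul_sum, ← prod_univ_sum (fun _ : Γ => T) fun _ j => w j]
        simp
    _ ≤ (Real.exp #Γ * bohrMass Γ c) * (∑' j, w j) ^ #Γ := by
        gcongr
        exact summable_exp_neg_abs_int.sum_le_tsum _ fun _ _ => (Real.exp_pos _).le
    _ = (Real.exp 1 * ∑' j, w j) ^ #Γ * bohrMass Γ c := by
        rw [mul_pow, ← Real.exp_nat_mul]
        ring_nf
    _ ≤ Real.exp bohrConst ^ #Γ * bohrMass Γ c := by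
        gcongr
        exact exp_one_mul_tsum_le
    _ = _ := by
        rw [← Real.exp_nat_mul]
        ring_nf

lemma card_le_mul_bohrMass (Γ : Finset (AddChar G ℂ)) {c : ℝ} (hc : 1 ≤ c) :
    (Fintype.card G : ℝ) ≤ (Real.exp bohrConst * c) ^ #Γ * bohrMass Γ c := by
  classical
  have hc0 : 0 < c := by linarith
  set T : Finset ℤ := Icc (-⌈1 + c * 4⌉) ⌈1 + c * 4⌉ with hT
  set J : G → (Γ → ℤ) := fun x γ => torusCell c γ.1 x with hJ
  have hmem : ∀ x ∈ (univ : Finset G), J x ∈ Fintype.piFinset fun _ : Γ => T :=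
    fun x _ => torusCell_mem_piFinset Γ hc0 x
  have hcard : (#T : ℝ) ≤ 13 * c := by
    have h1 : (#T : ℤ) = 2 * ⌈1 + c * 4⌉ + 1 := by
      have : 0 ≤ ⌈1 + c * 4⌉ := Int.ceil_nonneg (by positivity)
      rw [hT, Int.card_Icc, Int.toNat_of_nonneg (by linarith)]
      ring
    have h2 : (#T : ℝ) = 2 * (⌈1 + c * 4⌉ : ℝ) + 1 := by exact_mod_cast h1
    have h3 := Int.ceil_lt_add_one (1 + c * 4)
    linarith
  have hconst : Real.exp 1 * 13 ≤ Real.exp bohrConst := by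
    have h1 : Real.exp 4 ≤ Real.exp bohrConst := Real.exp_le_exp.2 four_le_bohrConst
    have h2 : Real.exp 4 = Real.exp 1 * Real.exp 1 ^ 3 := by
      rw [← Real.exp_nat_mul, ← Real.exp_add]
      norm_num
    have h3 : (13 : ℝ) ≤ Real.exp 1 ^ 3 := by
      have := Real.exp_one_gt_d9
      calc (13 : ℝ) ≤ 2.7 ^ 3 := by norm_num
        _ ≤ _ := by gcongr; linarith
    rw [h2] at h1
    exact (by gcongr : Real.exp 1 * 13 ≤ Real.exp 1 * Real.exp 1 ^ 3).trans h1
  have hmass := bohrMass_pos Γ c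
  calc (Fintype.card G : ℝ) = ∑ j ∈ Fintype.piFinset fun _ : Γ => T, (#{x | J x = j} : ℝ) := by
        rw [← card_univ, card_eq_sum_card_fiberwise hmem]
        push_cast
        rfl
    _ ≤ ∑ j ∈ Fintype.piFinset fun _ : Γ => T, Real.exp #Γ * bohrMass Γ c :=
        sum_le_sum fun j _ => card_torusCell_fiber_le Γ hc0 j
    _ = (#T : ℝ) ^ #Γ * (Real.exp #Γ * bohrMass Γ c) := by
        rw [sum_const, Fintype.card_piFinset, nsmul_eq_mul]
        simp
    _ ≤ (13 * c) ^ #Γ * (Real.exp #Γ * bohrMass Γ c) := by gcongr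
    _ = (Real.exp 1 * 13 * c) ^ #Γ * bohrMass Γ c := by
        rw [mul_assoc, mul_pow (Real.exp 1), ← Real.exp_nat_mul]
        ring_nf
    _ ≤ _ := by gcongr

/-- A much narrower exponential weight hardly sees the norm at the original scale. -/
lemma sum_bohrWeight_exp_sub_one_le (Γ : Finset (AddChar G ℂ)) {c R : ℝ} (hc : 0 < c) (hR : 1 ≤ R)
    {n : ℕ} (hn0 : 0 < n) (hn : 2 * bohrConst * #Γ * R ≤ n) :
    ∑ x, bohrWeight Γ (2 * n * c) x * (Real.exp (c * bohrNorm Γ x) - 1) ≤ 1 / R := by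
  have hnR : (0 : ℝ) < n := by exact_mod_cast hn0
  have hZ := bohrMass_pos Γ (2 * n * c)
  set E : ℝ := ∑ x, bohrWeight Γ (2 * n * c) x * Real.exp (c * bohrNorm Γ x) with hE
  have hE0 : 0 ≤ E := sum_nonneg fun x _ => mul_nonneg (bohrWeight_pos _ _ _).le (Real.exp_pos _).le
  have h1 : E ^ n ≤ ∑ x, bohrWeight Γ (2 * n * c) x * Real.exp (c * bohrNorm Γ x) ^ n :=
    Real.pow_arith_mean_le_arith_mean_pow _ _ _ (fun x _ => (bohrWeight_pos _ _ _).le)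
      (sum_bohrWeight _ _) (fun x _ => (Real.exp_pos _).le) n
  have h2 : ∑ x, bohrWeight Γ (2 * n * c) x * Real.exp (c * bohrNorm Γ x) ^ n =
      bohrMass Γ (2 * n * c / 2) / bohrMass Γ (2 * n * c) := by
    rw [bohrMass, sum_div]
    refine sum_congr rfl fun x _ => ?_
    rw [bohrWeight, ← Real.exp_nat_mul, div_mul_eq_mul_div, ← Real.exp_add]
    congr 2
    ring
  have h3 : E ^ n ≤ Real.exp (bohrConst * #Γ) := by
    rw [h2] at h1
    refine h1.trans ?_
    rw [div_le_iff₀ hZ]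
    exact bohrMass_half_le Γ (by positivity)
  have h4 : bohrConst * #Γ ≤ n * (1 / (2 * R)) := by
    rw [mul_one_div, le_div_iff₀ (by positivity)]
    linarith
  have h5 : E ^ n ≤ Real.exp (1 / (2 * R)) ^ n := by
    rw [← Real.exp_nat_mul]
    exact h3.trans (Real.exp_le_exp.2 h4)
  have h6 : E ≤ Real.exp (1 / (2 * R)) := le_of_pow_le_pow_left₀ hn0.ne' (Real.exp_pos _).le h5
  have h7 : Real.exp (1 / (2 * R)) ≤ 1 + 1 / R := by
    have h8 : |1 / (2 * R)| ≤ 1 := by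
      rw [abs_of_pos (by positivity), div_le_one (by positivity)]
      linarith
    have := Real.abs_exp_sub_one_le h8
    rw [abs_of_pos (by positivity : 0 < 1 / (2 * R))] at this
    have h9 := le_abs_self (Real.exp (1 / (2 * R)) - 1)
    have h10 : 2 * (1 / (2 * R)) = 1 / R := by field_simp
    linarith
  simp_rw [mul_sub, mul_one]
  rw [sum_sub_distrib, sum_bohrWeight]
  linarith

/-- The exponential weight truncated to the region where the coarser norm is at most one. -/
lemma exists_truncated_bohrWeight (Γ : Finset (AddChar G ℂ)) {c : ℝ} (hc : 0 < c)
    {n : ℕ} (hn0 : 0 < n) (hn : 4 * bohrConst * #Γ ≤ n) :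
    ∃ ρ : G → ℝ, (∀ x, 0 ≤ ρ x) ∧ ∑ x, ρ x = 1 ∧ (∀ x, ρ (-x) = ρ x) ∧
      (∀ x, ρ x ≤ 2 * bohrWeight Γ (2 * n * c) x) ∧ ∀ x, ρ x ≠ 0 → c * bohrNorm Γ x ≤ 1 := by
  classical
  set β := bohrWeight Γ (2 * n * c) with hβ
  have hβ0 : ∀ x, 0 < β x := bohrWeight_pos _ _
  have h1 := sum_bohrWeight_exp_sub_one_le Γ hc (R := 2) (by norm_num) hn0 (by linarith)
  obtain ⟨m, hm⟩ : ∃ m, m = ∑ x, if c * bohrNorm Γ x ≤ 1 then β x else 0 := ⟨_, rfl⟩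
  have h2 : 1 / 2 ≤ m := by
    have h3 : ∀ x, β x - β x * (Real.exp (c * bohrNorm Γ x) - 1) ≤
        if c * bohrNorm Γ x ≤ 1 then β x else 0 := by
      intro x
      have h4 := Real.add_one_le_exp (c * bohrNorm Γ x)
      have h5 := mul_nonneg hc.le (bohrNorm_nonneg Γ x)
      split_ifs with h
      · nlinarith [hβ0 x]
      · push Not at h
        nlinarith [hβ0 x]
    have h6 := sum_le_sum fun x (_ : x ∈ univ) => h3 x
    rw [sum_sub_distrib, sum_bohrWeight, ← hm] at h6
    linarith
  have hm0 : 0 < m := by linarith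
  refine ⟨fun x => (if c * bohrNorm Γ x ≤ 1 then β x else 0) / m, fun x => ?_, ?_, fun x => ?_,
    fun x => ?_, fun x hx => ?_⟩
  · refine div_nonneg ?_ hm0.le
    split_ifs
    exacts [(hβ0 x).le, le_rfl]
  · rw [← sum_div, ← hm]
    exact div_self hm0.ne'
  · simp only [hβ, bohrNorm_neg, bohrWeight_neg]
  · have h7 := hβ0 x
    rw [div_le_iff₀ hm0]
    split_ifs
    · nlinarith
    · exact mul_nonneg (by linarith) hm0.le
  · by_contra h
    simp [h] at hx

end Doubling

section Moments

variable {G : Type*} [AddCommGroup G] [Fintype G]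

lemma sum_mul_sum_pow (K F H : G → G → ℝ) (p : ℕ) :
    ∑ u, ∑ v, K u v * (∑ y, F y u * H y v) ^ p =
      ∑ y : Fin p → G, ∑ u, ∑ v, K u v * ((∏ i, F (y i) u) * ∏ i, H (y i) v) := by
  simp_rw [Fintype.sum_pow, mul_sum, prod_mul_distrib]
  rw [sum_comm' (t' := univ) (s' := fun _ => univ) (by simp)]
  rw [sum_comm]
  conv_rhs => rw [sum_comm]
  refine sum_congr rfl fun u _ => ?_
  conv_rhs => rw [sum_comm]

lemma sum_mul_corr_pow_eq (ρ f : G → ℝ) (p : ℕ) :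
    ∑ u, ∑ v, ρ u * ρ v * (∑ y, f (y + u) * f (y + v)) ^ p =
      ∑ y : Fin p → G, (∑ u, ρ u * ∏ i, f (y i + u)) ^ 2 := by
  rw [sum_mul_sum_pow (fun u v => ρ u * ρ v) (fun y u => f (y + u)) (fun y v => f (y + v))]
  refine sum_congr rfl fun y _ => ?_
  rw [sq, sum_mul_sum]
  refine sum_congr rfl fun u _ => sum_congr rfl fun v _ => by ring

lemma sum_corr_shift (f g : G → ℝ) (u v : G) :
    ∑ y, f (y + u) * g (y + v) = ∑ y, f y * g (y + (v - u)) := by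
  refine Fintype.sum_equiv (Equiv.addRight u) _ _ fun y => ?_
  simp only [Equiv.coe_addRight]
  congr 2
  abel

lemma sum_mul_corr_pow_nonneg (ρ f : G → ℝ) (p : ℕ) :
    0 ≤ ∑ u, ∑ v, ρ u * ρ v * (∑ y, f y * f (y + (v - u))) ^ p := by
  simp_rw [← sum_corr_shift]
  rw [sum_mul_corr_pow_eq]
  exact sum_nonneg fun _ _ => sq_nonneg _

lemma sum_mul_conv_pow_le (ρ f : G → ℝ) (hρ : ∀ x, ρ (-x) = ρ x) (s : G) (p : ℕ) :
    ∑ u, ∑ v, ρ u * ρ v * (∑ y, f y * f (s + v - u - y)) ^ p ≤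
      ∑ u, ∑ v, ρ u * ρ v * (∑ y, f y * f (y + (v - u))) ^ p := by
  simp_rw [← sum_corr_shift]
  rw [sum_mul_corr_pow_eq]
  set M : (Fin p → G) → ℝ := fun y => ∑ u, ρ u * ∏ i, f (y i + u) with hM
  have h1 : ∑ u, ∑ v, ρ u * ρ v * (∑ y, f y * f (s + v - u - y)) ^ p =
      ∑ y : Fin p → G, M y * M (fun i => s - y i) := by
    have h2 : ∑ u, ∑ v, ρ u * ρ v * (∑ y, f y * f (s + v - u - y)) ^ p =
        ∑ u, ∑ v, ρ u * ρ v * (∑ y, f (y + u) * f (s - y + v)) ^ p := by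
      refine Fintype.sum_equiv (Equiv.neg G) _ _ fun u => ?_
      simp only [Equiv.neg_apply, hρ]
      refine sum_congr rfl fun v _ => ?_
      congr 2
      refine Fintype.sum_equiv (Equiv.addRight u) _ _ fun y => ?_
      simp only [Equiv.coe_addRight]
      congr 2 <;> abel
    rw [h2, sum_mul_sum_pow (fun u v => ρ u * ρ v) (fun y u => f (y + u))
      (fun y v => f (s - y + v))]
    refine sum_congr rfl fun y _ => ?_
    simp only [hM]
    rw [sum_mul_sum]
    refine sum_congr rfl fun u _ => sum_congr rfl fun v _ => by ring
  have h3 : ∑ y : Fin p → G, M (fun i => s - y i) ^ 2 = ∑ y, M y ^ 2 :=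
    Fintype.sum_equiv (Equiv.piCongrRight fun _ => Equiv.subLeft s) _ _ fun y => rfl
  rw [h1]
  have h4 : ∀ y, M y * M (fun i => s - y i) ≤ (M y ^ 2 + M (fun i => s - y i) ^ 2) / 2 :=
    fun y => by nlinarith [sq_nonneg (M y - M (fun i => s - y i))]
  refine (sum_le_sum fun y _ => h4 y).trans ?_
  rw [← sum_div, sum_add_distrib, h3]
  linarith

/-- A random variable with a large even moment and a nonnegative odd moment is often large. -/
lemma unbalancing {ι : Type*} [Fintype ι] (P g : ι → ℝ) (hP : ∀ i, 0 ≤ P i) (hP1 : ∑ i, P i = 1)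
    {L : ℝ} (hg : ∀ i, P i ≠ 0 → |g i| ≤ L) {p : ℕ} (hp : Even p) (hp3 : 3 ≤ p)
    (h0 : (1 / 4) ^ p ≤ ∑ i, P i * g i ^ p) (h1 : 0 ≤ ∑ i, P i * g i ^ (p + 1)) :
    (1 / 4) ^ (p + 1) / 8 ≤ L ^ (p + 1) * ∑ i, if 1 / 8 ≤ g i then P i else 0 := by
  have key : ∀ i, P i * (g i ^ (p + 1) / 2 + (1 / 16) * (g i ^ p - (1 / 8) ^ p)
      - (1 / 8) ^ (p + 1)) ≤ L ^ (p + 1) * if 1 / 8 ≤ g i then P i else 0 := by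
    intro i
    by_cases hi : P i = 0
    · simp [hi]
    have h2 := hg i hi
    have h3 : (|g i|) ^ p = g i ^ p := hp.pow_abs _
    have h6 : (1 / 16) * (g i ^ p - (1 / 8) ^ p) ≤ |g i| ^ (p + 1) / 2 := by
      rw [← h3]
      have h7 : 0 ≤ |g i| := abs_nonneg _
      by_cases h8 : 1 / 8 ≤ |g i|
      · have : 0 ≤ |g i| ^ p := by positivity
        have : (0 : ℝ) ≤ (1 / 8) ^ p := by positivity
        rw [pow_succ]
        nlinarith
      · push Not at h8
        have : |g i| ^ p ≤ (1 / 8) ^ p := by gcongr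
        have : 0 ≤ |g i| ^ (p + 1) := by positivity
        linarith
    have h9 : (0 : ℝ) ≤ (1 / 8) ^ (p + 1) := by positivity
    have h10 := hP i
    split_ifs with h
    · rw [abs_of_nonneg (by linarith)] at h6 h2
      have : g i ^ (p + 1) ≤ L ^ (p + 1) := by gcongr
      nlinarith
    · rw [mul_zero]
      refine mul_nonpos_of_nonneg_of_nonpos h10 ?_
      push Not at h
      rcases le_total 0 (g i) with h11 | h11
      · rw [abs_of_nonneg h11] at h6
        have : g i ^ (p + 1) ≤ (1 / 8) ^ (p + 1) := by gcongr
        linarith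
      · have : |g i| ^ (p + 1) = - g i ^ (p + 1) := by
          rw [abs_of_nonpos h11, (hp.add_one).neg_pow]
        linarith
  have h12 := sum_le_sum fun i (_ : i ∈ univ) => key i
  rw [← mul_sum] at h12
  refine le_trans ?_ h12
  have h13 : ∑ i, P i * (g i ^ (p + 1) / 2 + (1 / 16) * (g i ^ p - (1 / 8) ^ p)
      - (1 / 8) ^ (p + 1)) = (∑ i, P i * g i ^ (p + 1)) / 2 + (1 / 16) * (∑ i, P i * g i ^ p)
      - ((1 / 16) * (1 / 8) ^ p + (1 / 8) ^ (p + 1)) * ∑ i, P i := by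
    rw [sum_div, mul_sum, mul_sum, ← sum_add_distrib, ← sum_sub_distrib]
    exact sum_congr rfl fun i _ => by ring
  rw [h13, hP1]
  have h14 : (1 / 8 : ℝ) ^ p ≤ (1 / 4) ^ p * (1 / 8) := by
    have : (1 / 8 : ℝ) ^ p = (1 / 4) ^ p * (1 / 2) ^ p := by rw [← mul_pow]; norm_num
    rw [this]
    gcongr
    calc (1 / 2 : ℝ) ^ p ≤ (1 / 2) ^ 3 := pow_le_pow_of_le_one (by norm_num) (by norm_num) hp3
      _ = 1 / 8 := by norm_num
  have h15 : (0 : ℝ) < (1 / 4) ^ p := by positivity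
  rw [pow_succ, pow_succ]
  linarith

/-- Dependent random choice: a measure `π` such that differences of independent samples lie in
the popular set `S` with high probability. -/
lemma exists_sifted_measure (a b ρ : G → ℝ) (ha : ∀ x, 0 ≤ a x) (hb : ∀ x, 0 ≤ b x)
    (hρ : ∀ x, 0 ≤ ρ x) (hρ1 : ∑ x, ρ x = 1) {α B t₁ t₂ δ q : ℝ} {k : ℕ} (hk : 0 < k) (hα : 0 < α)
    (hab : ∀ x, a x ≤ b x / α) (hB : ∑ x, b x ^ 2 = B) (hB0 : 0 < B)
    (hbρ : ∀ u, ρ u ≠ 0 → ∀ x, b (x + u) ≤ Real.exp (1 / k) * b x)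
    (S : G → Prop) [DecidablePred S] (hS : ∀ w, ¬ S w → ∑ y, a y * a (y + w) ≤ t₁ * B)
    (hq : q ≤ ∑ u, ∑ v, if t₂ * B ≤ ∑ y, a y * a (y + (v - u)) then ρ u * ρ v else 0)
    (ht₁ : 1 ≤ t₁) (ht₂ : 0 ≤ t₂) (hδ : 0 < δ) (hδ1 : δ < 1 / 2)
    (hkq : t₁ ^ k ≤ δ * (q * t₂ ^ k)) :
    ∃ π : G → ℝ, (∀ x, 0 ≤ π x) ∧ ∑ x, π x = 1 ∧ (∀ x, π x ≤ Real.exp 1 / α ^ k * ρ x) ∧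
      ∑ u, ∑ v, π u * π v * (if S (v - u) then 0 else 1) ≤ 2 * δ := by
  set A : (Fin k → G) → G → ℝ := fun s u => ρ u * ∏ i, a (s i + u) with hA
  set I : (Fin k → G) → ℝ := fun s => ∑ u, A s u with hI
  set bad : (Fin k → G) → ℝ := fun s =>
    ∑ u, ∑ v, A s u * A s v * (if S (v - u) then 0 else 1) with hbad
  have hA0 : ∀ s u, 0 ≤ A s u := fun s u => mul_nonneg (hρ u) (prod_nonneg fun i _ => ha _)
  have hI2 : ∑ u, ∑ v, ρ u * ρ v * (∑ y, a y * a (y + (v - u))) ^ k = ∑ s, I s ^ 2 := by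
    simp_rw [← sum_corr_shift]
    rw [sum_mul_corr_pow_eq]
  have hr0 : ∀ w, 0 ≤ ∑ y, a y * a (y + w) := fun w =>
    sum_nonneg fun y _ => mul_nonneg (ha _) (ha _)
  have h1 : q * (t₂ * B) ^ k ≤ ∑ s, I s ^ 2 := by
    rw [← hI2]
    calc q * (t₂ * B) ^ k ≤ (∑ u, ∑ v, if t₂ * B ≤ ∑ y, a y * a (y + (v - u))
          then ρ u * ρ v else 0) * (t₂ * B) ^ k := by gcongr
      _ ≤ _ := by
        rw [sum_mul]
        refine sum_le_sum fun u _ => ?_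
        rw [sum_mul]
        refine sum_le_sum fun v _ => ?_
        split_ifs with h
        · have := mul_nonneg (hρ u) (hρ v)
          gcongr
        · rw [zero_mul]
          exact mul_nonneg (mul_nonneg (hρ u) (hρ v)) (pow_nonneg (hr0 _) _)
  have h2 : ∑ s, bad s ≤ (t₁ * B) ^ k := by
    have h3 : ∑ s, bad s = ∑ u, ∑ v, (ρ u * ρ v * (if S (v - u) then 0 else 1)) *
        (∑ y, a y * a (y + (v - u))) ^ k := by
      simp_rw [← sum_corr_shift]
      rw [sum_mul_sum_pow (fun u v => ρ u * ρ v * (if S (v - u) then 0 else 1))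
        (fun y u => a (y + u)) (fun y v => a (y + v))]
      refine sum_congr rfl fun s _ => sum_congr rfl fun u _ => sum_congr rfl fun v _ => ?_
      simp only [hA]
      ring
    rw [h3]
    calc _ ≤ ∑ u, ∑ v, ρ u * ρ v * (t₁ * B) ^ k := by
          refine sum_le_sum fun u _ => sum_le_sum fun v _ => ?_
          have h4 := mul_nonneg (hρ u) (hρ v)
          split_ifs with h
          · rw [mul_zero, zero_mul]
            positivity
          · rw [mul_one]
            have := hS _ h
            have := hr0 (v - u)
            gcongr
      _ = (t₁ * B) ^ k := by
          simp_rw [← sum_mul, ← mul_sum, hρ1]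
          simp [hρ1]
  set W : (Fin k → G) → ℝ := fun s => ∏ i, b (s i) with hW
  have h5 : ∑ s, W s ^ 2 = B ^ k := by
    rw [← hB, Fintype.sum_pow]
    exact sum_congr rfl fun s _ => by rw [hW, prod_pow]
  obtain ⟨s, hs⟩ : ∃ s, bad s + 2 * δ * W s ^ 2 < 2 * δ * I s ^ 2 := by
    by_contra! h
    have h6 := sum_le_sum fun s (_ : s ∈ univ) => h s
    rw [sum_add_distrib, ← mul_sum, ← mul_sum, h5] at h6
    have h7 : B ^ k ≤ δ * (q * (t₂ * B) ^ k) := by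
      calc B ^ k ≤ t₁ ^ k * B ^ k := le_mul_of_one_le_left (by positivity) (one_le_pow₀ ht₁)
        _ ≤ δ * (q * t₂ ^ k) * B ^ k := by gcongr
        _ = _ := by rw [mul_pow]; ring
    have h8 : (t₁ * B) ^ k ≤ δ * (q * (t₂ * B) ^ k) := by
      calc (t₁ * B) ^ k = t₁ ^ k * B ^ k := mul_pow _ _ _
        _ ≤ δ * (q * t₂ ^ k) * B ^ k := by gcongr
        _ = _ := by rw [mul_pow]; ring
    have h9 : 0 < B ^ k := by positivity
    nlinarith
  have hW0 : 0 ≤ W s := prod_nonneg fun i _ => hb _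
  have hI0 : 0 ≤ I s := sum_nonneg fun u _ => hA0 s u
  have hbad0 : 0 ≤ bad s := sum_nonneg fun u _ => sum_nonneg fun v _ =>
    mul_nonneg (mul_nonneg (hA0 s u) (hA0 s v)) (by split_ifs <;> norm_num)
  have hWI : W s < I s := by
    refine lt_of_pow_lt_pow_left₀ 2 hI0 ?_
    nlinarith
  have hI1 : 0 < I s := by linarith
  have hAW : ∀ u, A s u ≤ Real.exp 1 / α ^ k * ρ u * W s := by
    intro u
    by_cases hu : ρ u = 0
    · simp [hA, hu]
    have h10 : ∏ i, a (s i + u) ≤ ∏ i : Fin k, (Real.exp (1 / k) * b (s i) / α) :=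
      prod_le_prod (fun i _ => ha _) fun i _ =>
        (hab _).trans (div_le_div_of_nonneg_right (hbρ u hu _) hα.le)
    have h11 : ∏ i : Fin k, (Real.exp (1 / k) * b (s i) / α) = Real.exp 1 / α ^ k * W s := by
      rw [prod_div_distrib, prod_mul_distrib]
      simp only [prod_const, card_univ, Fintype.card_fin, ← Real.exp_nat_mul]
      have : (k : ℝ) * (1 / k) = 1 := by field_simp
      rw [this]
      ring
    calc A s u ≤ ρ u * (Real.exp 1 / α ^ k * W s) := by
          rw [← h11]
          exact mul_le_mul_of_nonneg_left h10 (hρ u)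
      _ = _ := by ring
  refine ⟨fun u => A s u / I s, fun u => div_nonneg (hA0 s u) hI0, ?_, fun u => ?_, ?_⟩
  · rw [← sum_div]
    exact div_self hI1.ne'
  · rw [div_le_iff₀ hI1]
    refine (hAW u).trans ?_
    have := hρ u
    gcongr
  · have h12 : ∑ u, ∑ v, A s u / I s * (A s v / I s) * (if S (v - u) then 0 else 1) =
        bad s / I s ^ 2 := by
      simp only [hbad, sum_div]
      refine sum_congr rfl fun u _ => sum_congr rfl fun v _ => ?_
      field_simp
    rw [h12, div_le_iff₀ (by positivity)]
    nlinarith [sq_nonneg (W s)]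

end Moments

section AlmostPeriods

variable {G : Type*} [AddCommGroup G] [Fintype G]

lemma sum_prod_pi_eq_one {π : G → ℝ} (hπ1 : ∑ x, π x = 1) (m : ℕ) :
    ∑ v : Fin m → G, ∏ i, π (v i) = 1 := by
  rw [← Fintype.sum_pow, hπ1, one_pow]

lemma hoeffding_upper {π g : G → ℝ} (hπ : ∀ x, 0 ≤ π x) (hπ1 : ∑ x, π x = 1)
    (hg : ∀ x, |g x| ≤ 1) (hg0 : ∑ x, π x * g x = 0) {η : ℝ} (hη : 0 < η) (hη1 : η ≤ 1) (m : ℕ) :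
    (∑ v : Fin m → G, if η * m < ∑ i, g (v i) then ∏ i, π (v i) else 0) ≤
      Real.exp (-(η ^ 2 * m / 4)) := by
  have h1 : ∑ x, π x * Real.exp (η / 2 * g x) ≤ Real.exp (η ^ 2 / 4) := by
    calc ∑ x, π x * Real.exp (η / 2 * g x) ≤
          ∑ x, (π x * (1 + η ^ 2 / 4) + η / 2 * (π x * g x)) := by
          refine sum_le_sum fun x _ => ?_
          have h2 : |η / 2 * g x| ≤ 1 := by
            rw [abs_mul, abs_of_pos (by linarith)]
            nlinarith [hg x, abs_nonneg (g x)]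
          have h3 := (abs_le.1 (Real.abs_exp_sub_one_sub_id_le h2)).2
          have h4 : (η / 2 * g x) ^ 2 ≤ η ^ 2 / 4 := by
            have h5 : g x ^ 2 ≤ 1 := (sq_le_one_iff_abs_le_one _).2 (hg x)
            nlinarith [sq_nonneg η]
          nlinarith [hπ x]
      _ = 1 + η ^ 2 / 4 := by
          rw [sum_add_distrib, ← sum_mul, ← mul_sum, hπ1, hg0]
          ring
      _ ≤ _ := by linarith [Real.add_one_le_exp (η ^ 2 / 4)]
  calc _ ≤ ∑ v : Fin m → G, Real.exp (-(η ^ 2 * m / 2)) *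
        ∏ i, (π (v i) * Real.exp (η / 2 * g (v i))) := by
        refine sum_le_sum fun v _ => ?_
        have h6 : 0 ≤ ∏ i, π (v i) := prod_nonneg fun i _ => hπ _
        rw [prod_mul_distrib, ← Real.exp_sum, ← mul_sum]
        split_ifs with h
        · have h7 : 1 ≤ Real.exp (-(η ^ 2 * m / 2)) * Real.exp (η / 2 * ∑ i, g (v i)) := by
            rw [← Real.exp_add]
            refine Real.one_le_exp ?_
            nlinarith
          nlinarith
        · positivity
    _ = Real.exp (-(η ^ 2 * m / 2)) * (∑ x, π x * Real.exp (η / 2 * g x)) ^ m := by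
        rw [← mul_sum, Fintype.sum_pow]
    _ ≤ Real.exp (-(η ^ 2 * m / 2)) * Real.exp (η ^ 2 / 4) ^ m := by
        have : 0 ≤ ∑ x, π x * Real.exp (η / 2 * g x) :=
          sum_nonneg fun x _ => mul_nonneg (hπ x) (Real.exp_pos _).le
        gcongr
    _ = _ := by
        rw [← Real.exp_nat_mul, ← Real.exp_add]
        congr 1
        ring

lemma hoeffding_two_sided {π h : G → ℝ} (hπ : ∀ x, 0 ≤ π x) (hπ1 : ∑ x, π x = 1)
    (h0 : ∀ x, 0 ≤ h x) (h1 : ∀ x, h x ≤ 1) {η : ℝ} (hη : 0 < η) (hη1 : η ≤ 1) {m : ℕ}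
    (hm : 0 < m) :
    (∑ v : Fin m → G, if η < |(∑ i, h (v i)) / m - ∑ x, π x * h x| then ∏ i, π (v i) else 0) ≤
      2 * Real.exp (-(η ^ 2 * m / 4)) := by
  set F := ∑ x, π x * h x with hF
  have hF0 : 0 ≤ F := sum_nonneg fun x _ => mul_nonneg (hπ x) (h0 x)
  have hF1 : F ≤ 1 := by
    rw [← hπ1, hF]
    exact sum_le_sum fun x _ => mul_le_of_le_one_right (hπ x) (h1 x)
  have h2 := hoeffding_upper (g := fun x => h x - F) hπ hπ1
    (fun x => abs_le.2 ⟨by linarith [h0 x], by linarith [h1 x]⟩)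
    (by simp_rw [mul_sub]; rw [sum_sub_distrib, ← sum_mul, hπ1]; simp [hF]) hη hη1 m
  have h3 := hoeffding_upper (g := fun x => F - h x) hπ hπ1
    (fun x => abs_le.2 ⟨by linarith [h1 x], by linarith [h0 x]⟩)
    (by simp_rw [mul_sub]; rw [sum_sub_distrib, ← sum_mul, hπ1]; simp [hF]) hη hη1 m
  have h4 : ∀ v : Fin m → G,
      (if η < |(∑ i, h (v i)) / m - F| then ∏ i, π (v i) else 0) ≤
      (if η * m < ∑ i, (h (v i) - F) then ∏ i, π (v i) else 0) +
      (if η * m < ∑ i, (F - h (v i)) then ∏ i, π (v i) else 0) := by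
    intro v
    have h5 : 0 ≤ ∏ i, π (v i) := prod_nonneg fun i _ => hπ _
    have hm' : (0 : ℝ) < m := by exact_mod_cast hm
    simp only [sum_sub_distrib, sum_const, card_univ, Fintype.card_fin, nsmul_eq_mul]
    by_cases h6 : η < |(∑ i, h (v i)) / m - F|
    · rw [if_pos h6]
      rcases lt_abs.1 h6 with h7 | h7
      · have : η * m < ∑ i, h (v i) - m * F := by
          rw [lt_sub_iff_add_lt, lt_div_iff₀ hm'] at h7
          linarith
        rw [if_pos this]
        split_ifs <;> linarith
      · have : η * m < m * F - ∑ i, h (v i) := by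
          have : (∑ i, h (v i)) / m < F - η := by linarith
          rw [div_lt_iff₀ hm'] at this
          linarith
        rw [if_pos this]
        split_ifs <;> linarith
    · rw [if_neg h6]
      split_ifs <;> linarith
  refine (sum_le_sum fun v _ => h4 v).trans ?_
  rw [sum_add_distrib]
  linarith

/-- The Croot–Sisask sampling argument. -/
lemma exists_almost_periods {β π τ h : G → ℝ} (hβ : ∀ x, 0 < β x) (hβ1 : ∑ x, β x = 1)
    (hπ : ∀ x, 0 ≤ π x) (hπ1 : ∑ x, π x = 1) (hτ : ∀ x, 0 ≤ τ x) (hτ1 : ∑ x, τ x = 1)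
    {M : ℝ} (hM : 0 < M) (hπβ : ∀ x, π x ≤ M * β x)
    (hτβ : ∀ t, τ t ≠ 0 → ∀ u, β (u + t) ≤ Real.exp 1 * β u ∧ β (u - t) ≤ Real.exp 1 * β u)
    (h0 : ∀ x, 0 ≤ h x) (h1 : ∀ x, h x ≤ 1) {η : ℝ} (hη : 0 < η) (hη1 : η ≤ 1) {m : ℕ}
    (hm : 0 < m) :
    ∃ X : Finset G, (∀ t ∈ X, τ t ≠ 0) ∧ 1 / (2 * (Real.exp 1 * M) ^ m) ≤ ∑ t ∈ X, τ t ∧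
      ∀ t ∈ X, ∀ t' ∈ X, (∑ u, if 2 * η < |∑ v, π v * h (v - (u + (t - t'))) -
        ∑ v, π v * h (v - u)| then β u else 0) ≤ 40 * Real.exp (-(η ^ 2 * m / 4)) := by
  classical
  set κ := 2 * Real.exp (-(η ^ 2 * m / 4)) with hκ
  have hκ0 : 0 < κ := by positivity
  set F : G → ℝ := fun u => ∑ v, π v * h (v - u) with hF
  set D : (Fin m → G) → G → ℝ := fun v u => (∑ i, h (v i - u)) / m with hD
  set mass : (Fin m → G) → ℝ := fun v => ∑ u, if η < |D v u - F u| then β u else 0 with hmass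
  have h2 : ∑ v : Fin m → G, (∏ i, π (v i)) * mass v ≤ κ := by
    calc ∑ v : Fin m → G, (∏ i, π (v i)) * mass v
        = ∑ u, β u * ∑ v : Fin m → G, if η < |D v u - F u| then ∏ i, π (v i) else 0 := by
          simp only [hmass, mul_sum]
          rw [sum_comm]
          refine sum_congr rfl fun u _ => sum_congr rfl fun v _ => ?_
          split_ifs <;> ring
      _ ≤ ∑ u, β u * κ := sum_le_sum fun u _ => mul_le_mul_of_nonneg_left
          (hoeffding_two_sided (h := fun v => h (v - u)) hπ hπ1 (fun _ => h0 _) (fun _ => h1 _)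
            hη hη1 hm) (hβ u).le
      _ = κ := by rw [← sum_mul, hβ1, one_mul]
  have hprod : ∀ v : Fin m → G, 0 ≤ ∏ i, π (v i) := fun v => prod_nonneg fun i _ => hπ _
  have hgood : 1 / 2 ≤ ∑ v : Fin m → G, if mass v ≤ 2 * κ then ∏ i, π (v i) else 0 := by
    have h3 : ∀ v : Fin m → G, (∏ i, π (v i)) - (∏ i, π (v i)) * mass v / (2 * κ) ≤
        if mass v ≤ 2 * κ then ∏ i, π (v i) else 0 := by
      intro v
      have hmass0 : 0 ≤ mass v := sum_nonneg fun u _ => by split_ifs <;> linarith [hβ u]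
      split_ifs with h4
      · have : 0 ≤ (∏ i, π (v i)) * mass v / (2 * κ) :=
          div_nonneg (mul_nonneg (hprod v) hmass0) (by positivity)
        linarith
      · push Not at h4
        rw [sub_nonpos, le_div_iff₀ (by positivity)]
        exact mul_le_mul_of_nonneg_left h4.le (hprod v)
    have h5 := sum_le_sum fun v (_ : v ∈ univ) => h3 v
    rw [sum_sub_distrib, sum_prod_pi_eq_one hπ1, ← sum_div] at h5
    have h6 : (∑ v : Fin m → G, (∏ i, π (v i)) * mass v) / (2 * κ) ≤ 1 / 2 := by
      rw [div_le_div_iff₀ (by positivity) (by norm_num)]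
      linarith
    linarith
  set X : (Fin m → G) → Finset G := fun w => {t | τ t ≠ 0 ∧ mass (fun i => w i + t) ≤ 2 * κ}
    with hX
  obtain ⟨w, hw⟩ : ∃ w : Fin m → G, (∏ i, β (w i)) * (1 / 2) ≤
      (∏ i, β (w i)) * ((Real.exp 1 * M) ^ m * ∑ t ∈ X w, τ t) := by
    have h7 : ∑ w : Fin m → G, (∏ i, β (w i)) * (1 / 2) ≤ ∑ w : Fin m → G,
        (∏ i, β (w i)) * ((Real.exp 1 * M) ^ m * ∑ t ∈ X w, τ t) := by
      calc ∑ w : Fin m → G, (∏ i, β (w i)) * (1 / 2) = 1 / 2 := by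
            rw [← sum_mul, sum_prod_pi_eq_one hβ1, one_mul]
        _ = ∑ t, τ t * (1 / 2) := by rw [← sum_mul, hτ1, one_mul]
        _ ≤ ∑ t, τ t * ∑ v : Fin m → G, if mass v ≤ 2 * κ then ∏ i, π (v i) else 0 :=
            sum_le_sum fun t _ => mul_le_mul_of_nonneg_left hgood (hτ t)
        _ = ∑ t, τ t * ∑ w : Fin m → G,
              if mass (fun i => w i + t) ≤ 2 * κ then ∏ i, π (w i + t) else 0 := by
            refine sum_congr rfl fun t _ => ?_
            congr 1
            exact (Fintype.sum_equiv (Equiv.piCongrRight fun _ => Equiv.addRight t) _ _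
              fun w => rfl).symm
        _ ≤ ∑ t, ∑ w : Fin m → G, if t ∈ X w then
              (∏ i, β (w i)) * ((Real.exp 1 * M) ^ m * τ t) else 0 := by
            refine sum_le_sum fun t _ => ?_
            rw [mul_sum]
            refine sum_le_sum fun w _ => ?_
            by_cases ht : τ t = 0
            · simp [ht]
            by_cases hw : mass (fun i => w i + t) ≤ 2 * κ
            · rw [if_pos hw, if_pos
                (by simp only [hX, mem_filter, mem_univ, true_and]; exact ⟨ht, hw⟩)]
              have h8 : ∏ i, π (w i + t) ≤ ∏ i, (M * (Real.exp 1 * β (w i))) :=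
                prod_le_prod (fun i _ => hπ _) fun i _ => (hπβ _).trans
                  (mul_le_mul_of_nonneg_left (hτβ t ht _).1 hM.le)
              have h9 : ∏ i, (M * (Real.exp 1 * β (w i))) =
                  (∏ i, β (w i)) * (Real.exp 1 * M) ^ m := by
                simp_rw [← mul_assoc]
                rw [prod_mul_distrib]
                simp [mul_comm]
              rw [h9] at h8
              calc τ t * ∏ i, π (w i + t) ≤ τ t * ((∏ i, β (w i)) * (Real.exp 1 * M) ^ m) :=
                    mul_le_mul_of_nonneg_left h8 (hτ t)
                _ = _ := by ring
            · rw [if_neg hw, if_neg (by simp only [hX, mem_filter, mem_univ, true_and]; tauto)]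
              simp
        _ = _ := by
            rw [sum_comm]
            refine sum_congr rfl fun w _ => ?_
            rw [mul_sum, mul_sum, ← sum_filter]
            refine sum_congr ?_ fun _ _ => rfl
            ext
            simp
    obtain ⟨w, -, hw⟩ := exists_le_of_sum_le univ_nonempty h7
    exact ⟨w, hw⟩
  refine ⟨X w, fun t ht => (mem_filter.1 ht).2.1, ?_, fun t ht t' ht' => ?_⟩
  · have h10 : 0 < ∏ i, β (w i) := prod_pos fun i _ => hβ _
    have h11 := le_of_mul_le_mul_left hw h10
    rw [div_le_iff₀ (by positivity)]
    linarith
  · obtain ⟨ht, hmt⟩ := (mem_filter.1 ht).2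
    obtain ⟨ht', hmt'⟩ := (mem_filter.1 ht').2
    have hbad : (∑ u, if 2 * η < |F (u + (t - t')) - F u| then β u else 0) ≤
        Real.exp 2 * mass (fun i => w i + t) + mass (fun i => w i + t') := by
      have hshift : mass (fun i => w i + t) = ∑ u, if η < |D (fun i => w i + t) (u + (t - t')) -
          F (u + (t - t'))| then β (u + (t - t')) else 0 :=
        (Fintype.sum_equiv (Equiv.addRight (t - t')) _ _ fun u => rfl).symm
      rw [hshift, mul_sum, hmass]
      simp only
      rw [← sum_add_distrib]
      refine sum_le_sum fun u _ => ?_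
      have hDD : D (fun i => w i + t) (u + (t - t')) = D (fun i => w i + t') u := by
        simp only [hD]
        congr 1
        refine sum_congr rfl fun i _ => ?_
        congr 1
        abel
      have hβu : β u ≤ Real.exp 2 * β (u + (t - t')) := by
        have e1 := (hτβ t ht (u + (t - t') + t')).2
        have e2 := (hτβ t' ht' (u + (t - t'))).1
        have e3 : u + (t - t') + t' - t = u := by abel
        rw [e3] at e1
        calc β u ≤ Real.exp 1 * (Real.exp 1 * β (u + (t - t'))) :=
              e1.trans (mul_le_mul_of_nonneg_left e2 (Real.exp_pos _).le)
          _ = _ := by rw [← mul_assoc, ← Real.exp_add]; norm_num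
      have hb1 := (hβ u)
      have hb2 := mul_pos (Real.exp_pos 2) (hβ (u + (t - t')))
      by_cases h12 : 2 * η < |F (u + (t - t')) - F u|
      · rw [if_pos h12]
        by_cases h13 : η < |D (fun i => w i + t') u - F u|
        · rw [if_pos h13]
          split_ifs <;> linarith
        · rw [if_neg h13, if_pos]
          · linarith
          · rw [hDD]
            push Not at h13
            by_contra h14
            push Not at h14
            have := abs_sub_le (F (u + (t - t'))) (D (fun i => w i + t') u) (F u)
            rw [abs_sub_comm] at h14
            linarith
      · rw [if_neg h12]
        split_ifs <;> linarith
    have hexp2 : Real.exp 2 ≤ 9 := by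
      have : Real.exp 2 = Real.exp 1 ^ 2 := by rw [← Real.exp_nat_mul]; norm_num
      rw [this]
      have := Real.exp_one_lt_d9
      have := Real.exp_pos 1
      nlinarith
    refine hbad.trans ?_
    have h15 : Real.exp 2 * mass (fun i => w i + t) ≤ 9 * (2 * κ) := by
      have : 0 ≤ mass (fun i => w i + t) :=
        sum_nonneg fun u _ => by split_ifs <;> linarith [hβ u]
      gcongr
    simp only [hκ] at *
    linarith

end AlmostPeriods

section Fourier

variable {G : Type*} [AddCommGroup G] [Fintype G]

/-- The (unnormalised) Fourier transform of a real function. -/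
noncomputable def fourierHat (f : G → ℝ) (γ : AddChar G ℂ) : ℂ := ∑ x, (f x : ℂ) * γ x

/-- Convolution of real functions. -/
noncomputable def addConv (f g : G → ℝ) (x : G) : ℝ := ∑ y, f y * g (x - y)

lemma sum_addConv_mul (f g φ : G → ℝ) :
    ∑ x, addConv f g x * φ x = ∑ y, ∑ z, f y * g z * φ (y + z) := by
  simp_rw [addConv, sum_mul]
  rw [sum_comm]
  refine sum_congr rfl fun y _ => ?_
  refine Fintype.sum_equiv (Equiv.subRight y) _ _ fun x => ?_
  simp

lemma sum_addConv (f g : G → ℝ) : ∑ x, addConv f g x = (∑ x, f x) * ∑ x, g x := by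
  have := sum_addConv_mul f g 1
  simp only [Pi.one_apply, mul_one] at this
  rw [this, sum_mul_sum]

lemma addConv_nonneg {f g : G → ℝ} (hf : ∀ x, 0 ≤ f x) (hg : ∀ x, 0 ≤ g x) (x : G) :
    0 ≤ addConv f g x := sum_nonneg fun _ _ => mul_nonneg (hf _) (hg _)

lemma exists_of_addConv_ne_zero {f g : G → ℝ} {x : G} (h : addConv f g x ≠ 0) :
    ∃ y z, f y ≠ 0 ∧ g z ≠ 0 ∧ x = y + z := by
  obtain ⟨y, -, hy⟩ := exists_ne_zero_of_sum_ne_zero h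
  exact ⟨y, x - y, left_ne_zero_of_mul hy, right_ne_zero_of_mul hy, by abel⟩

lemma fourierHat_addConv (f g : G → ℝ) (γ : AddChar G ℂ) :
    fourierHat (addConv f g) γ = fourierHat f γ * fourierHat g γ := by
  simp_rw [fourierHat, addConv, sum_mul_sum, Complex.ofReal_sum, sum_mul]
  rw [sum_comm]
  refine sum_congr rfl fun y _ => ?_
  refine Fintype.sum_equiv (Equiv.subRight y) _ _ fun x => ?_
  simp only [Equiv.subRight_apply, Complex.ofReal_mul]
  have : γ x = γ y * γ (x - y) := by rw [← AddChar.map_add_eq_mul]; simp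
  rw [this]
  ring

lemma fourierHat_neg (f : G → ℝ) (γ : AddChar G ℂ) :
    fourierHat (fun x => f (-x)) γ = (starRingEnd ℂ) (fourierHat f γ) := by
  simp_rw [fourierHat, map_sum, map_mul, Complex.conj_ofReal]
  refine Fintype.sum_equiv (Equiv.neg G) _ _ fun x => ?_
  simp [← AddChar.map_neg_eq_conj]

lemma norm_fourierHat_neg (f : G → ℝ) (γ : AddChar G ℂ) :
    ‖fourierHat (fun x => f (-x)) γ‖ = ‖fourierHat f γ‖ := by
  rw [fourierHat_neg, RCLike.norm_conj]

lemma norm_fourierHat_le {f : G → ℝ} (hf : ∀ x, 0 ≤ f x) (γ : AddChar G ℂ) :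
    ‖fourierHat f γ‖ ≤ ∑ x, f x := by
  refine (norm_sum_le _ _).trans (sum_le_sum fun x _ => ?_)
  simp [abs_of_nonneg (hf x)]

lemma sum_fourierHat_mul_normSq (P a : G → ℝ) :
    ∑ γ, fourierHat P γ * (‖fourierHat a γ‖ ^ 2 : ℝ) =
      ((Fintype.card G * ∑ w, P w * ∑ y, a y * a (y + w) : ℝ) : ℂ) := by
  classical
  have h1 : ∀ γ : AddChar G ℂ, fourierHat P γ * (‖fourierHat a γ‖ ^ 2 : ℝ) =
      ∑ w, ∑ y, ∑ z, ((P w * (a y * a z) : ℝ) : ℂ) * γ (w + y - z) := by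
    intro γ
    have h2 : ((‖fourierHat a γ‖ ^ 2 : ℝ) : ℂ) =
        fourierHat a γ * (starRingEnd ℂ) (fourierHat a γ) := by
      rw [Complex.mul_conj, Complex.normSq_eq_norm_sq]
    rw [h2]
    simp_rw [fourierHat, map_sum, map_mul, Complex.conj_ofReal]
    rw [sum_mul_sum, sum_mul]
    refine sum_congr rfl fun w _ => ?_
    rw [mul_sum]
    refine sum_congr rfl fun y _ => ?_
    rw [mul_sum]
    refine sum_congr rfl fun z _ => ?_
    rw [← AddChar.map_neg_eq_conj, sub_eq_add_neg, AddChar.map_add_eq_mul, AddChar.map_add_eq_mul]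
    push_cast
    ring
  simp_rw [h1]
  rw [sum_comm]
  push_cast
  rw [mul_sum]
  refine sum_congr rfl fun w _ => ?_
  rw [sum_comm, mul_sum, mul_sum]
  refine sum_congr rfl fun y _ => ?_
  rw [sum_comm]
  simp_rw [← mul_sum, AddChar.sum_apply_eq_ite]
  rw [sum_eq_single (w + y)]
  · rw [if_pos (sub_self _), add_comm w y]
    ring
  · intro z _ hz
    rw [if_neg (sub_ne_zero.2 hz.symm), mul_zero]
  · simp

lemma card_mul_sum_corr_le (P a : G → ℝ) :
    Fintype.card G * ∑ w, P w * ∑ y, a y * a (y + w) ≤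
      ∑ γ, ‖fourierHat P γ‖ * ‖fourierHat a γ‖ ^ 2 := by
  calc Fintype.card G * ∑ w, P w * ∑ y, a y * a (y + w)
      ≤ ‖((Fintype.card G * ∑ w, P w * ∑ y, a y * a (y + w) : ℝ) : ℂ)‖ := by
        rw [Complex.norm_real]
        exact le_abs_self _
    _ ≤ _ := by
        rw [← sum_fourierHat_mul_normSq]
        refine (norm_sum_le _ _).trans (sum_le_sum fun γ _ => ?_)
        rw [norm_mul, Complex.norm_real, Real.norm_of_nonneg (by positivity)]

lemma fourierHat_ite_zero [DecidableEq G] (γ : AddChar G ℂ) :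
    fourierHat (fun x : G => if x = 0 then 1 else 0) γ = 1 := by
  rw [fourierHat, sum_eq_single 0]
  · simp
  · intro x _ hx
    simp [hx]
  · simp

lemma sum_norm_fourierHat_sq (a : G → ℝ) :
    ∑ γ, ‖fourierHat a γ‖ ^ 2 = Fintype.card G * ∑ y, a y ^ 2 := by
  classical
  have h := sum_fourierHat_mul_normSq (fun x => if x = 0 then 1 else 0) a
  simp only [fourierHat_ite_zero, one_mul, ite_mul, zero_mul, sum_ite_eq', mem_univ, if_true,
    add_zero, ← sq] at h
  exact_mod_cast h

lemma le_sum_large_spectrum {π Q σ a : G → ℝ} (hπ : ∀ x, 0 ≤ π x) (hπ1 : ∑ x, π x = 1) {j : ℕ}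
    (hQ : ∀ γ, ‖fourierHat Q γ‖ = ‖fourierHat σ γ‖ ^ (2 * j)) (hσ : ∀ x, 0 ≤ σ x)
    (hσ1 : ∑ x, σ x = 1) {T : ℝ}
    (hT : T ≤ ∑ u, ∑ v, ∑ x, π u * π v * Q x * ∑ y, a y * a (y + (v - (u + x)))) :
    Fintype.card G * T ≤ ∑ γ with 1 / 2 ≤ ‖fourierHat σ γ‖, ‖fourierHat a γ‖ ^ 2 +
      (1 / 4) ^ j * (Fintype.card G * ∑ y, a y ^ 2) := by
  set P : G → ℝ := addConv π (fun x => addConv π Q (-x)) with hP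
  have h1 : ∑ u, ∑ v, ∑ x, π u * π v * Q x * ∑ y, a y * a (y + (v - (u + x))) =
      ∑ w, P w * ∑ y, a y * a (y + w) := by
    rw [hP, sum_addConv_mul π _ fun w => ∑ y, a y * a (y + w)]
    conv_lhs => rw [sum_comm]
    refine sum_congr rfl fun v _ => ?_
    have h2 : ∑ z, π v * addConv π Q (-z) * (∑ y, a y * a (y + (v + z))) =
        ∑ z, addConv π Q z * (π v * ∑ y, a y * a (y + (v - z))) := by
      refine Fintype.sum_equiv (Equiv.neg G) _ _ fun z => ?_
      simp only [Equiv.neg_apply, sub_neg_eq_add]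
      ring
    rw [h2, sum_addConv_mul π Q fun z => π v * ∑ y, a y * a (y + (v - z))]
    exact sum_congr rfl fun u _ => sum_congr rfl fun x _ => by ring
  rw [h1] at hT
  have hn : (0 : ℝ) ≤ Fintype.card G := by positivity
  refine (mul_le_mul_of_nonneg_left hT hn).trans ((card_mul_sum_corr_le P a).trans ?_)
  rw [← sum_norm_fourierHat_sq, mul_sum, sum_filter, ← sum_add_distrib]
  refine sum_le_sum fun γ _ => ?_
  have h3 : ‖fourierHat P γ‖ ≤ ‖fourierHat σ γ‖ ^ (2 * j) := by
    rw [hP, fourierHat_addConv, norm_mul, norm_fourierHat_neg, fourierHat_addConv, norm_mul, hQ]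
    have h4 := norm_fourierHat_le hπ γ
    rw [hπ1] at h4
    have h5 : 0 ≤ ‖fourierHat σ γ‖ ^ (2 * j) := by positivity
    have h6 := norm_nonneg (fourierHat π γ)
    calc _ ≤ 1 * (1 * ‖fourierHat σ γ‖ ^ (2 * j)) := by gcongr
      _ = _ := by ring
  have h7 := norm_fourierHat_le hσ γ
  rw [hσ1] at h7
  have h8 : 0 ≤ ‖fourierHat a γ‖ ^ 2 := by positivity
  split_ifs with h
  · have h9 : ‖fourierHat σ γ‖ ^ (2 * j) ≤ 1 := pow_le_one₀ (norm_nonneg _) h7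
    have : 0 ≤ (1 / 4 : ℝ) ^ j * ‖fourierHat a γ‖ ^ 2 := by positivity
    nlinarith
  · push Not at h
    rw [zero_add]
    refine mul_le_mul_of_nonneg_right (h3.trans ?_) h8
    calc ‖fourierHat σ γ‖ ^ (2 * j) ≤ (1 / 2) ^ (2 * j) := by gcongr
      _ = (1 / 4) ^ j := by rw [pow_mul]; norm_num

end Fourier

section Smoothing

variable {G : Type*} [AddCommGroup G] [Fintype G]

lemma exists_iterated_smoothing {β σ F : G → ℝ} {X : Finset G} (hβ : ∀ x, 0 ≤ β x)
    (hσ : ∀ x, 0 ≤ σ x) (hσ1 : ∑ x, σ x = 1) (hσX : ∀ x, σ x ≠ 0 → x ∈ X)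
    (hX : ∀ t ∈ X, ∀ u, β (u + t) ≤ Real.exp 1 * β u ∧ β (u - t) ≤ Real.exp 1 * β u) {η κ : ℝ}
    (hκ : 0 ≤ κ)
    (hF : ∀ t ∈ X, ∀ t' ∈ X, (∑ u, if η < |F (u + (t - t')) - F u| then β u else 0) ≤ κ)
    (j : ℕ) :
    ∃ Q : G → ℝ, (∀ x, 0 ≤ Q x) ∧ ∑ x, Q x = 1 ∧
      (∀ γ, ‖fourierHat Q γ‖ = ‖fourierHat σ γ‖ ^ (2 * j)) ∧
      ∀ x, Q x ≠ 0 → (∀ u, β u ≤ Real.exp (2 * j) * β (u + x)) ∧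
        (∑ u, if j * η < |F (u + x) - F u| then β u else 0) ≤ j * Real.exp (2 * j) * κ := by
  classical
  induction j with
  | zero =>
    refine ⟨fun x => if x = 0 then 1 else 0, fun x => by dsimp only; split_ifs <;> norm_num,
      by simp,
      fun γ => by simp [fourierHat_ite_zero], fun x hx => ?_⟩
    obtain rfl : x = 0 := by
      by_contra h
      simp [h] at hx
    simp
  | succ j ih =>
    obtain ⟨Q, hQ0, hQ1, hQh, hQ⟩ := ih
    set D := addConv σ (fun x => σ (-x)) with hD
    have hσneg : ∑ x, σ (-x) = 1 := by
      rw [← hσ1]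
      exact Fintype.sum_equiv (Equiv.neg G) _ _ fun x => rfl
    refine ⟨addConv Q D, addConv_nonneg hQ0 (addConv_nonneg hσ fun x => hσ _), ?_, fun γ => ?_,
      fun x hx => ?_⟩
    · rw [sum_addConv, hD, sum_addConv, hσneg, hσ1, hQ1]
      norm_num
    · rw [fourierHat_addConv, hD, fourierHat_addConv, norm_mul, norm_mul, norm_fourierHat_neg, hQh]
      ring
    · obtain ⟨y, d, hy, hd, rfl⟩ := exists_of_addConv_ne_zero hx
      obtain ⟨t, t', ht, ht', rfl⟩ := exists_of_addConv_ne_zero hd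
      have htX := hσX _ ht
      have htX' := hσX _ ht'
      obtain ⟨h1, h2⟩ := hQ y hy
      have h3 : ∀ u, β u ≤ Real.exp 2 * β (u + (t + t')) := by
        intro u
        have e1 := (hX t htX (u + t)).2
        have e2 := (hX (-t') htX' (u + t + t')).1
        rw [add_sub_cancel_right] at e1
        rw [add_neg_cancel_right, add_assoc u t t'] at e2
        calc β u ≤ Real.exp 1 * (Real.exp 1 * β (u + (t + t'))) :=
              e1.trans (mul_le_mul_of_nonneg_left e2 (Real.exp_pos _).le)
          _ = _ := by rw [← mul_assoc, ← Real.exp_add]; norm_num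
      have hexp : Real.exp (2 * (j + 1 : ℕ)) = Real.exp (2 * j) * Real.exp 2 := by
        rw [← Real.exp_add]
        push_cast
        ring_nf
      refine ⟨fun u => ?_, ?_⟩
      · calc β u ≤ Real.exp (2 * j) * β (u + y) := h1 u
          _ ≤ Real.exp (2 * j) * (Real.exp 2 * β (u + y + (t + t'))) := by
              gcongr
              exact h3 _
          _ = _ := by rw [hexp, add_assoc u y]; ring
      · have h4 := hF t htX (-t') htX'
        rw [sub_neg_eq_add] at h4
        have h5 : (∑ u, if η < |F (u + y + (t + t')) - F (u + y)| then β (u + y) else 0) ≤ κ := by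
          refine le_trans (le_of_eq ?_) h4
          exact Fintype.sum_equiv (Equiv.addRight y) _ _ fun u => rfl
        have h6 : ∀ u, (if (j + 1 : ℕ) * η < |F (u + (y + (t + t'))) - F u| then β u else 0) ≤
            (if j * η < |F (u + y) - F u| then β u else 0) + Real.exp (2 * j) *
            (if η < |F (u + y + (t + t')) - F (u + y)| then β (u + y) else 0) := by
          intro u
          have e1 := hβ u
          have e2 := mul_nonneg (Real.exp_pos (2 * (j : ℝ))).le (hβ (u + y))
          have e3 := h1 u
          by_cases e4 : (j + 1 : ℕ) * η < |F (u + (y + (t + t'))) - F u|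
          · rw [if_pos e4]
            by_cases e5 : j * η < |F (u + y) - F u|
            · rw [if_pos e5]
              split_ifs <;> linarith
            · rw [if_neg e5, if_pos]
              · linarith
              · rw [← add_assoc] at e4
                have := abs_sub_le (F (u + y + (t + t'))) (F (u + y)) (F u)
                push_cast at e4
                linarith
          · rw [if_neg e4]
            split_ifs <;> linarith
        refine (sum_le_sum fun u _ => h6 u).trans ?_
        rw [sum_add_distrib, ← mul_sum, hexp]
        have h7 : Real.exp (2 * j) * (∑ u, if η < |F (u + y + (t + t')) - F (u + y)|
            then β (u + y) else 0) ≤ Real.exp (2 * j) * κ := by gcongr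
        have h8 : 1 ≤ Real.exp 2 := Real.one_le_exp (by norm_num)
        have h9 : 0 ≤ (j + 1) * Real.exp (2 * j) * κ := by positivity
        push_cast
        nlinarith

/-- Sampling produces a smoothing kernel `Q`, an iterated difference convolution of a measure `σ`,
under which the correlations of `π` with `h` persist. -/
lemma exists_smoothing {β π τ h : G → ℝ} (hβ : ∀ x, 0 < β x) (hβ1 : ∑ x, β x = 1)
    (hπ : ∀ x, 0 ≤ π x) (hπ1 : ∑ x, π x = 1) (hτ : ∀ x, 0 ≤ τ x) (hτ1 : ∑ x, τ x = 1)
    {M : ℝ} (hM : 0 < M) (hπβ : ∀ x, π x ≤ M * β x)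
    (hτβ : ∀ t, τ t ≠ 0 → ∀ u, β (u + t) ≤ Real.exp 1 * β u ∧ β (u - t) ≤ Real.exp 1 * β u)
    (h0 : ∀ x, 0 ≤ h x) (h1 : ∀ x, h x ≤ 1) {η : ℝ} (hη : 0 < η) (hη1 : η ≤ 1) {m : ℕ}
    (hm : 0 < m) (j : ℕ) {δ : ℝ} (hδ : 1 - δ ≤ ∑ u, ∑ v, π u * π v * h (v - u)) :
    ∃ σ Q : G → ℝ, (∀ x, 0 ≤ σ x) ∧ ∑ x, σ x = 1 ∧
      (∀ x, σ x ≤ 2 * (Real.exp 1 * M) ^ m * τ x) ∧ (∀ x, 0 ≤ Q x) ∧ ∑ x, Q x = 1 ∧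
      (∀ γ, ‖fourierHat Q γ‖ = ‖fourierHat σ γ‖ ^ (2 * j)) ∧
      1 - δ - 2 * j * η - M * (j * Real.exp (2 * j) * (40 * Real.exp (-(η ^ 2 * m / 4)))) ≤
        ∑ u, ∑ v, ∑ x, π u * π v * Q x * h (v - (u + x)) := by
  classical
  obtain ⟨X, hX1, hX2, hX3⟩ := exists_almost_periods hβ hβ1 hπ hπ1 hτ hτ1 hM hπβ hτβ h0 h1 hη hη1 hm
  set F : G → ℝ := fun u => ∑ v, π v * h (v - u) with hF
  obtain ⟨κ, hκ⟩ : ∃ κ, κ = 40 * Real.exp (-(η ^ 2 * m / 4)) := ⟨_, rfl⟩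
  have hκ0 : 0 ≤ κ := by rw [hκ]; positivity
  rw [← hκ] at hX3 ⊢
  have hMpos : 0 < 2 * (Real.exp 1 * M) ^ m := by positivity
  have hs : 0 < ∑ t ∈ X, τ t := lt_of_lt_of_le (by positivity) hX2
  obtain ⟨s, hs'⟩ : ∃ s, s = ∑ t ∈ X, τ t := ⟨_, rfl⟩
  rw [← hs'] at hs hX2
  obtain ⟨σ, hσ⟩ : ∃ σ : G → ℝ, σ = fun x => if x ∈ X then τ x / s else 0 := ⟨_, rfl⟩
  have hσ0 : ∀ x, 0 ≤ σ x := fun x => by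
    simp only [hσ]
    split_ifs
    exacts [div_nonneg (hτ x) hs.le, le_rfl]
  have hσ1 : ∑ x, σ x = 1 := by
    simp only [hσ]
    rw [sum_ite_mem, univ_inter, ← sum_div, ← hs']
    exact div_self hs.ne'
  have hσX : ∀ x, σ x ≠ 0 → x ∈ X := fun x hx => by
    by_contra h
    simp [hσ, h] at hx
  obtain ⟨Q, hQ0, hQ1, hQh, hQ⟩ := exists_iterated_smoothing (F := F) (η := 2 * η)
    (fun x => (hβ x).le) hσ0 hσ1 hσX
    (fun t ht => hτβ t (hX1 t ht)) hκ0 hX3 j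
  refine ⟨σ, Q, hσ0, hσ1, fun x => ?_, hQ0, hQ1, hQh, ?_⟩
  · simp only [hσ]
    split_ifs with hx
    · rw [div_le_iff₀ hs]
      rw [div_le_iff₀ hMpos] at hX2
      have := hτ x
      nlinarith
    · exact mul_nonneg hMpos.le (hτ x)
  · have hF1 : ∀ u, F u ≤ 1 := fun u => by
      rw [← hπ1]
      exact sum_le_sum fun v _ => mul_le_of_le_one_right (hπ v) (h1 _)
    have hF0 : ∀ u, 0 ≤ F u := fun u => sum_nonneg fun v _ => mul_nonneg (hπ v) (h0 _)
    have hπF : ∑ u, ∑ v, π u * π v * h (v - u) = ∑ u, π u * F u := by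
      refine sum_congr rfl fun u _ => ?_
      rw [hF, mul_sum]
      exact sum_congr rfl fun v _ => by ring
    rw [hπF] at hδ
    obtain ⟨E, hE⟩ : ∃ E, E = M * (j * Real.exp (2 * j) * κ) := ⟨_, rfl⟩
    rw [← hE]
    have h2 : ∀ x, Q x ≠ 0 → 1 - δ - 2 * j * η - E ≤ ∑ u, π u * F (u + x) := by
      intro x hx
      have h3 := (hQ x hx).2
      have h4 : ∀ u, π u * F u - π u * (2 * j * η) - M *
          (if j * (2 * η) < |F (u + x) - F u| then β u else 0) ≤ π u * F (u + x) := by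
        intro u
        have e1 := hπ u
        have e2 := hπβ u
        have e5 : 0 ≤ 2 * j * η := by positivity
        split_ifs with h5
        · have := mul_le_of_le_one_right e1 (hF1 u)
          have := mul_nonneg e1 (hF0 (u + x))
          have := mul_nonneg e1 e5
          linarith
        · push Not at h5
          have e3 := (abs_le.1 h5).1
          nlinarith
      have h6 := sum_le_sum fun u (_ : u ∈ univ) => h4 u
      rw [sum_sub_distrib, sum_sub_distrib, ← sum_mul, hπ1, ← mul_sum] at h6
      have h7 := mul_le_mul_of_nonneg_left h3 hM.le
      rw [← hE] at h7
      linarith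
    have h8 : ∑ u, ∑ v, ∑ x, π u * π v * Q x * h (v - (u + x)) =
        ∑ x, Q x * ∑ u, π u * F (u + x) := by
      simp only [hF, mul_sum]
      conv_rhs => rw [sum_comm]
      refine sum_congr rfl fun u _ => ?_
      conv_rhs => rw [sum_comm]
      exact sum_congr rfl fun v _ => sum_congr rfl fun x _ => by ring
    rw [h8]
    calc 1 - δ - 2 * j * η - E = ∑ x, Q x * (1 - δ - 2 * j * η - E) := by
          rw [← sum_mul, hQ1, one_mul]
      _ ≤ _ := sum_le_sum fun x _ => by
          by_cases hx : Q x = 0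
          · simp [hx]
          · exact mul_le_mul_of_nonneg_left (h2 x hx) (hQ0 x)

end Smoothing

section Chang

variable {G : Type*} [AddCommGroup G] [Fintype G]

/-- A Riesz product with frequencies in `Λ` and phases `ω`. -/
noncomputable def rieszProduct (Λ : Finset (AddChar G ℂ)) (ω : AddChar G ℂ → ℂ) (x : G) : ℝ :=
  ∏ γ ∈ Λ, (1 + (ω γ * γ x).re / 4)

lemma abs_re_phase_mul_le {ω : AddChar G ℂ → ℂ} (hω : ∀ γ, ‖ω γ‖ = 1) (γ : AddChar G ℂ) (x : G) :
    |(ω γ * γ x).re| ≤ 1 :=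
  (Complex.abs_re_le_norm _).trans (by simp [hω])

lemma rieszProduct_pos (Λ : Finset (AddChar G ℂ)) {ω : AddChar G ℂ → ℂ} (hω : ∀ γ, ‖ω γ‖ = 1)
    (x : G) : 0 < rieszProduct Λ ω x :=
  prod_pos fun γ _ => by linarith [(abs_le.1 (abs_re_phase_mul_le hω γ x)).1]

lemma rieszProduct_add_le (Λ : Finset (AddChar G ℂ)) {ω : AddChar G ℂ → ℂ} (hω : ∀ γ, ‖ω γ‖ = 1)
    (x t : G) : rieszProduct Λ ω (x + t) ≤ Real.exp (bohrNorm Λ t) * rieszProduct Λ ω x := by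
  rw [bohrNorm, Real.exp_sum, rieszProduct, rieszProduct, ← prod_mul_distrib]
  refine prod_le_prod (fun γ _ => ?_) fun γ _ => ?_
  · linarith [(abs_le.1 (abs_re_phase_mul_le hω γ (x + t))).1]
  · have h1 := (abs_le.1 (abs_re_phase_mul_le hω γ x)).1
    have h2 : (ω γ * γ (x + t)).re - (ω γ * γ x).re ≤ ‖1 - γ t‖ := by
      rw [← Complex.sub_re]
      refine (Complex.re_le_norm _).trans ?_
      have : ω γ * γ (x + t) - ω γ * γ x = -(ω γ * γ x * (1 - γ t)) := by
        rw [AddChar.map_add_eq_mul]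
        ring
      rw [this, norm_neg, norm_mul, norm_mul, hω]
      simp
    have h3 := Real.add_one_le_exp ‖1 - γ t‖
    have h4 := norm_nonneg (1 - γ t)
    nlinarith

lemma exp_sub_sq_le {z : ℝ} (hz : |z| ≤ 1 / 4) : Real.exp (z - z ^ 2) ≤ 1 + z := by
  obtain ⟨h1, h2⟩ := abs_le.1 hz
  rcases le_total 0 z with hz0 | hz0
  · have h3 := Real.add_one_le_exp (-(z - z ^ 2))
    rw [Real.exp_neg] at h3
    have h4 : 0 < Real.exp (z - z ^ 2) := Real.exp_pos _
    have h5 : (-(z - z ^ 2) + 1) * Real.exp (z - z ^ 2) ≤ 1 := by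
      calc _ ≤ (Real.exp (z - z ^ 2))⁻¹ * Real.exp (z - z ^ 2) := by gcongr
        _ = 1 := inv_mul_cancel₀ h4.ne'
    have h6 : 1 ≤ (1 + z) * (1 - z + z ^ 2) := by nlinarith [pow_nonneg hz0 3]
    have h7 : 0 < 1 - z + z ^ 2 := by nlinarith
    refine le_of_mul_le_mul_left (a := 1 - z + z ^ 2) ?_ h7
    linarith
  · have h3 := Real.quadratic_le_exp_of_nonneg (x := -(z - z ^ 2)) (by nlinarith)
    rw [Real.exp_neg] at h3
    have h4 : 0 < Real.exp (z - z ^ 2) := Real.exp_pos _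
    set q := 1 + -(z - z ^ 2) + (-(z - z ^ 2)) ^ 2 / 2 with hq
    have h5 : q * Real.exp (z - z ^ 2) ≤ 1 := by
      calc _ ≤ (Real.exp (z - z ^ 2))⁻¹ * Real.exp (z - z ^ 2) := by gcongr
        _ = 1 := inv_mul_cancel₀ h4.ne'
    have h6 : 1 ≤ (1 + z) * q := by
      have h8 : (1 + z) * q - 1 = z ^ 2 * (z + (1 + z) * (1 - z) ^ 2 / 2) := by
        rw [hq]
        ring
      have h9 : 0 ≤ z + (1 + z) * (1 - z) ^ 2 / 2 := by nlinarith [sq_nonneg z]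
      nlinarith [mul_nonneg (sq_nonneg z) h9]
    have h7 : 0 < q := by
      rw [hq]
      nlinarith [sq_nonneg (-(z - z ^ 2))]
    refine le_of_mul_le_mul_left (a := q) ?_ h7
    linarith

/-- Frequencies at which a measure `W` of slow variation has a large Fourier coefficient are
nearly trivial in the directions of slow variation. -/
lemma norm_one_sub_le_of_large_coeff {W : G → ℝ} (hW : ∀ x, 0 < W x) {N : ℝ} {t : G}
    (h1 : ∀ x, W (x + t) ≤ Real.exp N * W x) (h2 : ∀ x, W x ≤ Real.exp N * W (x + t))
    {γ : AddChar G ℂ} (hγ : (∑ x, W x) / 8 ≤ ‖fourierHat W γ‖) :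
    ‖1 - γ t‖ ≤ 8 * (Real.exp N - 1) := by
  have hS : 0 < ∑ x, W x := sum_pos (fun x _ => hW x) univ_nonempty
  have h3 : fourierHat W γ * (1 - γ t) = ∑ x, ((W (x + t) - W x : ℝ) : ℂ) * γ (x + t) := by
    have h4 : fourierHat W γ = ∑ x, (W (x + t) : ℂ) * γ (x + t) :=
      (Fintype.sum_equiv (Equiv.addRight t) _ _ fun x => rfl).symm
    rw [mul_sub, mul_one]
    nth_rewrite 1 [h4]
    rw [fourierHat, sum_mul, ← sum_sub_distrib]
    refine sum_congr rfl fun x _ => ?_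
    rw [AddChar.map_add_eq_mul]
    push_cast
    ring
  have h5 : ‖fourierHat W γ‖ * ‖1 - γ t‖ ≤ (Real.exp N - 1) * ∑ x, W x := by
    rw [← norm_mul, h3, mul_sum]
    refine (norm_sum_le _ _).trans (sum_le_sum fun x _ => ?_)
    rw [norm_mul, Complex.norm_real, AddChar.norm_apply, mul_one, Real.norm_eq_abs, abs_le]
    have e1 := h1 x
    have e2 := h2 x
    have e3 := hW x
    refine ⟨?_, by linarith⟩
    have e5 : (2 - Real.exp N) * Real.exp N ≤ 1 := by nlinarith [sq_nonneg (Real.exp N - 1)]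
    have e4 := Real.exp_pos N
    have e6 : (2 - Real.exp N) * Real.exp N * W x ≤ Real.exp N * W (x + t) := by nlinarith
    nlinarith
  have h6 := mul_le_mul_of_nonneg_right hγ (norm_nonneg (1 - γ t))
  have h7 : (∑ x, W x) * ‖1 - γ t‖ ≤ (∑ x, W x) * (8 * (Real.exp N - 1)) := by linarith
  exact le_of_mul_le_mul_left h7 hS

lemma exists_phase (z : ℂ) : ∃ ω : ℂ, ‖ω‖ = 1 ∧ (ω * z).re = ‖z‖ := by
  by_cases hz : z = 0
  · exact ⟨1, by simp, by simp [hz]⟩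
  · refine ⟨(starRingEnd ℂ) z / ‖z‖, ?_, ?_⟩
    · simp [hz]
    · have : (starRingEnd ℂ) z / ‖z‖ * z = (‖z‖ : ℂ) := by
        have h : (‖z‖ : ℂ) ≠ 0 := by simpa using hz
        field_simp
        rw [mul_comm, Complex.mul_conj, Complex.normSq_eq_norm_sq]
        push_cast
        ring
      rw [this, Complex.ofReal_re]

/-- `Λ` is dissociated with respect to `β`: all its Riesz products have small mean. -/
def IsWeaklyDissociated (β : G → ℝ) (Λ : Finset (AddChar G ℂ)) : Prop :=
  ∀ ω : AddChar G ℂ → ℂ, (∀ γ, ‖ω γ‖ = 1) →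
    ∑ x, β x * rieszProduct Λ ω x ≤ (1 + 1 / 32) ^ #Λ

lemma IsWeaklyDissociated.card_le {β σ : G → ℝ} {M : ℝ} (hM : 0 < M) (hσ : ∀ x, 0 ≤ σ x)
    (hσ1 : ∑ x, σ x = 1) (hσβ : ∀ x, σ x ≤ M * β x) {Λ : Finset (AddChar G ℂ)}
    (hΛ : IsWeaklyDissociated β Λ) (hspec : ∀ γ ∈ Λ, 1 / 2 ≤ ‖fourierHat σ γ‖) :
    #Λ ≤ 32 * Real.log M := by
  choose ω hω hωσ using fun γ => exists_phase (fourierHat σ γ)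
  set ψ : G → ℝ := fun x => ∑ γ ∈ Λ, ((ω γ * γ x).re / 4 - ((ω γ * γ x).re / 4) ^ 2) with hψ
  have h1 : ∀ x, Real.exp (ψ x) ≤ rieszProduct Λ ω x := by
    intro x
    rw [hψ, Real.exp_sum]
    refine prod_le_prod (fun _ _ => (Real.exp_pos _).le) fun γ _ => exp_sub_sq_le ?_
    have := abs_re_phase_mul_le hω γ x
    rw [abs_div, abs_of_pos (by norm_num : (0 : ℝ) < 4)]
    linarith
  have h2 : #Λ / 16 ≤ ∑ x, σ x * ψ x := by
    have h3 : ∑ x, σ x * ψ x = ∑ γ ∈ Λ, ∑ x, σ x * ((ω γ * γ x).re / 4 -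
        ((ω γ * γ x).re / 4) ^ 2) := by
      simp only [hψ, mul_sum]
      rw [sum_comm]
    rw [h3]
    have h4 : ∀ γ ∈ Λ, (1 / 16 : ℝ) ≤ ∑ x, σ x * ((ω γ * γ x).re / 4 -
        ((ω γ * γ x).re / 4) ^ 2) := by
      intro γ hγ
      have h5 : ∑ x, σ x * (ω γ * γ x).re = ‖fourierHat σ γ‖ := by
        rw [← hωσ, fourierHat, mul_sum, Complex.re_sum]
        refine sum_congr rfl fun x _ => ?_
        rw [mul_left_comm, Complex.re_ofReal_mul]
      have h6 : ∀ x, σ x * (ω γ * γ x).re / 4 - σ x / 16 ≤ σ x * ((ω γ * γ x).re / 4 -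
          ((ω γ * γ x).re / 4) ^ 2) := by
        intro x
        have h7 : (ω γ * γ x).re ^ 2 ≤ 1 :=
          (sq_le_one_iff_abs_le_one _).2 (abs_re_phase_mul_le hω γ x)
        nlinarith [hσ x]
      refine le_trans ?_ (sum_le_sum fun x _ => h6 x)
      rw [sum_sub_distrib, ← sum_div, ← sum_div, h5, hσ1]
      linarith [hspec γ hγ]
    calc (#Λ / 16 : ℝ) = ∑ γ ∈ Λ, (1 / 16 : ℝ) := by rw [sum_const, nsmul_eq_mul]; ring
      _ ≤ _ := sum_le_sum h4
  have h8 : Real.exp (#Λ / 16) ≤ ∑ x, σ x * Real.exp (ψ x) := by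
    refine (Real.exp_le_exp.2 h2).trans ?_
    set μ := ∑ x, σ x * ψ x with hμ
    have h9 : ∀ x, σ x * (Real.exp μ * (1 - μ)) + Real.exp μ * (σ x * ψ x) ≤
        σ x * Real.exp (ψ x) := by
      intro x
      have e1 : Real.exp (ψ x) = Real.exp μ * Real.exp (ψ x - μ) := by
        rw [← Real.exp_add]
        ring_nf
      have e2 := Real.add_one_le_exp (ψ x - μ)
      have e3 := mul_le_mul_of_nonneg_left e2 (mul_nonneg (hσ x) (Real.exp_pos μ).le)
      rw [e1]
      linarith
    refine le_trans (le_of_eq ?_) (sum_le_sum fun x _ => h9 x)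
    rw [sum_add_distrib, ← sum_mul, ← mul_sum, hσ1, ← hμ]
    ring
  have h10 : ∑ x, σ x * Real.exp (ψ x) ≤ M * (1 + 1 / 32) ^ #Λ := by
    calc _ ≤ ∑ x, M * (β x * rieszProduct Λ ω x) := by
          refine sum_le_sum fun x _ => ?_
          rw [← mul_assoc]
          exact mul_le_mul (hσβ x) (h1 x) (Real.exp_pos _).le ((hσ x).trans (hσβ x))
      _ ≤ _ := by
          rw [← mul_sum]
          exact mul_le_mul_of_nonneg_left (hΛ ω hω) hM.le
  have h11 : Real.exp (#Λ / 16) ≤ Real.exp (Real.log M + #Λ / 32) := by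
    refine h8.trans (h10.trans ?_)
    rw [Real.exp_add, Real.exp_log hM]
    refine mul_le_mul_of_nonneg_left ?_ hM.le
    calc ((1 + 1 / 32) ^ #Λ : ℝ) ≤ Real.exp (1 / 32) ^ #Λ := by
          gcongr
          linarith [Real.add_one_le_exp (1 / 32)]
      _ = _ := by
          rw [← Real.exp_nat_mul]
          ring_nf
  rw [Real.exp_le_exp] at h11
  linarith

/-- A Chang-type theorem relative to exponential Bohr weights. -/
lemma exists_chang_frequencies (Γ : Finset (AddChar G ℂ)) {c : ℝ} (hc : 0 ≤ c) {σ : G → ℝ} {M : ℝ}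
    (hM : 0 < M) (hσ : ∀ x, 0 ≤ σ x) (hσ1 : ∑ x, σ x = 1)
    (hσβ : ∀ x, σ x ≤ M * bohrWeight Γ c x) :
    ∃ Λ : Finset (AddChar G ℂ), #Λ ≤ 32 * Real.log M ∧
      ∀ γ, 1 / 2 ≤ ‖fourierHat σ γ‖ → ∀ t,
        ‖1 - γ t‖ ≤ 8 * (Real.exp (c * bohrNorm Γ t + bohrNorm Λ t) - 1) := by
  classical
  set β := bohrWeight Γ c with hβ
  set P : Finset (Finset (AddChar G ℂ)) := {Λ | IsWeaklyDissociated β Λ ∧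
    ∀ γ ∈ Λ, 1 / 2 ≤ ‖fourierHat σ γ‖} with hP
  have hempty : ∅ ∈ P := by
    simp only [hP, mem_filter, mem_univ, true_and]
    refine ⟨fun ω _ => ?_, by simp⟩
    simp [rieszProduct, hβ, sum_bohrWeight]
  obtain ⟨Λ, hΛP, hmax⟩ := exists_max_image P card ⟨∅, hempty⟩
  obtain ⟨hΛ, hspec⟩ := (mem_filter.1 hΛP).2
  refine ⟨Λ, hΛ.card_le hM hσ hσ1 hσβ hspec, fun γ hγ t => ?_⟩
  have hN0 : 0 ≤ c * bohrNorm Γ t := mul_nonneg hc (bohrNorm_nonneg _ _)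
  by_cases hγΛ : γ ∈ Λ
  · have h1 : ‖1 - γ t‖ ≤ bohrNorm Λ t :=
      single_le_sum (f := fun γ : AddChar G ℂ => ‖1 - γ t‖) (fun _ _ => norm_nonneg _) hγΛ
    have h2 := Real.add_one_le_exp (c * bohrNorm Γ t + bohrNorm Λ t)
    have h3 := norm_nonneg (1 - γ t)
    linarith
  · have hnot : ¬ IsWeaklyDissociated β (insert γ Λ) := by
      intro h
      have h4 : insert γ Λ ∈ P := by
        simp only [hP, mem_filter, mem_univ, true_and]
        refine ⟨h, fun γ' hγ' => ?_⟩
        rcases mem_insert.1 hγ' with rfl | h5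
        exacts [hγ, hspec _ h5]
      have := hmax _ h4
      rw [card_insert_of_notMem hγΛ] at this
      omega
    simp only [IsWeaklyDissociated, not_forall, not_le, exists_prop] at hnot
    obtain ⟨ω, hω, hlt⟩ := hnot
    set W : G → ℝ := fun x => β x * rieszProduct Λ ω x with hW
    have hW0 : ∀ x, 0 < W x := fun x => mul_pos (bohrWeight_pos _ _ _) (rieszProduct_pos _ hω x)
    have hWadd : ∀ x t, W (x + t) ≤ Real.exp (c * bohrNorm Γ t + bohrNorm Λ t) * W x := by
      intro x t
      calc W (x + t) ≤ (Real.exp (c * bohrNorm Γ t) * β x) *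
            (Real.exp (bohrNorm Λ t) * rieszProduct Λ ω x) :=
            mul_le_mul (bohrWeight_add_le Γ hc x t) (rieszProduct_add_le Λ hω x t)
              (rieszProduct_pos _ hω _).le
              (mul_nonneg (Real.exp_pos _).le (bohrWeight_pos _ _ _).le)
        _ = _ := by rw [Real.exp_add]; ring
    refine norm_one_sub_le_of_large_coeff hW0 (fun x => hWadd x t) (fun x => ?_) ?_
    · have := hWadd (x + t) (-t)
      rwa [add_neg_cancel_right, bohrNorm_neg, bohrNorm_neg] at this
    · have h5 := hΛ ω hω
      rw [card_insert_of_notMem hγΛ, pow_succ] at hlt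
      have h6 : ∑ x, β x * rieszProduct (insert γ Λ) ω x =
          ∑ x, W x + (ω γ * fourierHat W γ).re / 4 := by
        rw [fourierHat, mul_sum, Complex.re_sum, sum_div, ← sum_add_distrib]
        refine sum_congr rfl fun x _ => ?_
        rw [mul_left_comm, Complex.re_ofReal_mul, rieszProduct, prod_insert hγΛ]
        simp only [hW, rieszProduct]
        ring
      have h7 := Complex.re_le_norm (ω γ * fourierHat W γ)
      rw [norm_mul, hω, one_mul] at h7
      have h8 : ∑ x, W x ≤ (1 + 1 / 32) ^ #Λ := h5
      linarith

end Chang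

section Averaging

variable {G : Type*} [AddCommGroup G] [Fintype G]

lemma sum_mul_exp_neg_ge {τ w : G → ℝ} {r : ℝ} (hτ : ∀ x, 0 ≤ τ x)
    (hr : ∑ x, τ x * (Real.exp (w x) - 1) ≤ r) {e : G → ℝ}
    (he1 : ∀ x, e x ≤ 1) (hw : ∀ x, 0 ≤ w x) :
    ∑ x, τ x * e x - r ≤ ∑ x, τ x * e x * Real.exp (-w x) := by
  refine le_trans (sub_le_sub_left hr _) ?_
  rw [← sum_sub_distrib]
  refine sum_le_sum fun x _ => ?_
  have h1 : 1 - w x ≤ Real.exp (-w x) := by linarith [Real.add_one_le_exp (-w x)]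
  have h2 : w x ≤ Real.exp (w x) - 1 := by linarith [Real.add_one_le_exp (w x)]
  have h3 : τ x * e x * (1 - Real.exp (-w x)) ≤ τ x * (Real.exp (w x) - 1) := by
    rw [mul_assoc]
    refine mul_le_mul_of_nonneg_left ?_ (hτ x)
    have h4 : 0 ≤ 1 - Real.exp (-w x) := by
      have := hw x
      simpa using this
    nlinarith [he1 x]
  linarith

/-- Averaging over translates by a narrow measure nearly preserves densities. -/
lemma le_sum_translate_density (Γ : Finset (AddChar G ℂ)) {c r : ℝ} (hc : 0 ≤ c) {τ e : G → ℝ}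
    (hτ : ∀ x, 0 ≤ τ x) (hτ1 : ∑ x, τ x = 1)
    (hr : ∑ x, τ x * (Real.exp (c * bohrNorm Γ x) - 1) ≤ r) (he : ∀ x, 0 ≤ e x) :
    (1 - r) * ∑ y, bohrWeight Γ c y * e y ≤
      ∑ y, bohrWeight Γ c y * ∑ z, τ z * e (y + z) := by
  have h1 : 1 - r ≤ ∑ z, τ z * Real.exp (-(c * bohrNorm Γ z)) := by
    have := sum_mul_exp_neg_ge (e := fun _ => 1) hτ hr (by simp)
      fun x => mul_nonneg hc (bohrNorm_nonneg Γ x)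
    simpa [hτ1] using this
  have h2 : 0 ≤ ∑ y, bohrWeight Γ c y * e y :=
    sum_nonneg fun y _ => mul_nonneg (bohrWeight_pos _ _ _).le (he y)
  refine (mul_le_mul_of_nonneg_right h1 h2).trans ?_
  have h4 : ∑ y, bohrWeight Γ c y * ∑ z, τ z * e (y + z) =
      ∑ z, ∑ y, bohrWeight Γ c y * (τ z * e (y + z)) := by
    rw [sum_comm]
    exact sum_congr rfl fun y _ => mul_sum _ _ _
  rw [h4, sum_mul]
  refine sum_le_sum fun z _ => ?_
  rw [mul_sum, ← Equiv.sum_comp (Equiv.addRight z)]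
  refine sum_le_sum fun y _ => ?_
  simp only [Equiv.coe_addRight]
  have h3 : Real.exp (-(c * bohrNorm Γ z)) * bohrWeight Γ c (y + z) ≤ bohrWeight Γ c y := by
    simpa using le_bohrWeight_add Γ hc (y + z) (-z)
  calc τ z * Real.exp (-(c * bohrNorm Γ z)) * (bohrWeight Γ c (y + z) * e (y + z))
      = τ z * e (y + z) * (Real.exp (-(c * bohrNorm Γ z)) * bohrWeight Γ c (y + z)) := by ring
    _ ≤ τ z * e (y + z) * bohrWeight Γ c y :=
        mul_le_mul_of_nonneg_left h3 (mul_nonneg (hτ z) (he _))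
    _ = _ := by ring

/-- If no translate has large density with respect to three narrow measures, some translate has
simultaneously almost full density with respect to all of them. -/
lemma exists_translate_density (Γ : Finset (AddChar G ℂ)) {c r U : ℝ} (hc : 0 ≤ c)
    {τ : Fin 3 → G → ℝ} {e : G → ℝ} (hτ : ∀ i x, 0 ≤ τ i x) (hτ1 : ∀ i, ∑ x, τ i x = 1)
    (hr : ∀ i, ∑ x, τ i x * (Real.exp (c * bohrNorm Γ x) - 1) ≤ r) (he : ∀ x, 0 ≤ e x)
    (hU : ∀ i y, ∑ z, τ i z * e (y + z) ≤ U) :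
    ∃ y, ∀ i, 3 * (1 - r) * ∑ y, bohrWeight Γ c y * e y - 2 * U ≤ ∑ z, τ i z * e (y + z) := by
  obtain ⟨y, hy⟩ : ∃ y, 3 * (1 - r) * ∑ y, bohrWeight Γ c y * e y ≤
      ∑ i, ∑ z, τ i z * e (y + z) := by
    by_contra! hcon
    have h1 : ∑ y, bohrWeight Γ c y * ∑ i, ∑ z, τ i z * e (y + z) <
        ∑ y, bohrWeight Γ c y * (3 * (1 - r) * ∑ y, bohrWeight Γ c y * e y) :=
      sum_lt_sum_of_nonempty ⟨0, mem_univ _⟩ fun y _ =>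
        mul_lt_mul_of_pos_left (hcon y) (bohrWeight_pos _ _ _)
    rw [← sum_mul, sum_bohrWeight] at h1
    simp_rw [mul_sum (s := (univ : Finset (Fin 3)))] at h1
    rw [sum_comm] at h1
    have h2 := sum_le_sum fun i (_ : i ∈ (univ : Finset (Fin 3))) =>
      le_sum_translate_density Γ hc (hτ i) (hτ1 i) (hr i) he
    simp at h2
    linarith
  refine ⟨y, fun i => ?_⟩
  rw [Fin.sum_univ_three] at hy
  have h0 := hU 0 y
  have h1 := hU 1 y
  have h2 := hU 2 y
  fin_cases i <;> simp only [Fin.zero_eta, Fin.mk_one, Fin.reduceFinMk] <;> linarith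

end Averaging

section Doubling

variable {G : Type*} [AddCommGroup G] [Fintype G]

open Classical in
/-- The characters of `Γ` precomposed with halving. -/
noncomputable def halvedChars (d : G ≃+ G) (Γ : Finset (AddChar G ℂ)) : Finset (AddChar G ℂ) :=
  Γ.image fun γ => γ.compAddMonoidHom d.symm.toAddMonoidHom

lemma card_halvedChars_le (d : G ≃+ G) (Γ : Finset (AddChar G ℂ)) :
    #(halvedChars d Γ) ≤ #Γ := card_image_le

lemma bohrNorm_halvedChars (d : G ≃+ G) (Γ : Finset (AddChar G ℂ)) (x : G) :
    bohrNorm (halvedChars d Γ) (d x) = bohrNorm Γ x := by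
  classical
  rw [bohrNorm, halvedChars, sum_image]
  · simp [bohrNorm]
  · intro γ _ γ' _ h
    ext y
    have := DFunLike.congr_fun h (d y)
    simpa using this

lemma bohrMass_halvedChars (d : G ≃+ G) (Γ : Finset (AddChar G ℂ)) (c : ℝ) :
    bohrMass (halvedChars d Γ) c = bohrMass Γ c := by
  rw [bohrMass, ← d.toEquiv.sum_comp]
  simp [bohrMass, bohrNorm_halvedChars]

lemma bohrWeight_halvedChars (d : G ≃+ G) (Γ : Finset (AddChar G ℂ)) (c : ℝ) (x : G) :
    bohrWeight (halvedChars d Γ) c (d x) = bohrWeight Γ c x := by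
  rw [bohrWeight, bohrWeight, bohrNorm_halvedChars, bohrMass_halvedChars]

lemma bohrNorm_le_two_mul_halvedChars {d : G ≃+ G} (hd : ∀ x, d x = x + x)
    (Γ : Finset (AddChar G ℂ)) (x : G) :
    bohrNorm Γ x ≤ 2 * bohrNorm (halvedChars d Γ) x := by
  obtain ⟨y, rfl⟩ := d.surjective x
  rw [bohrNorm_halvedChars, hd]
  linarith [bohrNorm_add_le Γ y y]

end Doubling

section Moments

variable {G : Type*} [AddCommGroup G] [Fintype G]

lemma sum_mul_sub_le (f g : G → ℝ) (s : G) (hfg : ∑ x, f x ^ 2 = ∑ x, g x ^ 2) :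
    ∑ y, f y * g (s - y) ≤ ∑ x, f x ^ 2 := by
  have h1 : ∑ y, g (s - y) ^ 2 = ∑ x, g x ^ 2 := (Equiv.subLeft s).sum_comp fun x => g x ^ 2
  have h2 : ∑ y, f y * g (s - y) ≤ ∑ y, (f y ^ 2 + g (s - y) ^ 2) / 2 :=
    sum_le_sum fun y _ => by nlinarith [sq_nonneg (f y - g (s - y))]
  rw [← sum_div, sum_add_distrib, h1, ← hfg] at h2
  linarith

/-- The balanced function of a progression-free set correlates negatively with the set at
midpoints. -/
lemma sum_balanced_midpoint_le (Γ : Finset (AddChar G ℂ)) {c₁ c₂ α₁ α₂ B : ℝ} (hc₁ : 0 ≤ c₁)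
    (hc₂ : 0 ≤ c₂) {e : G → ℝ} (he : ∀ x, e x = 0 ∨ e x = 1)
    (hfree : ∀ x y z, e x ≠ 0 → e y ≠ 0 → e z ≠ 0 → x + y = z + z → x = z)
    (hα₁0 : 0 < α₁)
    (hα₁' : 0.99 * α₁ ≤ ∑ y, bohrWeight Γ (2 * c₁) y * e y)
    (hα₂ : ∑ y, bohrWeight Γ c₂ y * e y = α₂) (hα₂0 : 0 < α₂)
    (hB : ∑ y, bohrWeight Γ c₁ y ^ 2 = B)
    (hr : ∑ x, bohrWeight Γ c₂ x * (Real.exp (2 * c₁ * bohrNorm Γ x) - 1) ≤ 0.01 * α₂)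
    (hmass : 4 ≤ α₂ * α₁ ^ 2 * bohrMass Γ c₂) {f : G → ℝ}
    (hf : ∀ x, f x = e x * bohrWeight Γ c₁ x / α₁ - bohrWeight Γ c₁ x) :
    ∑ z, bohrWeight Γ c₂ z * e z * ∑ y, f y * f (z + z - y) ≤ -(α₂ * (B / 2)) := by
  obtain ⟨b, hb⟩ : ∃ b : G → ℝ, b = bohrWeight Γ c₁ := ⟨_, rfl⟩
  obtain ⟨β, hβ⟩ : ∃ b : G → ℝ, b = bohrWeight Γ c₂ := ⟨_, rfl⟩
  obtain ⟨a, ha⟩ : ∃ a : G → ℝ, a = fun x => e x * b x / α₁ := ⟨_, rfl⟩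
  have hb0 : ∀ x, 0 < b x := fun x => hb ▸ bohrWeight_pos _ _ _
  have hβ0 : ∀ x, 0 < β x := fun x => hβ ▸ bohrWeight_pos _ _ _
  have he0 : ∀ x, 0 ≤ e x := fun x => by rcases he x with h | h <;> simp [h]
  have he1 : ∀ x, e x ≤ 1 := fun x => by rcases he x with h | h <;> simp [h]
  have hesq : ∀ x, e x ^ 2 = e x := fun x => by rcases he x with h | h <;> simp [h]
  have ha0 : ∀ x, 0 ≤ a x := fun x => by
    rw [ha]; exact div_nonneg (mul_nonneg (he0 x) (hb0 x).le) hα₁0.le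
  have hB0 : 0 < B := by
    rw [← hB]
    exact sum_pos (fun x _ => pow_pos (bohrWeight_pos _ _ _) 2) ⟨0, mem_univ _⟩
  have hf' : ∀ x, f x = a x - b x := fun x => by rw [hf, ha, hb]
  rw [← hb] at hB
  rw [← hβ] at hα₂ hr ⊢
  have hab : 0.99 * B ≤ ∑ y, a y * b y := by
    have h1 : ∑ y, a y * b y = B * (∑ y, bohrWeight Γ (2 * c₁) y * e y) / α₁ := by
      rw [mul_sum, sum_div]
      refine sum_congr rfl fun y _ => ?_
      have := bohrWeight_sq_sum Γ c₁ y
      rw [← hb, hB] at this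
      rw [← mul_assoc, ← this, ha]
      ring
    rw [h1, le_div_iff₀ hα₁0]
    nlinarith
  have haa : ∑ z, β z * e z * ∑ y, a y * a (z + z - y) ≤ α₂ * B / 4 := by
    have h1 : ∀ z, β z * e z * ∑ y, a y * a (z + z - y) = β z * e z * (a z * a z) := by
      intro z
      by_cases hz : e z = 0
      · simp [hz]
      congr 1
      rw [sum_eq_single z]
      · simp
      · intro y _ hyz
        by_contra hne
        have hy : e y ≠ 0 := fun h => hne (by simp [ha, h])
        have hy' : e (z + z - y) ≠ 0 := fun h => hne (by simp [ha, h])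
        exact hyz (hfree y _ z hy hy' hz (by abel))
      · simp
    simp_rw [h1]
    have hm := bohrMass_pos Γ c₂
    have h2 : ∀ z, β z * e z * (a z * a z) ≤ α₂ / 4 * b z ^ 2 := by
      intro z
      have h3 : β z ≤ 1 / bohrMass Γ c₂ := hβ ▸ bohrWeight_le_inv_mass Γ hc₂ z
      have h4 : e z * (a z * a z) ≤ b z ^ 2 / α₁ ^ 2 := by
        rw [ha]
        rcases he z with h | h
        · simp only [h]; simp; positivity
        · simp only [h]; apply le_of_eq; ring
      have h5 : 0 ≤ e z * (a z * a z) := mul_nonneg (he0 z) (mul_nonneg (ha0 z) (ha0 z))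
      calc β z * e z * (a z * a z) = β z * (e z * (a z * a z)) := by ring
        _ ≤ 1 / bohrMass Γ c₂ * (b z ^ 2 / α₁ ^ 2) :=
            mul_le_mul h3 h4 h5 (by positivity)
        _ = 1 / (bohrMass Γ c₂ * α₁ ^ 2) * b z ^ 2 := by field_simp
        _ ≤ α₂ / 4 * b z ^ 2 := by
            refine mul_le_mul_of_nonneg_right ?_ (sq_nonneg _)
            rw [div_le_div_iff₀ (by positivity) (by norm_num)]
            nlinarith
    refine (sum_le_sum fun z _ => h2 z).trans ?_
    rw [← mul_sum, hB]
    linarith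
  have hE : 0.99 * α₂ ≤ ∑ z, β z * e z * Real.exp (-(2 * c₁ * bohrNorm Γ z)) := by
    have := sum_mul_exp_neg_ge (fun x => (hβ0 x).le) hr he1
      fun x => mul_nonneg (mul_nonneg zero_le_two hc₁) (bohrNorm_nonneg Γ x)
    rw [hα₂] at this
    linarith
  have hab2 : 0.98 * (α₂ * B) ≤ ∑ z, β z * e z * ∑ y, a y * b (z + z - y) := by
    have h1 : ∀ z, β z * e z * Real.exp (-(2 * c₁ * bohrNorm Γ z)) * (∑ y, a y * b y) ≤
        β z * e z * ∑ y, a y * b (z + z - y) := by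
      intro z
      rw [mul_assoc]
      refine mul_le_mul_of_nonneg_left ?_ (mul_nonneg (hβ0 z).le (he0 z))
      rw [mul_sum]
      refine sum_le_sum fun y _ => ?_
      rw [mul_left_comm]
      refine mul_le_mul_of_nonneg_left ?_ (ha0 y)
      have h2 := le_bohrWeight_add Γ hc₁ y (-(z + z))
      have h3 : bohrWeight Γ c₁ (y + -(z + z)) = b (z + z - y) := by
        rw [hb, ← bohrWeight_neg]; congr 1; abel
      rw [h3, bohrNorm_neg, ← hb] at h2
      refine le_trans (mul_le_mul_of_nonneg_right (Real.exp_le_exp.2 ?_) (hb0 y).le) h2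
      nlinarith [bohrNorm_add_le Γ z z]
    refine le_trans ?_ (sum_le_sum fun z _ => h1 z)
    rw [← sum_mul]
    calc 0.98 * (α₂ * B) ≤ 0.99 * α₂ * (0.99 * B) := by nlinarith [mul_pos hα₂0 hB0]
      _ ≤ _ := mul_le_mul hE hab (by positivity) (le_trans (by positivity) hE)
  have hba : ∀ z, ∑ y, b y * a (z + z - y) = ∑ y, a y * b (z + z - y) := by
    intro z
    rw [← (Equiv.subLeft (z + z)).sum_comp]
    exact sum_congr rfl fun y _ => by simp [mul_comm]
  have hbb : ∑ z, β z * e z * ∑ y, b y * b (z + z - y) ≤ α₂ * B := by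
    rw [← hα₂, sum_mul]
    refine sum_le_sum fun z _ => mul_le_mul_of_nonneg_left ?_ (mul_nonneg (hβ0 z).le (he0 z))
    rw [← hB]
    exact sum_mul_sub_le b b _ rfl
  have hexp : ∑ z, β z * e z * ∑ y, f y * f (z + z - y) =
      ∑ z, β z * e z * (∑ y, a y * a (z + z - y)) -
        2 * ∑ z, β z * e z * (∑ y, a y * b (z + z - y)) +
        ∑ z, β z * e z * ∑ y, b y * b (z + z - y) := by
    rw [mul_sum, ← sum_sub_distrib, ← sum_add_distrib]
    refine sum_congr rfl fun z _ => ?_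
    have : ∑ y, f y * f (z + z - y) = ∑ y, a y * a (z + z - y) - ∑ y, a y * b (z + z - y) -
        ∑ y, b y * a (z + z - y) + ∑ y, b y * b (z + z - y) := by
      rw [← sum_sub_distrib, ← sum_sub_distrib, ← sum_add_distrib]
      exact sum_congr rfl fun y _ => by rw [hf', hf']; ring
    rw [this, hba]
    ring
  rw [hexp]
  nlinarith [mul_pos hα₂0 hB0]

/-- A bound on a weighted mean from above by a negative number forces large even moments. -/
lemma le_sum_even_moment {ι : Type*} [Fintype ι] {w e F : ι → ℝ} {α X : ℝ} (hw : ∀ i, 0 ≤ w i)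
    (he0 : ∀ i, 0 ≤ e i) (he1 : ∀ i, e i ≤ 1) (hα : ∑ i, w i * e i = α) (hα0 : 0 < α)
    (hX : 0 ≤ X) (h : ∑ i, w i * e i * F i ≤ -(α * X)) {p : ℕ} (hp : Even p) :
    α * X ^ p ≤ ∑ i, w i * F i ^ p := by
  have h1 := Real.pow_arith_mean_le_arith_mean_pow_of_even univ (fun i => w i * e i / α) F
    (fun i _ => div_nonneg (mul_nonneg (hw i) (he0 i)) hα0.le)
    (by rw [← sum_div, hα, div_self hα0.ne']) hp
  have h2 : ∑ i, w i * e i / α * F i ≤ -X := by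
    have : ∑ i, w i * e i / α * F i = (∑ i, w i * e i * F i) / α := by
      rw [sum_div]; exact sum_congr rfl fun i _ => by ring
    rw [this, div_le_iff₀ hα0]
    linarith
  have h3 : X ^ p ≤ (∑ i, w i * e i / α * F i) ^ p := by
    rw [← hp.neg_pow (∑ i, w i * e i / α * F i)]
    exact pow_le_pow_left₀ hX (by linarith) p
  have h4 : ∑ i, w i * e i / α * F i ^ p ≤ (∑ i, w i * F i ^ p) / α := by
    rw [sum_div]
    refine sum_le_sum fun i _ => ?_
    have h5 : 0 ≤ F i ^ p := hp.pow_nonneg _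
    rw [div_mul_eq_mul_div]
    refine div_le_div_of_nonneg_right ?_ hα0.le
    have := mul_le_mul_of_nonneg_right (mul_le_of_le_one_right (hw i) (he1 i)) h5
    linarith
  have h6 := (h3.trans h1).trans h4
  rw [le_div_iff₀ hα0] at h6
  linarith

/-- Replacing a Bohr weight by differences of a narrow measure. -/
lemma exists_smoothed_moment (Γ : Finset (AddChar G ℂ)) {c : ℝ} (hc : 0 ≤ c) {ρ : G → ℝ}
    (hρ : ∀ x, 0 ≤ ρ x) (hρ1 : ∑ x, ρ x = 1) (hsupp : ∀ x, ρ x ≠ 0 → c * bohrNorm Γ x ≤ 1)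
    {F : G → ℝ} (hF : ∀ x, 0 ≤ F x) :
    ∃ s, Real.exp (-2) * ∑ t, bohrWeight Γ c t * F t ≤ ∑ u, ∑ v, ρ u * ρ v * F (s + v - u) := by
  by_contra! hcon
  have h1 : ∑ s, bohrWeight Γ c s * ∑ u, ∑ v, ρ u * ρ v * F (s + v - u) <
      ∑ s, bohrWeight Γ c s * (Real.exp (-2) * ∑ t, bohrWeight Γ c t * F t) :=
    sum_lt_sum_of_nonempty ⟨0, mem_univ _⟩ fun y _ =>
      mul_lt_mul_of_pos_left (hcon y) (bohrWeight_pos _ _ _)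
  rw [← sum_mul, sum_bohrWeight, one_mul] at h1
  refine absurd h1 (not_lt.2 ?_)
  have h2 : ∑ s, bohrWeight Γ c s * ∑ u, ∑ v, ρ u * ρ v * F (s + v - u) =
      ∑ u, ∑ v, ρ u * ρ v * ∑ s, bohrWeight Γ c s * F (s + v - u) := by
    simp_rw [mul_sum]
    rw [sum_comm]
    refine sum_congr rfl fun u _ => ?_
    rw [sum_comm]
    exact sum_congr rfl fun v _ => sum_congr rfl fun s _ => by ring
  rw [h2]
  have h3 : Real.exp (-2) * ∑ t, bohrWeight Γ c t * F t =
      ∑ u, ∑ v, ρ u * ρ v * (Real.exp (-2) * ∑ t, bohrWeight Γ c t * F t) := by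
    simp_rw [← sum_mul, ← mul_sum, hρ1]
    simp [hρ1]
  rw [h3]
  refine sum_le_sum fun u _ => sum_le_sum fun v _ => ?_
  by_cases hu : ρ u = 0
  · simp [hu]
  by_cases hv : ρ v = 0
  · simp [hv]
  refine mul_le_mul_of_nonneg_left ?_ (mul_nonneg (hρ u) (hρ v))
  rw [mul_sum, ← Equiv.sum_comp (Equiv.addRight (v - u))]
  refine sum_le_sum fun s _ => ?_
  simp only [Equiv.coe_addRight]
  rw [← mul_assoc, show s + (v - u) = s + v - u by abel]
  refine mul_le_mul_of_nonneg_right ?_ (hF _)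
  have h4 := le_bohrWeight_add Γ hc (s + v - u) (-(v - u))
  rw [show s + v - u + -(v - u) = s by abel, bohrNorm_neg] at h4
  refine le_trans (mul_le_mul_of_nonneg_right (Real.exp_le_exp.2 ?_) (bohrWeight_pos _ _ _).le) h4
  have h5 := bohrNorm_sub_le Γ v u
  have h6 := hsupp u hu
  have h7 := hsupp v hv
  nlinarith

/-- Large even moments of the autocorrelation of the balanced function of a progression-free
set. -/
lemma le_sum_balanced_moment {d : G ≃+ G} (hd : ∀ x, d x = x + x) (Γ : Finset (AddChar G ℂ))
    {c₂ α₂ X : ℝ} (hc₂ : 0 ≤ c₂) {e f ρ : G → ℝ} (he0 : ∀ x, 0 ≤ e x) (he1 : ∀ x, e x ≤ 1)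
    (hα₂ : ∑ y, bohrWeight Γ c₂ y * e y = α₂) (hα₂0 : 0 < α₂) (hX : 0 ≤ X)
    (h : ∑ z, bohrWeight Γ c₂ z * e z * ∑ y, f y * f (z + z - y) ≤ -(α₂ * X))
    (hρ : ∀ x, 0 ≤ ρ x) (hρ1 : ∑ x, ρ x = 1) (hρn : ∀ x, ρ (-x) = ρ x)
    (hsupp : ∀ x, ρ x ≠ 0 → c₂ * bohrNorm (halvedChars d Γ) x ≤ 1) {p : ℕ} (hp : Even p) :
    Real.exp (-2) * (α₂ * X ^ p) ≤
      ∑ u, ∑ v, ρ u * ρ v * (∑ y, f y * f (y + (v - u))) ^ p := by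
  have h1 := le_sum_even_moment (fun x => (bohrWeight_pos Γ c₂ x).le) he0 he1 hα₂ hα₂0 hX h hp
  obtain ⟨s, hs⟩ := exists_smoothed_moment (halvedChars d Γ) hc₂ hρ hρ1 hsupp
    (F := fun t => (∑ y, f y * f (t - y)) ^ p) fun x => hp.pow_nonneg _
  refine le_trans ?_ (sum_mul_conv_pow_le ρ f hρn s p)
  refine le_trans ?_ hs
  refine mul_le_mul_of_nonneg_left (h1.trans (le_of_eq ?_)) (Real.exp_pos _).le
  symm
  rw [← d.toEquiv.sum_comp]
  refine sum_congr rfl fun z _ => ?_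
  have : d.toEquiv z = d z := rfl
  rw [this, bohrWeight_halvedChars, hd]

end Moments

section PopularDifferences

variable {G : Type*} [AddCommGroup G] [Fintype G]

lemma sum_mul_shift_le_sum_sq (f g : G → ℝ) (w : G) :
    ∑ y, f y * g (y + w) ≤ (∑ y, f y ^ 2 + ∑ y, g y ^ 2) / 2 := by
  have h1 : ∑ y, g (y + w) ^ 2 = ∑ y, g y ^ 2 := Equiv.sum_comp (Equiv.addRight w) fun x => g x ^ 2
  rw [← h1, ← sum_add_distrib, sum_div]
  exact sum_le_sum fun y _ => by nlinarith [sq_nonneg (f y - g (y + w))]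

/-- A shift at which the balanced function has large autocorrelation is popular. -/
lemma le_autocorr_of_balanced (Γ : Finset (AddChar G ℂ)) {c B : ℝ} (hc : 0 ≤ c) {a : G → ℝ}
    (ha : ∀ x, 0 ≤ a x) (hB : ∑ y, bohrWeight Γ c y ^ 2 = B)
    (hab : 0.99 * B ≤ ∑ y, a y * bohrWeight Γ c y) {w : G} (hw : c * bohrNorm Γ w ≤ 0.01)
    (hf : B / 8 ≤ ∑ y, (a y - bohrWeight Γ c y) * (a (y + w) - bohrWeight Γ c (y + w))) :
    17 / 16 * B ≤ ∑ y, a y * a (y + w) := by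
  have hB0 : 0 ≤ B := hB ▸ sum_nonneg fun _ _ => sq_nonneg _
  have hexp : (0.99 : ℝ) ≤ Real.exp (-(c * bohrNorm Γ w)) := by
    linarith [Real.add_one_le_exp (-(c * bohrNorm Γ w))]
  have key : ∀ t : G, bohrNorm Γ t = bohrNorm Γ w →
      0.98 * B ≤ ∑ y, a y * bohrWeight Γ c (y + t) := by
    intro t ht
    have h1 : 0.99 * ∑ y, a y * bohrWeight Γ c y ≤ ∑ y, a y * bohrWeight Γ c (y + t) := by
      rw [mul_sum]
      refine sum_le_sum fun y _ => ?_
      rw [mul_left_comm]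
      refine mul_le_mul_of_nonneg_left ?_ (ha y)
      refine le_trans ?_ (le_bohrWeight_add Γ hc y t)
      rw [ht]
      exact mul_le_mul_of_nonneg_right hexp (bohrWeight_pos _ _ _).le
    linarith
  have h1 := key w rfl
  have h2 := key (-w) (by simp)
  have h3 : ∑ y, bohrWeight Γ c y * a (y + w) = ∑ y, a y * bohrWeight Γ c (y + -w) := by
    rw [← Equiv.sum_comp (Equiv.addRight (-w))]
    exact sum_congr rfl fun y _ => by simp [mul_comm]
  have h4 := sum_mul_shift_le_sum_sq (bohrWeight Γ c) (bohrWeight Γ c) w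
  rw [hB] at h4
  have h5 : ∑ y, (a y - bohrWeight Γ c y) * (a (y + w) - bohrWeight Γ c (y + w)) =
      ∑ y, a y * a (y + w) - ∑ y, a y * bohrWeight Γ c (y + w) -
        ∑ y, bohrWeight Γ c y * a (y + w) + ∑ y, bohrWeight Γ c y * bohrWeight Γ c (y + w) := by
    rw [← sum_sub_distrib, ← sum_sub_distrib, ← sum_add_distrib]
    exact sum_congr rfl fun y _ => by ring
  rw [h5, h3] at hf
  linarith

/-- A large even moment of the autocorrelation forces many shifts of large autocorrelation. -/
lemma le_sum_large_autocorr {f b ρ : G → ℝ} {α B : ℝ} (hα : 0 < α)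
    (hfb : ∀ x, |f x| ≤ b x / α) (hB : ∑ x, b x ^ 2 = B) (hB0 : 0 < B) (hρ : ∀ x, 0 ≤ ρ x)
    (hρ1 : ∑ x, ρ x = 1) {p : ℕ} (hp : Even p) (hp3 : 3 ≤ p)
    (h : (B / 4) ^ p ≤ ∑ u, ∑ v, ρ u * ρ v * (∑ y, f y * f (y + (v - u))) ^ p) :
    (1 / 4) ^ (p + 1) / 8 * α ^ (2 * (p + 1)) ≤
      ∑ u, ∑ v, if B / 8 ≤ ∑ y, f y * f (y + (v - u)) then ρ u * ρ v else 0 := by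
  obtain ⟨r, hr⟩ : ∃ r : G → ℝ, r = fun w => ∑ y, f y * f (y + w) := ⟨_, rfl⟩
  have hr' : ∀ w, ∑ y, f y * f (y + w) = r w := fun w => by rw [hr]
  simp_rw [hr'] at h ⊢
  have hrB : ∀ w, |r w| ≤ B / α ^ 2 := by
    intro w
    rw [hr]
    refine (abs_sum_le_sum_abs _ _).trans ?_
    have h1 : ∑ y, |f y * f (y + w)| ≤ (∑ y, b y * b (y + w)) / α ^ 2 := by
      rw [sum_div]
      refine sum_le_sum fun y _ => ?_
      rw [abs_mul]
      calc |f y| * |f (y + w)| ≤ b y / α * (b (y + w) / α) :=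
            mul_le_mul (hfb y) (hfb _) (abs_nonneg _) ((abs_nonneg _).trans (hfb y))
        _ = _ := by field_simp
    refine h1.trans (div_le_div_of_nonneg_right ?_ (by positivity))
    have := sum_mul_shift_le_sum_sq b b w
    rw [hB] at this
    linarith
  have hun := unbalancing (ι := G × G) (fun i => ρ i.1 * ρ i.2) (fun i => r (i.2 - i.1) / B)
    (fun i => mul_nonneg (hρ _) (hρ _))
    (by rw [Fintype.sum_prod_type]; simp_rw [← mul_sum, hρ1]; simp [hρ1])
    (L := 1 / α ^ 2)
    (fun i _ => by
      rw [abs_div, abs_of_pos hB0, div_le_iff₀ hB0]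
      refine (hrB _).trans (le_of_eq (by ring))) hp hp3
    (by
      rw [Fintype.sum_prod_type]
      simp_rw [div_pow]
      have h2 : ∑ x, ∑ y, ρ x * ρ y * (r (y - x) ^ p / B ^ p) =
          (∑ x, ∑ y, ρ x * ρ y * r (y - x) ^ p) / B ^ p := by
        simp_rw [sum_div]
        exact sum_congr rfl fun _ _ => sum_congr rfl fun _ _ => by ring
      rw [h2, le_div_iff₀ (by positivity), one_pow]
      rw [div_pow] at h
      refine le_trans (le_of_eq ?_) h
      ring)
    (by
      rw [Fintype.sum_prod_type]
      simp_rw [div_pow]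
      have h2 : ∑ x, ∑ y, ρ x * ρ y * (r (y - x) ^ (p + 1) / B ^ (p + 1)) =
          (∑ x, ∑ y, ρ x * ρ y * r (y - x) ^ (p + 1)) / B ^ (p + 1) := by
        simp_rw [sum_div]
        exact sum_congr rfl fun _ _ => sum_congr rfl fun _ _ => by ring
      rw [h2]
      refine div_nonneg ?_ (by positivity)
      rw [hr]
      exact sum_mul_corr_pow_nonneg ρ f (p + 1))
  rw [Fintype.sum_prod_type] at hun
  have h3 : ∀ w, (1 / 8 ≤ r w / B ↔ B / 8 ≤ r w) := fun w => by
    rw [le_div_iff₀ hB0]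
    constructor <;> intro h <;> linarith
  simp_rw [h3] at hun
  rw [div_pow (1 : ℝ) (α ^ 2), one_pow, ← pow_mul, one_div_mul_eq_div,
    le_div_iff₀ (by positivity)] at hun
  exact hun

end PopularDifferences

section Numerics

lemma exp_neg_sq_le_sift_mass {ℓ : ℕ} (hℓ : 2 ≤ ℓ) {α : ℝ} (hα : Real.exp (-ℓ) ≤ α) :
    Real.exp (-(16 * ℓ ^ 2)) ≤ (1 / 4) ^ (4 * ℓ + 1) / 8 * α ^ (2 * (4 * ℓ + 1)) := by
  have hL : (2 : ℝ) ≤ ℓ := by exact_mod_cast hℓ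
  have he := Real.exp_one_gt_d9
  have h4 : Real.exp (-2) ≤ 1 / 4 := by
    rw [Real.exp_neg, one_div]
    refine inv_anti₀ (by norm_num) ?_
    rw [show (2 : ℝ) = 1 + 1 by norm_num, Real.exp_add]
    nlinarith
  have h8 : Real.exp (-3) ≤ 1 / 8 := by
    rw [Real.exp_neg, one_div]
    refine inv_anti₀ (by norm_num) ?_
    rw [show (3 : ℝ) = 1 + 1 + 1 by norm_num, Real.exp_add, Real.exp_add]
    nlinarith [mul_pos (Real.exp_pos 1) (Real.exp_pos 1)]
  calc Real.exp (-(16 * ℓ ^ 2))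
      ≤ Real.exp ((4 * ℓ + 1 : ℕ) * (-2) + -3 + (2 * (4 * ℓ + 1) : ℕ) * (-ℓ)) := by
        refine Real.exp_le_exp.2 ?_
        push_cast
        nlinarith
    _ = Real.exp (-2) ^ (4 * ℓ + 1) * Real.exp (-3) * Real.exp (-ℓ) ^ (2 * (4 * ℓ + 1)) := by
        rw [Real.exp_add, Real.exp_add, Real.exp_nat_mul, Real.exp_nat_mul]
    _ ≤ (1 / 4) ^ (4 * ℓ + 1) * (1 / 8) * α ^ (2 * (4 * ℓ + 1)) := by gcongr
    _ = _ := by ring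

lemma thousand_le_exp_seven : (1000 : ℝ) ≤ Real.exp 7 := by
  have he := Real.exp_one_gt_d9
  calc (1000 : ℝ) ≤ 2.7 ^ 7 := by norm_num
    _ ≤ Real.exp 1 ^ 7 := by gcongr; linarith
    _ = Real.exp 7 := by rw [← Real.exp_nat_mul]; norm_num

lemma sift_threshold_pow_le {ℓ : ℕ} (hℓ : 2 ≤ ℓ) {q : ℝ} (hq : Real.exp (-(16 * ℓ ^ 2)) ≤ q) :
    (33 / 32 : ℝ) ^ (700 * ℓ ^ 2) ≤ 1 / 1000 * (q * (17 / 16) ^ (700 * ℓ ^ 2)) := by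
  have hL : (2 : ℝ) ≤ ℓ := by exact_mod_cast hℓ
  have h1 : Real.exp (1 / 34) ≤ 34 / 33 := by
    have h2 : (33 / 34 : ℝ) ≤ Real.exp (-(1 / 34)) := by
      linarith [Real.add_one_le_exp (-(1 / 34) : ℝ)]
    rw [Real.exp_neg] at h2
    have := inv_anti₀ (by norm_num) h2
    rw [inv_inv] at this
    norm_num at this ⊢
    exact this
  have h3 : Real.exp (20 * ℓ ^ 2) ≤ (34 / 33) ^ (700 * ℓ ^ 2) := by
    calc Real.exp (20 * ℓ ^ 2) ≤ Real.exp ((700 * ℓ ^ 2 : ℕ) * (1 / 34)) := by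
          refine Real.exp_le_exp.2 ?_
          push_cast
          nlinarith [sq_nonneg (ℓ : ℝ)]
      _ = Real.exp (1 / 34) ^ (700 * ℓ ^ 2) := Real.exp_nat_mul _ _
      _ ≤ _ := by gcongr
  have h4 : (1000 : ℝ) ≤ q * (34 / 33) ^ (700 * ℓ ^ 2) := by
    calc (1000 : ℝ) ≤ Real.exp 7 := thousand_le_exp_seven
      _ ≤ Real.exp (-(16 * ℓ ^ 2) + 20 * ℓ ^ 2) := by
          refine Real.exp_le_exp.2 ?_
          nlinarith
      _ = Real.exp (-(16 * ℓ ^ 2)) * Real.exp (20 * ℓ ^ 2) := Real.exp_add _ _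
      _ ≤ _ := mul_le_mul hq h3 (Real.exp_pos _).le ((Real.exp_pos _).le.trans hq)
  have h5 : (17 / 16 : ℝ) ^ (700 * ℓ ^ 2) =
      (33 / 32) ^ (700 * ℓ ^ 2) * (34 / 33) ^ (700 * ℓ ^ 2) := by
    rw [← mul_pow]; norm_num
  rw [h5]
  have h6 : (0 : ℝ) < (33 / 32) ^ (700 * ℓ ^ 2) := by positivity
  nlinarith

lemma two_exp_one_div_pow_le {ℓ : ℕ} (hℓ : 2 ≤ ℓ) {α : ℝ} (hα : Real.exp (-ℓ) ≤ α) :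
    2 * Real.exp 1 / α ^ (700 * ℓ ^ 2) ≤ Real.exp (701 * ℓ ^ 3) := by
  have hL : (2 : ℝ) ≤ ℓ := by exact_mod_cast hℓ
  have he := Real.exp_one_gt_d9
  have h1 : Real.exp (-(700 * ℓ ^ 3)) ≤ α ^ (700 * ℓ ^ 2) := by
    calc Real.exp (-(700 * ℓ ^ 3)) = Real.exp ((700 * ℓ ^ 2 : ℕ) * (-ℓ)) := by
          congr 1; push_cast; ring
      _ = Real.exp (-ℓ) ^ (700 * ℓ ^ 2) := Real.exp_nat_mul _ _
      _ ≤ _ := by gcongr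
  have h0 : (0 : ℝ) < α ^ (700 * ℓ ^ 2) := (Real.exp_pos _).trans_le h1
  rw [div_le_iff₀ h0]
  calc 2 * Real.exp 1 ≤ Real.exp 1 * Real.exp 1 := by nlinarith
    _ = Real.exp 2 := by rw [← Real.exp_add]; norm_num
    _ ≤ Real.exp (701 * ℓ ^ 3 + -(700 * ℓ ^ 3)) := by
        refine Real.exp_le_exp.2 ?_
        nlinarith [mul_le_mul hL hL (by norm_num) (by linarith), sq_nonneg (ℓ : ℝ)]
    _ = Real.exp (701 * ℓ ^ 3) * Real.exp (-(700 * ℓ ^ 3)) := Real.exp_add _ _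
    _ ≤ _ := by gcongr

lemma smoothing_error_le {ℓ : ℕ} (hℓ : 2 ≤ ℓ) :
    Real.exp (701 * ℓ ^ 3) * (((8 * ℓ : ℕ) : ℝ) * Real.exp (2 * ((8 * ℓ : ℕ) : ℝ)) *
      (40 * Real.exp (-((1 / (16000 * ℓ) : ℝ) ^ 2 *
        ((1024000000000 * ℓ ^ 5 : ℕ) : ℝ) / 4)))) ≤ 1 / 1000 := by
  have hL : (2 : ℝ) ≤ ℓ := by exact_mod_cast hℓ
  have he := Real.exp_one_gt_d9
  have h1 : (1 / (16000 * ℓ) : ℝ) ^ 2 * ((1024000000000 * ℓ ^ 5 : ℕ) : ℝ) / 4 = 1000 * ℓ ^ 3 := by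
    push_cast
    field_simp
    ring
  rw [h1]
  have h2 : (320000 : ℝ) ≤ Real.exp 14 := by
    calc (320000 : ℝ) ≤ (2.7 : ℝ) ^ 14 := by norm_num
      _ ≤ Real.exp 1 ^ 14 := by gcongr; linarith
      _ = Real.exp 14 := by rw [← Real.exp_nat_mul]; norm_num
  have h3 : (ℓ : ℝ) ≤ Real.exp ℓ := by linarith [Real.add_one_le_exp (ℓ : ℝ)]
  have h4 : (ℓ : ℝ) * (320000 * (Real.exp (701 * ℓ ^ 3) * Real.exp (2 * ((8 * ℓ : ℕ) : ℝ)) *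
      Real.exp (-(1000 * ℓ ^ 3)))) ≤ 1 := by
    calc (ℓ : ℝ) * (320000 * (Real.exp (701 * ℓ ^ 3) * Real.exp (2 * ((8 * ℓ : ℕ) : ℝ)) *
          Real.exp (-(1000 * ℓ ^ 3))))
        ≤ Real.exp ℓ * (Real.exp 14 * (Real.exp (701 * ℓ ^ 3) *
          Real.exp (2 * ((8 * ℓ : ℕ) : ℝ)) * Real.exp (-(1000 * ℓ ^ 3)))) := by gcongr
      _ = Real.exp (ℓ + (14 + (701 * ℓ ^ 3 + 2 * ((8 * ℓ : ℕ) : ℝ) + -(1000 * ℓ ^ 3)))) := by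
          simp only [Real.exp_add]
      _ ≤ Real.exp 0 := by
          refine Real.exp_le_exp.2 ?_
          push_cast
          nlinarith [mul_le_mul hL hL (by norm_num) (by linarith), sq_nonneg (ℓ : ℝ)]
      _ = 1 := Real.exp_zero
  push_cast at h4 ⊢
  linarith

lemma spectral_tail_le {ℓ : ℕ} (hℓ : 2 ≤ ℓ) {α : ℝ} (hα : Real.exp (-ℓ) ≤ α) :
    (1 / 4 : ℝ) ^ (8 * ℓ) * (1 / α ^ 2) ≤ 1 / 1000 := by
  have hL : (2 : ℝ) ≤ ℓ := by exact_mod_cast hℓ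
  have he := Real.exp_one_lt_d9
  have h1 : (1 / 4 : ℝ) ≤ Real.exp (-1) := by
    rw [Real.exp_neg, one_div]
    exact inv_anti₀ (Real.exp_pos _) (by linarith)
  have h2 : 1 / α ^ 2 ≤ Real.exp (2 * ℓ) := by
    have h0 : Real.exp (-(2 * ℓ)) ≤ α ^ 2 := by
      calc Real.exp (-(2 * ℓ)) = Real.exp ((2 : ℕ) * (-ℓ)) := by congr 1; push_cast; ring
        _ = Real.exp (-ℓ) ^ 2 := Real.exp_nat_mul _ _
        _ ≤ _ := by gcongr
    have := inv_anti₀ (Real.exp_pos _) h0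
    rw [Real.exp_neg, inv_inv] at this
    rwa [one_div]
  calc (1 / 4 : ℝ) ^ (8 * ℓ) * (1 / α ^ 2) ≤ Real.exp (-1) ^ (8 * ℓ) * Real.exp (2 * ℓ) := by
        gcongr
    _ = Real.exp ((8 * ℓ : ℕ) * (-1) + 2 * ℓ) := by rw [Real.exp_add, Real.exp_nat_mul]
    _ ≤ Real.exp (-7) := by
        refine Real.exp_le_exp.2 ?_
        push_cast
        linarith
    _ ≤ 1 / 1000 := by
        rw [Real.exp_neg, one_div]
        exact inv_anti₀ (by norm_num) thousand_le_exp_seven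

end Numerics

section Spectrum

variable {G : Type*} [AddCommGroup G] [Fintype G]

/-- Popular differences lead to a smooth measure whose large spectrum captures more than the
expected share of the energy of `a`. -/
lemma exists_measure_large_spectrum {ℓ : ℕ} (hℓ : 2 ≤ ℓ) {a b ρ β τ : G → ℝ} {α B : ℝ}
    (ha : ∀ x, 0 ≤ a x) (hb : ∀ x, 0 ≤ b x) (hα : Real.exp (-ℓ) ≤ α)
    (hab : ∀ x, a x ≤ b x / α) (hB : ∑ x, b x ^ 2 = B) (hB0 : 0 < B)
    (hρ : ∀ x, 0 ≤ ρ x) (hρ1 : ∑ x, ρ x = 1)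
    (hbρ : ∀ u, ρ u ≠ 0 → ∀ x, b (x + u) ≤ Real.exp (1 / (700 * ℓ ^ 2 : ℕ)) * b x)
    (hq : (1 / 4) ^ (4 * ℓ + 1) / 8 * α ^ (2 * (4 * ℓ + 1)) ≤
      ∑ u, ∑ v, if 17 / 16 * B ≤ ∑ y, a y * a (y + (v - u)) then ρ u * ρ v else 0)
    (hβ : ∀ x, 0 < β x) (hβ1 : ∑ x, β x = 1) (hρβ : ∀ x, ρ x ≤ 2 * β x)
    (hτ : ∀ x, 0 ≤ τ x) (hτ1 : ∑ x, τ x = 1)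
    (hτβ : ∀ t, τ t ≠ 0 → ∀ u, β (u + t) ≤ Real.exp 1 * β u ∧ β (u - t) ≤ Real.exp 1 * β u) :
    ∃ σ : G → ℝ, (∀ x, 0 ≤ σ x) ∧ ∑ x, σ x = 1 ∧
      (∀ x, σ x ≤ 2 * (Real.exp 1 * Real.exp (701 * ℓ ^ 3)) ^ (1024000000000 * ℓ ^ 5) * τ x) ∧
      1.02 * (Fintype.card G * B) ≤
        ∑ γ with 1 / 2 ≤ ‖fourierHat σ γ‖, ‖fourierHat a γ‖ ^ 2 := by
  classical
  have hℓ0 : 0 < ℓ := by omega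
  have hα0 : 0 < α := (Real.exp_pos _).trans_le hα
  have hL : (2 : ℝ) ≤ ℓ := by exact_mod_cast hℓ
  obtain ⟨r, hr⟩ : ∃ r : G → ℝ, r = fun w => ∑ y, a y * a (y + w) := ⟨_, rfl⟩
  have hr0 : ∀ w, 0 ≤ r w := fun w => by
    rw [hr]; exact sum_nonneg fun y _ => mul_nonneg (ha _) (ha _)
  obtain ⟨π, hπ, hπ1, hπρ, hπS⟩ := exists_sifted_measure a b ρ ha hb hρ hρ1
    (k := 700 * ℓ ^ 2) (δ := 1 / 1000) (t₁ := 33 / 32) (t₂ := 17 / 16) (by positivity) hα0 hab hB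
    hB0 hbρ (fun w => 33 / 32 * B < r w) (fun w hw => by rw [hr] at hw; exact not_lt.1 hw) hq
    (by norm_num) (by norm_num) (by norm_num) (by norm_num)
    (sift_threshold_pow_le hℓ (exp_neg_sq_le_sift_mass hℓ hα))
  obtain ⟨h, hh⟩ : ∃ h : G → ℝ, h = fun w => if 33 / 32 * B < r w then 1 else 0 := ⟨_, rfl⟩
  have hπβ : ∀ x, π x ≤ Real.exp (701 * ℓ ^ 3) * β x := by
    intro x
    calc π x ≤ Real.exp 1 / α ^ (700 * ℓ ^ 2) * ρ x := hπρ x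
      _ ≤ Real.exp 1 / α ^ (700 * ℓ ^ 2) * (2 * β x) := by
          gcongr
          exact hρβ x
      _ = 2 * Real.exp 1 / α ^ (700 * ℓ ^ 2) * β x := by ring
      _ ≤ _ := mul_le_mul_of_nonneg_right (two_exp_one_div_pow_le hℓ hα) (hβ x).le
  have hδ : 1 - 1 / 500 ≤ ∑ u, ∑ v, π u * π v * h (v - u) := by
    have h1 : ∑ u, ∑ v, π u * π v * h (v - u) +
        ∑ u, ∑ v, π u * π v * (if 33 / 32 * B < r (v - u) then 0 else 1) = 1 := by
      simp_rw [← sum_add_distrib]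
      have : ∀ u v, π u * π v * h (v - u) +
          π u * π v * (if 33 / 32 * B < r (v - u) then 0 else 1) = π u * π v := by
        intro u v
        rw [hh]
        dsimp only
        split_ifs <;> ring
      simp_rw [this, ← mul_sum, hπ1]
      simp [hπ1]
    linarith
  have hη : (0 : ℝ) < 1 / (16000 * ℓ) := by positivity
  obtain ⟨σ, Q, hσ, hσ1, hστ, hQ0, hQ1, hQ, hfin⟩ := exists_smoothing hβ hβ1 hπ hπ1 hτ hτ1
    (Real.exp_pos (701 * (ℓ : ℝ) ^ 3)) hπβ hτβ (h := h)
    (fun x => by rw [hh]; dsimp only; split_ifs <;> norm_num)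
    (fun x => by rw [hh]; dsimp only; split_ifs <;> norm_num) hη
    (by rw [div_le_one (by positivity)]; linarith)
    (m := 1024000000000 * ℓ ^ 5) (by positivity) (8 * ℓ) hδ
  refine ⟨σ, hσ, hσ1, hστ, ?_⟩
  have herr := smoothing_error_le hℓ
  have hη2 : 2 * ((8 * ℓ : ℕ) : ℝ) * (1 / (16000 * ℓ)) = 1 / 1000 := by
    push_cast
    field_simp
    norm_num
  have hT : 0.996 ≤ ∑ u, ∑ v, ∑ x, π u * π v * Q x * h (v - (u + x)) := by linarith
  have hT' : 1.021 * B + B / 1000 ≤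
      ∑ u, ∑ v, ∑ x, π u * π v * Q x * ∑ y, a y * a (y + (v - (u + x))) := by
    calc 1.021 * B + B / 1000 ≤ 33 / 32 * B * 0.996 := by linarith
      _ ≤ 33 / 32 * B * ∑ u, ∑ v, ∑ x, π u * π v * Q x * h (v - (u + x)) := by gcongr
      _ ≤ _ := by
          simp_rw [mul_sum (s := (univ : Finset G)) (a := 33 / 32 * B)]
          refine sum_le_sum fun u _ => sum_le_sum fun v _ => sum_le_sum fun x _ => ?_
          have h1 : 33 / 32 * B * h (v - (u + x)) ≤ r (v - (u + x)) := by
            rw [hh]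
            dsimp only
            split_ifs with hif
            · linarith
            · simpa using hr0 _
          have h2 : ∑ y, a y * a (y + (v - (u + x))) = r (v - (u + x)) := by rw [hr]
          rw [h2]
          have := mul_le_mul_of_nonneg_left h1
            (mul_nonneg (mul_nonneg (hπ u) (hπ v)) (hQ0 x))
          linarith
  have hspec := le_sum_large_spectrum hπ hπ1 hQ hσ hσ1 hT'
  have hcard : (0 : ℝ) < Fintype.card G := by exact_mod_cast Fintype.card_pos
  have ha2 : ∑ y, a y ^ 2 ≤ B * (1 / α ^ 2) := by
    rw [← hB, sum_mul]
    refine sum_le_sum fun y _ => ?_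
    calc a y ^ 2 ≤ (b y / α) ^ 2 := pow_le_pow_left₀ (ha y) (hab y) 2
      _ = _ := by ring
  have htail : (1 / 4 : ℝ) ^ (8 * ℓ) * (Fintype.card G * ∑ y, a y ^ 2) ≤
      Fintype.card G * (B / 1000) := by
    calc (1 / 4 : ℝ) ^ (8 * ℓ) * (Fintype.card G * ∑ y, a y ^ 2)
        ≤ (1 / 4 : ℝ) ^ (8 * ℓ) * (Fintype.card G * (B * (1 / α ^ 2))) := by gcongr
      _ = Fintype.card G * B * ((1 / 4 : ℝ) ^ (8 * ℓ) * (1 / α ^ 2)) := by ring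
      _ ≤ Fintype.card G * B * (1 / 1000) := by
          gcongr
          exact spectral_tail_le hℓ hα
      _ = _ := by ring
  have := mul_pos hcard hB0
  nlinarith

end Spectrum

section Increment

variable {G : Type*} [AddCommGroup G] [Fintype G]

lemma one_sub_le_norm_fourierHat {τ : G → ℝ} (hτ : ∀ x, 0 ≤ τ x) (hτ1 : ∑ x, τ x = 1)
    {γ : AddChar G ℂ} {s : ℝ} (h : ∑ t, τ t * ‖1 - γ t‖ ≤ s) : 1 - s ≤ ‖fourierHat τ γ‖ := by
  have h1 : (1 : ℂ) - fourierHat τ γ = ∑ t, (τ t : ℂ) * (1 - γ t) := by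
    have : (1 : ℂ) = ∑ t, (τ t : ℂ) := by
      rw [← Complex.ofReal_sum, hτ1, Complex.ofReal_one]
    rw [fourierHat, this, ← sum_sub_distrib]
    rw [← this]
    exact sum_congr rfl fun t _ => by ring
  have h2 : ‖(1 : ℂ) - fourierHat τ γ‖ ≤ s := by
    rw [h1]
    refine (norm_sum_le _ _).trans (le_trans (le_of_eq ?_) h)
    refine sum_congr rfl fun t _ => ?_
    rw [norm_mul, Complex.norm_real, Real.norm_of_nonneg (hτ t)]
  have h3 := norm_sub_norm_le (1 : ℂ) (fourierHat τ γ)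
  rw [norm_one] at h3
  linarith

/-- If `τ` is nearly invariant under the characters carrying the energy of the normalised
restriction of a set, then the set has increased density with respect to a translate of `τ`. -/
lemma le_density_of_large_spectrum (Γ : Finset (AddChar G ℂ)) {c α B D r : ℝ} (hc : 0 ≤ c)
    (hα : 0 < α) {a e τ : G → ℝ} (he0 : ∀ x, 0 ≤ e x) (he1 : ∀ x, e x ≤ 1)
    (ha : ∀ x, a x = e x * bohrWeight Γ c x / α) (hB : ∑ x, bohrWeight Γ c x ^ 2 = B)
    (hτ : ∀ x, 0 ≤ τ x) (hτ1 : ∑ x, τ x = 1) (hτn : ∀ x, τ (-x) = τ x)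
    (hr1 : r ≤ 1 / 100000) (hr : ∑ x, τ x * (Real.exp (c * bohrNorm Γ x) - 1) ≤ r)
    {Δ : Finset (AddChar G ℂ)} (hΔ : 1.02 * (Fintype.card G * B) ≤ ∑ γ ∈ Δ, ‖fourierHat a γ‖ ^ 2)
    (hτΔ : ∀ γ ∈ Δ, ∑ t, τ t * ‖1 - γ t‖ ≤ 8 * r)
    (hD : ∀ y, ∑ z, τ z * e (y + z) ≤ D) : 1.009 * α ≤ D + r := by
  have hB0 : 0 < B := by
    rw [← hB]
    exact sum_pos (fun x _ => pow_pos (bohrWeight_pos _ _ _) 2) ⟨0, mem_univ _⟩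
  have hcard : (0 : ℝ) < Fintype.card G := by exact_mod_cast Fintype.card_pos
  have hr0 : 0 ≤ r := by
    refine le_trans (sum_nonneg fun x _ => mul_nonneg (hτ x) ?_) hr
    have := mul_nonneg hc (bohrNorm_nonneg Γ x)
    simpa using this
  have hD0 : 0 ≤ D := (sum_nonneg fun z _ => mul_nonneg (hτ z) (he0 (0 + z))).trans (hD 0)
  have ha0 : ∀ x, 0 ≤ a x := fun x => by
    rw [ha]; exact div_nonneg (mul_nonneg (he0 x) (bohrWeight_pos _ _ _).le) hα.le
  have hconv : ∀ y, addConv a τ y ≤ bohrWeight Γ c y / α * (D + r) := by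
    intro y
    have h1 : addConv a τ y = ∑ t, a (y + t) * τ t := by
      rw [addConv, ← Equiv.sum_comp (Equiv.addLeft y)]
      exact sum_congr rfl fun t _ => by simp [hτn]
    have h2 : ∀ t, a (y + t) * τ t ≤ bohrWeight Γ c y / α *
        (τ t * e (y + t) + τ t * (Real.exp (c * bohrNorm Γ t) - 1)) := by
      intro t
      have h3 := bohrWeight_add_le Γ hc y t
      have h4 : 1 ≤ Real.exp (c * bohrNorm Γ t) :=
        Real.one_le_exp (mul_nonneg hc (bohrNorm_nonneg Γ t))
      have hb := bohrWeight_pos Γ c y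
      have h5 : e (y + t) * Real.exp (c * bohrNorm Γ t) ≤
          e (y + t) + (Real.exp (c * bohrNorm Γ t) - 1) := by nlinarith [he1 (y + t)]
      rw [ha]
      calc e (y + t) * bohrWeight Γ c (y + t) / α * τ t
          = τ t / α * (e (y + t) * bohrWeight Γ c (y + t)) := by ring
        _ ≤ τ t / α * (e (y + t) * (Real.exp (c * bohrNorm Γ t) * bohrWeight Γ c y)) := by
            have := he0 (y + t)
            have := hτ t
            gcongr
        _ = τ t / α * bohrWeight Γ c y * (e (y + t) * Real.exp (c * bohrNorm Γ t)) := by ring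
        _ ≤ τ t / α * bohrWeight Γ c y * (e (y + t) + (Real.exp (c * bohrNorm Γ t) - 1)) := by
            have := hτ t
            gcongr
        _ = _ := by ring
    rw [h1]
    refine (sum_le_sum fun t _ => h2 t).trans ?_
    rw [← mul_sum, sum_add_distrib]
    refine mul_le_mul_of_nonneg_left (add_le_add (hD y) hr) ?_
    exact div_nonneg (bohrWeight_pos _ _ _).le hα.le
  have hup : ∑ y, addConv a τ y ^ 2 ≤ (D + r) ^ 2 / α ^ 2 * B := by
    rw [← hB, mul_sum]
    refine sum_le_sum fun y _ => ?_
    refine (pow_le_pow_left₀ (addConv_nonneg ha0 hτ y) (hconv y) 2).trans (le_of_eq ?_)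
    ring
  have hlow : (1 - 8 * r) ^ 2 * (1.02 * (Fintype.card G * B)) ≤
      Fintype.card G * ∑ y, addConv a τ y ^ 2 := by
    rw [← sum_norm_fourierHat_sq]
    calc (1 - 8 * r) ^ 2 * (1.02 * (Fintype.card G * B))
        ≤ (1 - 8 * r) ^ 2 * ∑ γ ∈ Δ, ‖fourierHat a γ‖ ^ 2 := by gcongr
      _ = ∑ γ ∈ Δ, (1 - 8 * r) ^ 2 * ‖fourierHat a γ‖ ^ 2 := mul_sum _ _ _
      _ ≤ ∑ γ ∈ Δ, ‖fourierHat (addConv a τ) γ‖ ^ 2 := by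
          refine sum_le_sum fun γ hγ => ?_
          have h1 := one_sub_le_norm_fourierHat hτ hτ1 (hτΔ γ hγ)
          rw [fourierHat_addConv, norm_mul, mul_pow, mul_comm]
          have : 0 ≤ 1 - 8 * r := by linarith
          gcongr
      _ ≤ _ := sum_le_sum_of_subset_of_nonneg (subset_univ _) fun _ _ _ => sq_nonneg _
  have h1 : (1 - 8 * r) ^ 2 * 1.02 * (Fintype.card G * B) ≤
      (D + r) ^ 2 / α ^ 2 * (Fintype.card G * B) := by nlinarith
  have h2 := le_of_mul_le_mul_right h1 (mul_pos hcard hB0)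
  rw [le_div_iff₀ (by positivity)] at h2
  refine le_of_sq_le_sq ?_ (by positivity)
  have h3 : 1.009 ^ 2 ≤ (1 - 8 * r) ^ 2 * 1.02 := by nlinarith [sq_nonneg r]
  calc (1.009 * α) ^ 2 = 1.009 ^ 2 * α ^ 2 := by ring
    _ ≤ (1 - 8 * r) ^ 2 * 1.02 * α ^ 2 := by gcongr
    _ ≤ _ := h2

lemma log_smoothed_bound_le {ℓ : ℕ} (hℓ : 2 ≤ ℓ) :
    32 * Real.log (4 * (Real.exp 1 * Real.exp (701 * ℓ ^ 3)) ^ (1024000000000 * ℓ ^ 5)) ≤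
      24000000000000000 * ℓ ^ 8 := by
  have hL : (2 : ℝ) ≤ ℓ := by exact_mod_cast hℓ
  have h4 : Real.log 4 ≤ 3 := by
    have := Real.log_le_sub_one_of_pos (show (0 : ℝ) < 4 by norm_num)
    linarith
  rw [Real.log_mul (by norm_num) (by positivity), Real.log_pow, ← Real.exp_add, Real.log_exp]
  push_cast
  have h5 : (1 : ℝ) ≤ (ℓ : ℝ) ^ 8 := one_le_pow₀ (by linarith)
  have h6 : 8 * (ℓ : ℝ) ^ 5 ≤ (ℓ : ℝ) ^ 8 := by
    have : (8 : ℝ) ≤ (ℓ : ℝ) ^ 3 := by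
      calc (8 : ℝ) = 2 ^ 3 := by norm_num
        _ ≤ _ := by gcongr
    calc 8 * (ℓ : ℝ) ^ 5 ≤ (ℓ : ℝ) ^ 3 * (ℓ : ℝ) ^ 5 := by gcongr
      _ = _ := by ring
  have h7 : 1024000000000 * (ℓ : ℝ) ^ 5 * (1 + 701 * ℓ ^ 3) =
      1024000000000 * (ℓ : ℝ) ^ 5 + 1024000000000 * 701 * (ℓ : ℝ) ^ 8 := by ring
  rw [h7]
  linarith

lemma narrow_mono (Γ Γ' : Finset (AddChar G ℂ)) {c c' : ℝ} {τ : G → ℝ} (hτ : ∀ x, 0 ≤ τ x)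
    {r : ℝ} (hcc' : ∀ x, c * bohrNorm Γ x ≤ c' * bohrNorm Γ' x)
    (h : ∑ x, τ x * (Real.exp (c' * bohrNorm Γ' x) - 1) ≤ r) :
    ∑ x, τ x * (Real.exp (c * bohrNorm Γ x) - 1) ≤ r := by
  refine le_trans (sum_le_sum fun x _ => mul_le_mul_of_nonneg_left ?_ (hτ x)) h
  linarith [Real.exp_le_exp.2 (hcc' x)]

set_option maxHeartbeats 1000000 in
/-- One step of the density increment argument: a set without three-term progressions either has
increased density on a translate of a Bohr weight of slightly larger rank, or the current Bohr
weight is concentrated. -/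
lemma exists_density_increment {ℓ n : ℕ} (hℓ : 2 ≤ ℓ) {d : G ≃+ G} (hd : ∀ x, d x = x + x)
    (Γ : Finset (AddChar G ℂ)) {c₀ α : ℝ} (hc₀ : 1 ≤ c₀) {e : G → ℝ}
    (he : ∀ x, e x = 0 ∨ e x = 1)
    (hfree : ∀ x y z, e x ≠ 0 → e y ≠ 0 → e z ≠ 0 → x + y = z + z → x = z)
    (hα : ∑ y, bohrWeight Γ c₀ y * e y = α) (hαℓ : 2 * Real.exp (-ℓ) ≤ α)
    (hn : 2 * bohrConst * (#Γ + 24000000000000000 * ℓ ^ 8) * (100000 * Real.exp ℓ) ≤ n)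
    (hnℓ : 700 * ℓ ^ 2 ≤ n) (hn100 : 100 ≤ n)
    (hmass : 4 * Real.exp (3 * ℓ) ≤ bohrMass Γ ((4 * n) ^ 2 * c₀)) :
    ∃ (Γ' : Finset (AddChar G ℂ)) (x : G) (c : ℝ),
      (#Γ' : ℝ) ≤ #Γ + 24000000000000000 * ℓ ^ 8 ∧ 1 ≤ c ∧ c ≤ (4 * n) ^ 5 * c₀ ∧
      1.001 * α ≤ ∑ y, bohrWeight Γ' c y * e (x + y) := by
  classical
  by_contra! hcon
  have hL : (2 : ℝ) ≤ ℓ := by exact_mod_cast hℓ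
  have hn100' : (100 : ℝ) ≤ n := by exact_mod_cast hn100
  have hC := four_le_bohrConst
  have he0 : ∀ x, 0 ≤ e x := fun x => by rcases he x with h | h <;> simp [h]
  have he1 : ∀ x, e x ≤ 1 := fun x => by rcases he x with h | h <;> simp [h]
  have hεpos := Real.exp_pos (-(ℓ : ℝ))
  obtain ⟨R, hR⟩ : ∃ R : ℝ, R = 100000 * Real.exp ℓ := ⟨_, rfl⟩
  have hR1 : 100000 ≤ R := by
    rw [hR]; linarith [Real.one_le_exp (show (0 : ℝ) ≤ ℓ by positivity)]
  have hRinv : 1 / R = 1 / 100000 * Real.exp (-ℓ) := by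
    rw [hR, Real.exp_neg]; field_simp
  have hRinv' : 1 / R ≤ 1 / 100000 := one_div_le_one_div_of_le (by norm_num) hR1
  rw [← hR] at hn
  have hnΓ : ∀ Γ' : Finset (AddChar G ℂ), (#Γ' : ℝ) ≤ #Γ + 24000000000000000 * ℓ ^ 8 →
      2 * bohrConst * #Γ' * R ≤ n := fun Γ' h => le_trans (by gcongr) hn
  have hnΓ4 : ∀ Γ' : Finset (AddChar G ℂ), (#Γ' : ℝ) ≤ #Γ + 24000000000000000 * ℓ ^ 8 →
      4 * bohrConst * #Γ' ≤ (2 * n : ℕ) := by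
    intro Γ' h
    refine le_trans ?_ (show (n : ℝ) ≤ (2 * n : ℕ) by push_cast; linarith)
    refine le_trans ?_ (hnΓ Γ' h)
    have : (0 : ℝ) ≤ bohrConst * #Γ' := by positivity
    nlinarith
  have hΓ0 : (#Γ : ℝ) ≤ #Γ + 24000000000000000 * ℓ ^ 8 := by
    have : (0 : ℝ) ≤ (ℓ : ℝ) ^ 8 := by positivity
    linarith
  obtain ⟨c₁, hc₁⟩ : ∃ c, c = 4 * n * c₀ := ⟨_, rfl⟩
  obtain ⟨c₂, hc₂⟩ : ∃ c, c = 4 * n * c₁ := ⟨_, rfl⟩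
  obtain ⟨c₃, hc₃⟩ : ∃ c, c = 4 * n * c₂ := ⟨_, rfl⟩
  obtain ⟨c₄, hc₄⟩ : ∃ c, c = 4 * n * c₃ := ⟨_, rfl⟩
  obtain ⟨c₅, hc₅⟩ : ∃ c, c = 4 * n * c₄ := ⟨_, rfl⟩
  have hgrow : ∀ c : ℝ, 1 ≤ c → 400 * c ≤ 4 * n * c := fun c hc => by
    nlinarith [mul_le_mul_of_nonneg_right hn100' (zero_le_one.trans hc)]
  have h01 : 400 * c₀ ≤ c₁ := hc₁ ▸ hgrow _ hc₀
  have h12 : 400 * c₁ ≤ c₂ := hc₂ ▸ hgrow _ (by linarith)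
  have h23 : 400 * c₂ ≤ c₃ := hc₃ ▸ hgrow _ (by linarith)
  have h34 : 400 * c₃ ≤ c₄ := hc₄ ▸ hgrow _ (by linarith)
  have h45 : 400 * c₄ ≤ c₅ := hc₅ ▸ hgrow _ (by linarith)
  have hc₅' : (4 * n) ^ 5 * c₀ = c₅ := by rw [hc₅, hc₄, hc₃, hc₂, hc₁]; ring
  have hc₂' : (4 * n) ^ 2 * c₀ = c₂ := by rw [hc₂, hc₁]; ring
  rw [hc₂'] at hmass
  rw [hc₅'] at hcon
  have hn0 : 0 < n := by omega
  -- translate so that the densities at three scales are nearly full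
  have hnarrow : ∀ (Γ' : Finset (AddChar G ℂ)) (c c' : ℝ),
      (#Γ' : ℝ) ≤ #Γ + 24000000000000000 * ℓ ^ 8 → 0 < c → c' = 2 * n * c →
      ∑ x, bohrWeight Γ' c' x * (Real.exp (c * bohrNorm Γ' x) - 1) ≤ 1 / R := by
    rintro Γ' c c' hΓ' hc rfl
    exact sum_bohrWeight_exp_sub_one_le Γ' hc (by linarith) hn0 (hnΓ Γ' hΓ')
  have hnarrow0 : ∀ m c' : ℝ, 1 ≤ m → c' = 2 * n * (m * c₀) →
      ∑ x, bohrWeight Γ c' x * (Real.exp (c₀ * bohrNorm Γ x) - 1) ≤ 1 / R := by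
    intro m c' hm hc'
    refine narrow_mono Γ Γ (fun x => (bohrWeight_pos _ _ _).le) (fun x => ?_)
      (hnarrow Γ (m * c₀) c' hΓ0 (by positivity) hc')
    exact mul_le_mul_of_nonneg_right (by nlinarith) (bohrNorm_nonneg _ _)
  obtain ⟨x₀, hx₀⟩ := exists_translate_density Γ (c := c₀) (r := 1 / R) (U := 1.001 * α)
    (τ := ![bohrWeight Γ c₁, bohrWeight Γ (2 * c₁), bohrWeight Γ c₂]) (e := e) (by linarith)
    (by
      intro i x
      fin_cases i <;> exact (bohrWeight_pos _ _ _).le)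
    (by
      intro i
      fin_cases i <;> exact sum_bohrWeight _ _)
    (by
      intro i
      fin_cases i
      · exact hnarrow0 2 c₁ (by norm_num) (by rw [hc₁]; ring)
      · exact hnarrow0 4 (2 * c₁) (by norm_num) (by rw [hc₁]; ring)
      · exact hnarrow0 (2 * (4 * n)) c₂ (by linarith) (by rw [hc₂, hc₁]; ring)) he0
    (by
      intro i y
      fin_cases i
      · exact (hcon Γ y c₁ hΓ0 (by linarith) (by linarith)).le
      · exact (hcon Γ y (2 * c₁) hΓ0 (by linarith) (by linarith)).le
      · exact (hcon Γ y c₂ hΓ0 (by linarith) (by linarith)).le)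
  rw [hα] at hx₀
  obtain ⟨e', he'⟩ : ∃ e' : G → ℝ, e' = fun y => e (x₀ + y) := ⟨_, rfl⟩
  have hcon' : ∀ (Γ' : Finset (AddChar G ℂ)) (y : G) (c : ℝ),
      (#Γ' : ℝ) ≤ #Γ + 24000000000000000 * ℓ ^ 8 → 1 ≤ c → c ≤ c₅ →
      ∑ z, bohrWeight Γ' c z * e' (y + z) ≤ 1.001 * α := by
    intro Γ' y c h1 h2 h3
    rw [he']
    have := hcon Γ' (x₀ + y) c h1 h2 h3
    simp_rw [add_assoc] at this
    exact this.le
  have hα0 : 0 < α := by linarith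
  have hlow : 0.997 * α ≤ 3 * (1 - 1 / R) * α - 2 * (1.001 * α) := by
    linarith [mul_le_mul_of_nonneg_right hRinv' hα0.le]
  have hD₁ : 0.997 * α ≤ ∑ z, bohrWeight Γ c₁ z * e' z := by
    rw [he']; exact hlow.trans (hx₀ 0)
  have hD₁' : 0.997 * α ≤ ∑ z, bohrWeight Γ (2 * c₁) z * e' z := by
    rw [he']; exact hlow.trans (hx₀ 1)
  have hD₂ : 0.997 * α ≤ ∑ z, bohrWeight Γ c₂ z * e' z := by
    rw [he']; exact hlow.trans (hx₀ 2)
  have hU₁ : ∑ z, bohrWeight Γ c₁ z * e' z ≤ 1.001 * α := by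
    simpa using hcon' Γ 0 c₁ hΓ0 (by linarith) (by linarith)
  have he'01 : ∀ x, e' x = 0 ∨ e' x = 1 := fun x => by rw [he']; exact he _
  have he'0 : ∀ x, 0 ≤ e' x := fun x => by rw [he']; exact he0 _
  have he'1 : ∀ x, e' x ≤ 1 := fun x => by rw [he']; exact he1 _
  have hfree' : ∀ x y z, e' x ≠ 0 → e' y ≠ 0 → e' z ≠ 0 → x + y = z + z → x = z := by
    rw [he']
    intro x y z hx hy hz hxyz
    refine add_left_cancel (a := x₀) (hfree _ _ _ hx hy hz ?_)
    rw [add_add_add_comm, hxyz, add_add_add_comm]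
  obtain ⟨α₁, hα₁⟩ : ∃ α₁, α₁ = ∑ z, bohrWeight Γ c₁ z * e' z := ⟨_, rfl⟩
  obtain ⟨α₂, hα₂⟩ : ∃ α₂, α₂ = ∑ z, bohrWeight Γ c₂ z * e' z := ⟨_, rfl⟩
  rw [← hα₁] at hD₁ hU₁
  rw [← hα₂] at hD₂
  have hα₁0 : 0 < α₁ := by linarith
  have hα₂0 : 0 < α₂ := by linarith
  have hα₁ℓ : Real.exp (-ℓ) ≤ α₁ := by linarith
  have hα₂ℓ : Real.exp (-ℓ) ≤ α₂ := by linarith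
  have hα₁1 : α₁ ≤ 1 := by
    rw [hα₁, ← sum_bohrWeight Γ c₁]
    exact sum_le_sum fun x _ => mul_le_of_le_one_right (bohrWeight_pos _ _ _).le (he'1 x)
  obtain ⟨b, hb⟩ : ∃ b : G → ℝ, b = bohrWeight Γ c₁ := ⟨_, rfl⟩
  have hb0 : ∀ x, 0 < b x := fun x => hb ▸ bohrWeight_pos _ _ _
  obtain ⟨B, hB⟩ : ∃ B, B = ∑ x, b x ^ 2 := ⟨_, rfl⟩
  have hB0 : 0 < B := by
    rw [hB]
    exact sum_pos (fun x _ => pow_pos (hb0 x) 2) ⟨0, mem_univ _⟩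
  obtain ⟨a, ha⟩ : ∃ a : G → ℝ, a = fun x => e' x * b x / α₁ := ⟨_, rfl⟩
  have ha0 : ∀ x, 0 ≤ a x := fun x => by
    rw [ha]; exact div_nonneg (mul_nonneg (he'0 x) (hb0 x).le) hα₁0.le
  have hab : ∀ x, a x ≤ b x / α₁ := fun x => by
    rw [ha]
    exact div_le_div_of_nonneg_right (mul_le_of_le_one_left (hb0 x).le (he'1 x)) hα₁0.le
  obtain ⟨f, hf⟩ : ∃ f : G → ℝ, f = fun x => a x - b x := ⟨_, rfl⟩
  have hfb : ∀ x, |f x| ≤ b x / α₁ := by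
    intro x
    have h1 : b x ≤ b x / α₁ := by
      rw [le_div_iff₀ hα₁0]; exact mul_le_of_le_one_right (hb0 x).le hα₁1
    rw [hf, abs_le]
    constructor <;> dsimp only <;> linarith [ha0 x, hab x, hb0 x]
  have hB' : ∑ y, bohrWeight Γ c₁ y ^ 2 = B := by rw [hB, hb]
  have hα₁'99 : 0.99 * α₁ ≤ ∑ y, bohrWeight Γ (2 * c₁) y * e' y := by linarith
  have hmid := sum_balanced_midpoint_le Γ (c₁ := c₁) (c₂ := c₂) (by linarith) (by linarith)
    he'01 hfree' hα₁0 hα₁'99 hα₂.symm hα₂0 hB'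
    ((hnarrow Γ (2 * c₁) c₂ hΓ0 (by linarith) (by rw [hc₂]; ring)).trans (by
      rw [hRinv]; linarith))
    (by
      have h1 : Real.exp (-ℓ) * Real.exp (-ℓ) ^ 2 ≤ α₂ * α₁ ^ 2 := by gcongr
      have h2 : Real.exp (-ℓ) * Real.exp (-ℓ) ^ 2 * Real.exp (3 * ℓ) = 1 := by
        rw [← Real.exp_nat_mul, ← Real.exp_add, ← Real.exp_add, ← Real.exp_zero]
        congr 1; push_cast; ring
      calc (4 : ℝ) = Real.exp (-ℓ) * Real.exp (-ℓ) ^ 2 * (4 * Real.exp (3 * ℓ)) := by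
            linear_combination (-4) * h2
        _ ≤ α₂ * α₁ ^ 2 * bohrMass Γ c₂ := by gcongr)
    (f := f) (fun x => by rw [hf, ha, hb])
  -- the halved Bohr weights
  obtain ⟨Γ₁, hΓ₁⟩ : ∃ Γ₁, Γ₁ = halvedChars d Γ := ⟨_, rfl⟩
  have hΓ₁c : (#Γ₁ : ℝ) ≤ #Γ := by
    rw [hΓ₁]; exact_mod_cast card_halvedChars_le d Γ
  have hΓ₁2 : ∀ x, bohrNorm Γ x ≤ 2 * bohrNorm Γ₁ x := fun x => by
    rw [hΓ₁]; exact bohrNorm_le_two_mul_halvedChars hd Γ x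
  obtain ⟨ρ, hρ, hρ1, hρn, hρβ, hρs⟩ := exists_truncated_bohrWeight Γ₁ (c := c₂) (by linarith)
    (n := 2 * n) (by omega) (hnΓ4 Γ₁ (hΓ₁c.trans hΓ0))
  obtain ⟨τ, hτ, hτ1, hτn, hτβ, hτs⟩ := exists_truncated_bohrWeight Γ₁ (c := c₃) (by linarith)
    (n := 2 * n) (by omega) (hnΓ4 Γ₁ (hΓ₁c.trans hΓ0))
  have hc₃' : 2 * ((2 * n : ℕ) : ℝ) * c₂ = c₃ := by rw [hc₃]; push_cast; ring
  have hc₄' : 2 * ((2 * n : ℕ) : ℝ) * c₃ = c₄ := by rw [hc₄]; push_cast; ring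
  rw [hc₃'] at hρβ
  rw [hc₄'] at hτβ
  have hpe : Even (4 * ℓ) := by rw [Nat.even_mul]; left; decide
  have hmom := le_sum_balanced_moment hd Γ (c₂ := c₂) (X := B / 2) (by linarith) he'0 he'1
    hα₂.symm hα₂0 (by linarith) hmid hρ hρ1 hρn (by rw [← hΓ₁]; exact hρs) hpe
  have hmom' : (B / 4) ^ (4 * ℓ) ≤
      ∑ u, ∑ v, ρ u * ρ v * (∑ y, f y * f (y + (v - u))) ^ (4 * ℓ) := by
    refine le_trans ?_ hmom
    have h1 : (1 : ℝ) ≤ Real.exp (-2) * (α₂ * 2 ^ (4 * ℓ)) := by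
      have h2 : Real.exp (2 * ℓ) ≤ 2 ^ (4 * ℓ) := by
        calc Real.exp (2 * ℓ) = Real.exp 1 ^ (2 * ℓ) := by
              rw [← Real.exp_nat_mul]; push_cast; ring_nf
          _ ≤ 4 ^ (2 * ℓ) := by
              gcongr
              linarith [Real.exp_one_lt_d9]
          _ = 2 ^ (4 * ℓ) := by
              rw [show (4 : ℝ) = 2 ^ 2 by norm_num, ← pow_mul]; congr 1; ring
      calc (1 : ℝ) ≤ Real.exp (-2 + (-ℓ + 2 * ℓ)) := Real.one_le_exp (by linarith)
        _ = Real.exp (-2) * (Real.exp (-ℓ) * Real.exp (2 * ℓ)) := by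
            rw [Real.exp_add, Real.exp_add]
        _ ≤ _ := by gcongr
    calc (B / 4) ^ (4 * ℓ) = 1 * (B / 4) ^ (4 * ℓ) := (one_mul _).symm
      _ ≤ Real.exp (-2) * (α₂ * 2 ^ (4 * ℓ)) * (B / 4) ^ (4 * ℓ) := by gcongr
      _ = Real.exp (-2) * (α₂ * (2 * (B / 4)) ^ (4 * ℓ)) := by rw [mul_pow]; ring
      _ = _ := by congr 3; ring
  have hpop := le_sum_large_autocorr hα₁0 hfb hB.symm hB0 hρ hρ1 hpe (by omega) hmom'
  have hρ₁ : ∀ u, ρ u ≠ 0 → c₁ * bohrNorm Γ u ≤ 1 / (2 * n) := by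
    intro u hu
    have h1 := hρs u hu
    have h2 := hΓ₁2 u
    have h3 : c₁ * bohrNorm Γ u ≤ c₁ * (2 * bohrNorm Γ₁ u) :=
      mul_le_mul_of_nonneg_left h2 (by linarith)
    refine h3.trans ?_
    rw [le_div_iff₀ (by positivity)]
    rw [hc₂] at h1
    linarith
  have habB : 0.99 * B ≤ ∑ y, a y * bohrWeight Γ c₁ y := by
    have h1 : ∑ y, a y * bohrWeight Γ c₁ y =
        B * (∑ y, bohrWeight Γ (2 * c₁) y * e' y) / α₁ := by
      rw [mul_sum, sum_div]
      refine sum_congr rfl fun y _ => ?_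
      have := bohrWeight_sq_sum Γ c₁ y
      rw [hB'] at this
      rw [← mul_assoc, ← this, ha, hb]
      ring
    rw [h1, le_div_iff₀ hα₁0]
    linarith [mul_le_mul_of_nonneg_left hα₁'99 hB0.le]
  have hq : (1 / 4) ^ (4 * ℓ + 1) / 8 * α₁ ^ (2 * (4 * ℓ + 1)) ≤
      ∑ u, ∑ v, if 17 / 16 * B ≤ ∑ y, a y * a (y + (v - u)) then ρ u * ρ v else 0 := by
    refine hpop.trans (sum_le_sum fun u _ => sum_le_sum fun v _ => ?_)
    by_cases hu : ρ u = 0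
    · simp [hu]
    by_cases hv : ρ v = 0
    · simp [hv]
    by_cases hfuv : B / 8 ≤ ∑ y, f y * f (y + (v - u))
    · rw [if_pos hfuv, if_pos]
      refine le_autocorr_of_balanced Γ (c := c₁) (by linarith) ha0 hB' habB ?_ ?_
      · have h1 := hρ₁ u hu
        have h2 := hρ₁ v hv
        have h3 := bohrNorm_sub_le Γ v u
        have h4 : c₁ * bohrNorm Γ (v - u) ≤ c₁ * (bohrNorm Γ v + bohrNorm Γ u) :=
          mul_le_mul_of_nonneg_left h3 (by linarith)
        have h5 : 1 / (2 * (n : ℝ)) ≤ 1 / (2 * 100) :=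
          one_div_le_one_div_of_le (by norm_num) (by linarith)
        linarith
      · rw [hf, hb] at hfuv
        exact hfuv
    · rw [if_neg hfuv]
      split_ifs
      · exact mul_nonneg (hρ u) (hρ v)
      · exact le_rfl
  obtain ⟨σ, hσ, hσ1, hστ, hspec⟩ := exists_measure_large_spectrum hℓ ha0 (fun x => (hb0 x).le)
    hα₁ℓ hab hB.symm hB0 hρ hρ1
    (fun u hu x => by
      have h1 := bohrWeight_add_le Γ (c := c₁) (by linarith) x u
      rw [← hb] at h1
      refine h1.trans (mul_le_mul_of_nonneg_right (Real.exp_le_exp.2 ?_) (hb0 x).le)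
      refine (hρ₁ u hu).trans (one_div_le_one_div_of_le ?_ ?_)
      · exact_mod_cast (by positivity : 0 < 700 * ℓ ^ 2)
      · have : ((700 * ℓ ^ 2 : ℕ) : ℝ) ≤ n := by exact_mod_cast hnℓ
        linarith)
    hq (β := bohrWeight Γ₁ c₃) (fun x => bohrWeight_pos _ _ _) (sum_bohrWeight _ _) hρβ hτ hτ1
    (fun t ht u => by
      have h1 := Real.exp_le_exp.2 (hτs t ht)
      have h2 := bohrWeight_pos Γ₁ c₃ u
      exact ⟨(bohrWeight_add_le Γ₁ (by linarith) u t).trans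
          (mul_le_mul_of_nonneg_right h1 h2.le),
        (bohrWeight_sub_le Γ₁ (by linarith) u t).trans
          (mul_le_mul_of_nonneg_right h1 h2.le)⟩)
  obtain ⟨Λ, hΛ, hΛΔ⟩ := exists_chang_frequencies Γ₁ (c := c₄) (by linarith)
    (M := 4 * (Real.exp 1 * Real.exp (701 * ℓ ^ 3)) ^ (1024000000000 * ℓ ^ 5)) (by positivity)
    hσ hσ1 (fun x => (hστ x).trans (by
      refine (mul_le_mul_of_nonneg_left (hτβ x) (by positivity)).trans (le_of_eq ?_)
      ring))
  have hΛ' := hΛ.trans (log_smoothed_bound_le hℓ)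
  have hΓ₂ : (#(Γ₁ ∪ Λ) : ℝ) ≤ #Γ + 24000000000000000 * ℓ ^ 8 := by
    have : (#(Γ₁ ∪ Λ) : ℝ) ≤ #Γ₁ + #Λ := by exact_mod_cast card_union_le Γ₁ Λ
    linarith
  have hn5 := hnarrow (Γ₁ ∪ Λ) (2 * c₄) c₅ hΓ₂ (by linarith) (by rw [hc₅]; ring)
  have hfinal := le_density_of_large_spectrum Γ (c := c₁) (r := 1 / R) (D := 1.001 * α)
    (by linarith) hα₁0 he'0 he'1 (a := a) (fun x => by rw [ha, hb]) hB'
    (τ := bohrWeight (Γ₁ ∪ Λ) c₅) (fun x => (bohrWeight_pos _ _ _).le) (sum_bohrWeight _ _)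
    (bohrWeight_neg _ _) hRinv'
    (narrow_mono Γ (Γ₁ ∪ Λ) (fun x => (bohrWeight_pos _ _ _).le) (fun x => by
      have h1 := bohrNorm_mono (subset_union_left (s₁ := Γ₁) (s₂ := Λ)) x
      have h2 := hΓ₁2 x
      have h3 := bohrNorm_nonneg Γ x
      have h4 : bohrNorm Γ x ≤ 2 * bohrNorm (Γ₁ ∪ Λ) x := by linarith
      calc c₁ * bohrNorm Γ x ≤ c₄ * (2 * bohrNorm (Γ₁ ∪ Λ) x) :=
            mul_le_mul (by linarith) h4 h3 (by linarith)
        _ = _ := by ring) hn5)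
    hspec
    (fun γ hγ => by
      have hγ' := hΛΔ γ (mem_filter.1 hγ).2
      have h1 : ∀ t, bohrWeight (Γ₁ ∪ Λ) c₅ t * ‖1 - γ t‖ ≤ 8 * (bohrWeight (Γ₁ ∪ Λ) c₅ t *
          (Real.exp (2 * c₄ * bohrNorm (Γ₁ ∪ Λ) t) - 1)) := by
        intro t
        have h2 : c₄ * bohrNorm Γ₁ t + bohrNorm Λ t ≤ 2 * c₄ * bohrNorm (Γ₁ ∪ Λ) t := by
          have h3 := bohrNorm_mono (subset_union_left (s₁ := Γ₁) (s₂ := Λ)) t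
          have h4 := bohrNorm_mono (subset_union_right (s₁ := Γ₁) (s₂ := Λ)) t
          have h5 := bohrNorm_nonneg (Γ₁ ∪ Λ) t
          have h6 : c₄ * bohrNorm Γ₁ t ≤ c₄ * bohrNorm (Γ₁ ∪ Λ) t :=
            mul_le_mul_of_nonneg_left h3 (by linarith)
          have h7 : 1 * bohrNorm (Γ₁ ∪ Λ) t ≤ c₄ * bohrNorm (Γ₁ ∪ Λ) t :=
            mul_le_mul_of_nonneg_right (by linarith) h5
          linarith
        have h8 := (hγ' t).trans (mul_le_mul_of_nonneg_left
          (sub_le_sub_right (Real.exp_le_exp.2 h2) 1) (by norm_num))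
        have := mul_le_mul_of_nonneg_left h8 (bohrWeight_pos (Γ₁ ∪ Λ) c₅ t).le
        linarith
      refine (sum_le_sum fun t _ => h1 t).trans ?_
      rw [← mul_sum]
      linarith)
    (fun y => hcon' (Γ₁ ∪ Λ) y c₅ hΓ₂ (by linarith) le_rfl)
  rw [hRinv] at hfinal
  linarith

end Increment

section Iteration

variable {G : Type*} [AddCommGroup G] [Fintype G]

lemma bohrWeight_empty (c : ℝ) (x : G) :
    bohrWeight (∅ : Finset (AddChar G ℂ)) c x = 1 / Fintype.card G := by
  simp [bohrWeight, bohrMass]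

/-- Iterating the density increment as long as Bohr weights are not concentrated. -/
lemma exists_iterated_increment {ℓ n : ℕ} (hℓ : 2 ≤ ℓ) {d : G ≃+ G} (hd : ∀ x, d x = x + x)
    {e : G → ℝ} (he : ∀ x, e x = 0 ∨ e x = 1)
    (hfree : ∀ x y z, e x ≠ 0 → e y ≠ 0 → e z ≠ 0 → x + y = z + z → x = z)
    (havg : 2 * Real.exp (-ℓ) * Fintype.card G ≤ ∑ x, e x)
    (hn : 2 * bohrConst * (2000 * ℓ * (24000000000000000 * ℓ ^ 8)) * (100000 * Real.exp ℓ) ≤ n)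
    (hnℓ : 700 * ℓ ^ 2 ≤ n) (hn100 : 100 ≤ n)
    (hcard : (Real.exp bohrConst * (4 * n) ^ (10000 * ℓ + 2)) ^
      (2000 * ℓ * (24000000000000000 * ℓ ^ 8)) * (4 * Real.exp (3 * ℓ)) ≤ Fintype.card G) :
    ∀ i ≤ 2000 * ℓ, ∃ (Γ : Finset (AddChar G ℂ)) (x : G) (c : ℝ),
      #Γ ≤ i * (24000000000000000 * ℓ ^ 8) ∧ 1 ≤ c ∧ c ≤ (4 * n) ^ (5 * i) ∧
      1.001 ^ i * (2 * Real.exp (-ℓ)) ≤ ∑ y, bohrWeight Γ c y * e (x + y) := by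
  have hC := four_le_bohrConst
  have hn4 : (1 : ℝ) ≤ 4 * n := by
    have : (100 : ℝ) ≤ n := by exact_mod_cast hn100
    linarith
  intro i
  induction i with
  | zero =>
    intro _
    refine ⟨∅, 0, 1, by simp, le_rfl, by simp, ?_⟩
    simp_rw [bohrWeight_empty, zero_add, ← mul_sum]
    have hcard : (0 : ℝ) < Fintype.card G := by exact_mod_cast Fintype.card_pos
    rw [one_div_mul_eq_div, le_div_iff₀ hcard]
    simpa using havg
  | succ i ih =>
    intro hi
    obtain ⟨Γ, x, c, hΓ, hc1, hc, hdens⟩ := ih (by omega)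
    have hΓ' : (#Γ : ℝ) ≤ i * (24000000000000000 * ℓ ^ 8) := by exact_mod_cast hΓ
    have hi' : (i : ℝ) + 1 ≤ 2000 * ℓ := by exact_mod_cast hi
    have hmass : 4 * Real.exp (3 * ℓ) ≤ bohrMass Γ ((4 * n) ^ 2 * c) := by
      have h1 : (1 : ℝ) ≤ (4 * n) ^ 2 * c := one_le_mul_of_one_le_of_one_le (one_le_pow₀ hn4) hc1
      have h2 := hcard.trans (card_le_mul_bohrMass Γ h1)
      have h3 : (Real.exp bohrConst * ((4 * n) ^ 2 * c)) ^ #Γ ≤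
          (Real.exp bohrConst * (4 * n) ^ (10000 * ℓ + 2)) ^
            (2000 * ℓ * (24000000000000000 * ℓ ^ 8)) := by
        have h4 : ((4 * n) ^ 2 * c : ℝ) ≤ (4 * n) ^ (10000 * ℓ + 2) := by
          calc ((4 * n) ^ 2 * c : ℝ) ≤ (4 * n) ^ 2 * (4 * n) ^ (5 * i) := by gcongr
            _ = (4 * n) ^ (2 + 5 * i) := (pow_add _ _ _).symm
            _ ≤ _ := pow_le_pow_right₀ hn4 (by omega)
        have h5 : (1 : ℝ) ≤ Real.exp bohrConst := Real.one_le_exp (by linarith)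
        calc (Real.exp bohrConst * ((4 * n) ^ 2 * c)) ^ #Γ
            ≤ (Real.exp bohrConst * (4 * n) ^ (10000 * ℓ + 2)) ^ #Γ := by gcongr
          _ ≤ _ := by
              refine pow_le_pow_right₀ (one_le_mul_of_one_le_of_one_le h5 (one_le_pow₀ hn4)) ?_
              exact hΓ.trans (Nat.mul_le_mul_right _ (by omega))
      have h6 := h2.trans (mul_le_mul_of_nonneg_right h3 (bohrMass_pos _ _).le)
      exact le_of_mul_le_mul_left h6 (by positivity)
    have h2exp : 2 * Real.exp (-ℓ) ≤ ∑ y, bohrWeight Γ c y * e (x + y) := by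
      refine le_trans ?_ hdens
      exact le_mul_of_one_le_left (by positivity) (one_le_pow₀ (by norm_num))
    obtain ⟨Γ', x', c', hΓ'', hc'1, hc', hdens'⟩ := exists_density_increment hℓ hd Γ hc1
      (e := fun y => e (x + y)) (fun y => he _)
      (fun u v w hu hv hw h => add_left_cancel (hfree _ _ _ hu hv hw (by
        rw [add_add_add_comm, h, add_add_add_comm]))) rfl h2exp
      (by
        refine le_trans ?_ hn
        gcongr
        calc (#Γ : ℝ) + 24000000000000000 * ℓ ^ 8
            ≤ (i + 1) * (24000000000000000 * ℓ ^ 8) := by linarith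
          _ ≤ _ := by gcongr) hnℓ hn100 hmass
    refine ⟨Γ', x + x', c', ?_, hc'1, ?_, ?_⟩
    · have : (#Γ' : ℝ) ≤ ((i + 1 : ℕ) * (24000000000000000 * ℓ ^ 8) : ℕ) := by
        push_cast
        linarith
      exact_mod_cast this
    · calc c' ≤ (4 * n) ^ 5 * c := hc'
        _ ≤ (4 * n) ^ 5 * (4 * n) ^ (5 * i) := by gcongr
        _ = _ := by rw [← pow_add]; congr 1; ring
    · simp_rw [add_assoc]
      refine le_trans ?_ hdens'
      rw [pow_succ]
      linarith

lemma exp_le_pow (ℓ : ℕ) {k : ℕ} (hk : 2000 * ℓ ≤ k) : Real.exp ℓ ≤ 1.001 ^ k := by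
  have h1 : Real.exp (1 / 2000) ≤ 1.001 := by
    have h2 := Real.add_one_le_exp (-(1 / 2000) : ℝ)
    rw [Real.exp_neg] at h2
    refine (le_inv_of_le_inv₀ (by norm_num) h2).trans (by norm_num)
  have h3 : (2000 : ℝ) * ℓ ≤ k := by exact_mod_cast hk
  calc Real.exp ℓ ≤ Real.exp (k * (1 / 2000)) := Real.exp_le_exp.2 (by linarith)
    _ = Real.exp (1 / 2000) ^ k := Real.exp_nat_mul _ _
    _ ≤ _ := by gcongr

lemma card_lt_of_progression_free {ℓ n : ℕ} (hℓ : 2 ≤ ℓ) {d : G ≃+ G} (hd : ∀ x, d x = x + x)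
    {e : G → ℝ} (he : ∀ x, e x = 0 ∨ e x = 1)
    (hfree : ∀ x y z, e x ≠ 0 → e y ≠ 0 → e z ≠ 0 → x + y = z + z → x = z)
    (havg : 2 * Real.exp (-ℓ) * Fintype.card G ≤ ∑ x, e x)
    (hn : 2 * bohrConst * (2000 * ℓ * (24000000000000000 * ℓ ^ 8)) * (100000 * Real.exp ℓ) ≤ n)
    (hnℓ : 700 * ℓ ^ 2 ≤ n) (hn100 : 100 ≤ n) :
    Fintype.card G < (Real.exp bohrConst * (4 * n) ^ (10000 * ℓ + 2)) ^
      (2000 * ℓ * (24000000000000000 * ℓ ^ 8)) * (4 * Real.exp (3 * ℓ)) := by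
  by_contra! hcard
  obtain ⟨Γ, x, c, -, -, -, hdens⟩ := exists_iterated_increment hℓ hd he hfree havg hn hnℓ hn100
    hcard (2000 * ℓ) le_rfl
  have h1 : ∑ y, bohrWeight Γ c y * e (x + y) ≤ 1 := by
    rw [← sum_bohrWeight Γ c]
    refine sum_le_sum fun y _ => mul_le_of_le_one_right (bohrWeight_pos _ _ _).le ?_
    rcases he (x + y) with h | h <;> simp [h]
  have h2 := exp_le_pow ℓ le_rfl
  have h3 : (2 : ℝ) ≤ 1.001 ^ (2000 * ℓ) * (2 * Real.exp (-ℓ)) := by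
    calc (2 : ℝ) = Real.exp ℓ * (2 * Real.exp (-ℓ)) := by
          rw [mul_left_comm, ← Real.exp_add]; simp
      _ ≤ _ := by gcongr
  linarith

end Iteration

section Main

/-- In a finite abelian group with invertible doubling, a progression-free set of density
`2 exp (-ℓ)` forces the group to have size at most `exp (C ℓ ^ 11)`. -/
theorem exists_card_le_of_progression_free :
    ∃ C : ℝ, 0 < C ∧ ∀ ℓ : ℕ, 2 ≤ ℓ → ∀ (G : Type) [AddCommGroup G] [Fintype G] (d : G ≃+ G),
      (∀ x, d x = x + x) → ∀ e : G → ℝ, (∀ x, e x = 0 ∨ e x = 1) →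
      (∀ x y z, e x ≠ 0 → e y ≠ 0 → e z ≠ 0 → x + y = z + z → x = z) →
      2 * Real.exp (-ℓ) * Fintype.card G ≤ ∑ x, e x →
      (Fintype.card G : ℝ) ≤ Real.exp (C * ℓ ^ 11) := by
  have hC := four_le_bohrConst
  obtain ⟨A, hA⟩ : ∃ A : ℝ, A = 2 * bohrConst * (2000 * 24000000000000000) * 100000 := ⟨_, rfl⟩
  have hA1 : 1000 ≤ A := by rw [hA]; linarith
  obtain ⟨E, hE⟩ : ∃ E : ℝ, E = Real.log (8 * A) + 10 := ⟨_, rfl⟩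
  have hE0 : 0 < E := by
    rw [hE]; linarith [Real.log_nonneg (show 1 ≤ 8 * A by linarith)]
  refine ⟨48000000000000000000 * (bohrConst + 10002 * E) + 5, by positivity, ?_⟩
  intro ℓ hℓ G _ _ d hd e he hfree havg
  have hL : (2 : ℝ) ≤ ℓ := by exact_mod_cast hℓ
  have hL9 : (1 : ℝ) ≤ (ℓ : ℝ) ^ 9 := one_le_pow₀ (by linarith)
  have hexp1 : (1 : ℝ) ≤ Real.exp ℓ := Real.one_le_exp (by linarith)
  obtain ⟨n, hn⟩ : ∃ n : ℕ, n = ⌈A * ℓ ^ 9 * Real.exp ℓ⌉₊ := ⟨_, rfl⟩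
  have hnA : A * ℓ ^ 9 * Real.exp ℓ ≤ n := hn ▸ Nat.le_ceil _
  have hnA2 : (n : ℝ) ≤ 2 * (A * ℓ ^ 9 * Real.exp ℓ) := by
    have h1 : (n : ℝ) < A * ℓ ^ 9 * Real.exp ℓ + 1 := hn ▸ Nat.ceil_lt_add_one (by positivity)
    have h2 : 1 ≤ A * ℓ ^ 9 * Real.exp ℓ :=
      one_le_mul_of_one_le_of_one_le
        (one_le_mul_of_one_le_of_one_le (by linarith) hL9) hexp1
    linarith
  have hn1000 : 1000 * (ℓ : ℝ) ^ 2 ≤ n := by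
    refine le_trans ?_ hnA
    calc 1000 * (ℓ : ℝ) ^ 2 ≤ A * (ℓ : ℝ) ^ 9 * 1 := by
          rw [mul_one]
          gcongr
          · linarith
          · norm_num
      _ ≤ _ := by gcongr
  have hn4 : (4 * n : ℝ) ≤ Real.exp (E * ℓ) := by
    have h1 : (ℓ : ℝ) ≤ Real.exp ℓ := by linarith [Real.add_one_le_exp (ℓ : ℝ)]
    calc (4 * n : ℝ) ≤ 8 * A * (Real.exp ℓ ^ 9 * Real.exp ℓ) := by
          have : (ℓ : ℝ) ^ 9 * Real.exp ℓ ≤ Real.exp ℓ ^ 9 * Real.exp ℓ := by gcongr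
          have := mul_le_mul_of_nonneg_left this (show 0 ≤ A by linarith)
          linarith
      _ = Real.exp (Real.log (8 * A) + (10 : ℕ) * ℓ) := by
          rw [Real.exp_add, Real.exp_log (by linarith), Real.exp_nat_mul]
          ring
      _ ≤ _ := by
          refine Real.exp_le_exp.2 ?_
          have := Real.log_nonneg (show 1 ≤ 8 * A by linarith)
          rw [hE]
          push_cast
          nlinarith
  have hmain := card_lt_of_progression_free hℓ hd he hfree havg (n := n)
    (by
      refine le_trans (le_of_eq ?_) hnA
      rw [hA]; ring)
    (by
      have : ((700 * ℓ ^ 2 : ℕ) : ℝ) ≤ n := by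
        push_cast
        nlinarith
      exact_mod_cast this)
    (by
      have : ((100 : ℕ) : ℝ) ≤ n := by
        push_cast
        nlinarith
      exact_mod_cast this)
  refine hmain.le.trans ?_
  have h1 : Real.exp bohrConst * (4 * n) ^ (10000 * ℓ + 2) ≤
      Real.exp ((bohrConst + 10002 * E) * ℓ ^ 2) := by
    calc Real.exp bohrConst * (4 * n) ^ (10000 * ℓ + 2)
        ≤ Real.exp bohrConst * Real.exp (E * ℓ) ^ (10000 * ℓ + 2) := by gcongr
      _ = Real.exp (bohrConst + (10000 * ℓ + 2 : ℕ) * (E * ℓ)) := by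
          rw [Real.exp_add, Real.exp_nat_mul]
      _ ≤ _ := by
          refine Real.exp_le_exp.2 ?_
          push_cast
          have h2 : (1 : ℝ) ≤ (ℓ : ℝ) ^ 2 := one_le_pow₀ (by linarith)
          have h3 : E * ℓ ≤ E * (ℓ : ℝ) ^ 2 := by
            refine mul_le_mul_of_nonneg_left ?_ hE0.le
            nlinarith
          nlinarith
  have h4 : 4 * Real.exp (3 * ℓ) ≤ Real.exp (5 * ℓ ^ 11) := by
    have h5 : (4 : ℝ) ≤ Real.exp ℓ * Real.exp ℓ := by
      have : (2 : ℝ) ≤ Real.exp ℓ := by linarith [Real.add_one_le_exp (ℓ : ℝ)]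
      nlinarith
    calc 4 * Real.exp (3 * ℓ) ≤ Real.exp ℓ * Real.exp ℓ * Real.exp (3 * ℓ) := by gcongr
      _ = Real.exp (5 * ℓ) := by
          rw [← Real.exp_add, ← Real.exp_add]; congr 1; ring
      _ ≤ _ := by
          refine Real.exp_le_exp.2 ?_
          gcongr
          exact le_self_pow₀ (by linarith) (by norm_num)
  calc (Real.exp bohrConst * (4 * n) ^ (10000 * ℓ + 2)) ^
        (2000 * ℓ * (24000000000000000 * ℓ ^ 8)) * (4 * Real.exp (3 * ℓ))
      ≤ Real.exp ((bohrConst + 10002 * E) * ℓ ^ 2) ^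
        (2000 * ℓ * (24000000000000000 * ℓ ^ 8)) * Real.exp (5 * ℓ ^ 11) := by gcongr
    _ = Real.exp (((2000 * ℓ * (24000000000000000 * ℓ ^ 8) : ℕ) : ℝ) *
          ((bohrConst + 10002 * E) * ℓ ^ 2) + 5 * ℓ ^ 11) := by
        rw [Real.exp_add, Real.exp_nat_mul]
    _ = _ := by
        congr 1
        push_cast
        ring

/-- Doubling on a cyclic group of odd order. -/
noncomputable def doublingEquiv (N : ℕ) : ZMod (2 * N + 1) ≃+ ZMod (2 * N + 1) :=
  AddEquiv.ofBijective (AddMonoidHom.mulLeft 2) <| Finite.injective_iff_bijective.1 <| by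
    have h : IsUnit ((2 : ℕ) : ZMod (2 * N + 1)) := by
      rw [ZMod.isUnit_iff_coprime]
      simp
    intro x y hxy
    exact h.mul_left_cancel (by simpa using hxy)

lemma doublingEquiv_apply (N : ℕ) (x : ZMod (2 * N + 1)) : doublingEquiv N x = x + x := by
  simp [doublingEquiv, two_mul]

lemma card_le_of_progression_free_nat :
    ∃ C : ℝ, 0 < C ∧ ∀ ℓ : ℕ, 2 ≤ ℓ → ∀ (N : ℕ) (S : Finset ℕ), S ⊆ Finset.Icc 1 N →
      (¬ ∃ x d : ℕ, d ≠ 0 ∧ x ∈ S ∧ x + d ∈ S ∧ x + 2 * d ∈ S) →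
      2 * Real.exp (-ℓ) * (2 * N + 1) ≤ (#S : ℝ) → (2 * N + 1 : ℝ) ≤ Real.exp (C * ℓ ^ 11) := by
  classical
  obtain ⟨C, hC, h⟩ := exists_card_le_of_progression_free
  refine ⟨C, hC, fun ℓ hℓ N S hS hfree hdens => ?_⟩
  have hle : ∀ x ∈ S, x ≤ N := fun x hx => (mem_Icc.1 (hS hx)).2
  have hinj : ∀ x y : ℕ, x ≤ 2 * N → y ≤ 2 * N →
      (x : ZMod (2 * N + 1)) = y → x = y := by
    intro x y hx hy hxy
    rw [ZMod.natCast_eq_natCast_iff] at hxy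
    exact Nat.ModEq.eq_of_lt_of_lt hxy (by omega) (by omega)
  obtain ⟨T, hT⟩ : ∃ T : Finset (ZMod (2 * N + 1)),
      T = S.image fun x : ℕ => (x : ZMod _) := ⟨_, rfl⟩
  have hTcard : #T = #S := by
    rw [hT]
    exact card_image_of_injOn fun x hx y hy hxy =>
      hinj x y (by have := hle x hx; omega) (by have := hle y hy; omega) hxy
  have hne : ∀ x, (if x ∈ T then (1 : ℝ) else 0) ≠ 0 → ∃ a ∈ S, (a : ZMod (2 * N + 1)) = x := by
    intro x hx
    have : x ∈ T := by
      by_contra hcon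
      simp [hcon] at hx
    rw [hT] at this
    exact mem_image.1 this
  have := h ℓ hℓ (ZMod (2 * N + 1)) (doublingEquiv N) (doublingEquiv_apply N)
    (fun x => if x ∈ T then 1 else 0) (fun x => by by_cases hx : x ∈ T <;> simp [hx])
    (by
      intro x y z hx hy hz hxyz
      obtain ⟨a, ha, rfl⟩ := hne x hx
      obtain ⟨b, hb, rfl⟩ := hne y hy
      obtain ⟨c, hc, rfl⟩ := hne z hz
      have haN := hle a ha
      have hbN := hle b hb
      have hcN := hle c hc
      have habc : a + b = c + c := hinj _ _ (by omega) (by omega) (by exact_mod_cast hxyz)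
      rcases lt_trichotomy a c with hac | hac | hac
      · exact absurd ⟨a, c - a, by omega, ha, by rwa [show a + (c - a) = c by omega],
          by rwa [show a + 2 * (c - a) = b by omega]⟩ hfree
      · rw [hac]
      · exact absurd ⟨b, c - b, by omega, hb, by rwa [show b + (c - b) = c by omega],
          by rwa [show b + 2 * (c - b) = a by omega]⟩ hfree)
    (by
      rw [sum_ite_mem, univ_inter, sum_const, nsmul_eq_mul, mul_one, hTcard, ZMod.card]
      push_cast
      exact hdens)
  rw [ZMod.card] at this
  push_cast at this
  exact this

/-- Kelley–Meka: progression-free subsets of `{1,...,N}` have size at most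
`N · exp(−c (log N)^{1/11})`. -/
theorem kelley_meka :
    ∃ c : ℝ, 0 < c ∧ ∃ N₀ : ℕ, ∀ N : ℕ, N₀ < N →
      ∀ S : Finset ℕ, S ⊆ Finset.Icc 1 N →
        (¬ ∃ x d : ℕ, d ≠ 0 ∧ x ∈ S ∧ x + d ∈ S ∧ x + 2 * d ∈ S) →
        (S.card : ℝ) ≤ (N : ℝ) * Real.exp (-c * Real.log N ^ ((1 : ℝ) / 11)) := by
  obtain ⟨C, hC, h⟩ := card_le_of_progression_free_nat
  obtain ⟨c, hc⟩ : ∃ c : ℝ, c = 1 / (2 * (1 + C)) := ⟨_, rfl⟩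
  have hc0 : 0 < c := by rw [hc]; positivity
  refine ⟨c, hc0, ⌈Real.exp ((3 / c) ^ 11)⌉₊, fun N hN S hS hfree => ?_⟩
  have hNexp : Real.exp ((3 / c) ^ 11) < N := (Nat.le_ceil _).trans_lt (by exact_mod_cast hN)
  have hN0 : (0 : ℝ) < N := (Real.exp_pos _).trans hNexp
  have hN1 : (1 : ℝ) ≤ N := by
    have : 0 < N := by exact_mod_cast hN0
    exact_mod_cast this
  have hlog : (3 / c) ^ 11 < Real.log N := (Real.lt_log_iff_exp_lt hN0).2 hNexp
  have hlog0 : 0 ≤ Real.log N := Real.log_nonneg hN1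
  obtain ⟨t, ht⟩ : ∃ t : ℝ, t = Real.log N ^ ((1 : ℝ) / 11) := ⟨_, rfl⟩
  have ht0 : 0 ≤ t := ht ▸ Real.rpow_nonneg hlog0 _
  have ht11 : t ^ 11 = Real.log N := by
    rw [ht, ← Real.rpow_natCast, ← Real.rpow_mul hlog0]
    norm_num
  have hct : 3 ≤ c * t := by
    have h1 : 3 / c ≤ t := by
      refine le_of_lt (lt_of_pow_lt_pow_left₀ 11 ht0 ?_)
      rwa [ht11]
    rw [div_le_iff₀ hc0] at h1
    linarith
  rw [← ht]
  by_contra! hcon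
  obtain ⟨ℓ, hℓ⟩ : ∃ ℓ : ℕ, ℓ = ⌈c * t⌉₊ + 2 := ⟨_, rfl⟩
  have hℓ1 : c * t + 2 ≤ ℓ := by
    rw [hℓ]; push_cast; linarith [Nat.le_ceil (c * t)]
  have hℓ2 : (ℓ : ℝ) ≤ 2 * (c * t) := by
    rw [hℓ]; push_cast; linarith [Nat.ceil_lt_add_one (show 0 ≤ c * t by linarith)]
  have hdens : 2 * Real.exp (-ℓ) * (2 * N + 1) ≤ (#S : ℝ) := by
    refine le_trans ?_ hcon.le
    have h1 : 6 * Real.exp (-ℓ) ≤ Real.exp (-c * t) := by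
      have h2 : (6 : ℝ) ≤ Real.exp 2 := by
        rw [show (2 : ℝ) = 1 + 1 by norm_num, Real.exp_add]
        nlinarith [Real.exp_one_gt_d9]
      calc 6 * Real.exp (-ℓ) ≤ Real.exp 2 * Real.exp (-ℓ) := by gcongr
        _ = Real.exp (2 + -ℓ) := (Real.exp_add _ _).symm
        _ ≤ _ := Real.exp_le_exp.2 (by linarith)
    have h3 := Real.exp_pos (-(ℓ : ℝ))
    nlinarith
  have hfin := h ℓ (by omega) N S hS hfree hdens
  have hCℓ : C * (ℓ : ℝ) ^ 11 ≤ Real.log N := by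
    have h1 : 2 * c = 1 / (1 + C) := by rw [hc]; field_simp
    have h2 : (2 * c) ^ 11 ≤ 2 * c := by
      refine pow_le_of_le_one (by linarith) ?_ (by norm_num)
      rw [h1, div_le_one (by linarith)]
      linarith
    calc C * (ℓ : ℝ) ^ 11 ≤ C * (2 * (c * t)) ^ 11 := by gcongr
      _ = C * (2 * c) ^ 11 * t ^ 11 := by ring
      _ ≤ C * (2 * c) * t ^ 11 := by gcongr
      _ ≤ 1 * t ^ 11 := by
          gcongr
          rw [h1, mul_one_div, div_le_one (by linarith)]
          linarith
      _ = Real.log N := by rw [one_mul, ht11]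
  have := hfin.trans (Real.exp_le_exp.2 hCℓ)
  rw [Real.exp_log hN0] at this
  linarith

end Main
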